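/- Let $K$ be an algebraically closed field of characteristic $0$ that is complete with respect to a non-trivial absolute value $|\cdot|$, either non-archimedean or archimedean; in the archimedean case $|\cdot|$ is normalized by $|2|=2$, so that $K\cong\mathbb C$ with its usual absolute value. Let $f\in K(z)$ be a rational function of degree $d>1$. Notation. $\mathsf P^1$ is the Berkovich projective line over $K$ (equal to $\mathbb P^1=\mathbb P^1(K)$ if $K$ is archimedean). $\|\cdot\|$ is the maximum norm on $K^2$ if $K$ is non-archimedean and the Euclidean norm if $K$ is archimedean, $[z,w]=|p\wedge q|/(\|p\|\|q\|)$ is the normalized chordal metric on $\mathbb P^1$ ($p,q\in K^2\setminus\{0\}$ over $z,w$), and $[\cdot,\cdot]_{\mathrm{can}}$ is its extension to $\mathsf P^1$, the generalized Hsia kernel with respect to the Gauss point (in the archimedean case, $[\cdot,\cdot]$ itself). $\Omega_{\mathrm{can}}$ is the Dirac measure at the Gauss point if $K$ is non-archimedean and the normalized Fubini–Study area element if $K$ is archimedean, and $\Delta$ is the Laplacian on $\mathsf P^1$, normalized by $\Delta\log[\cdot,\mathcal S]_{\mathrm{can}}=\delta_{\mathcal S}-\Omega_{\mathrm{can}}$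 for every $\mathcal S\in\mathsf P^1$. For a continuous function $g$ on $\mathsf P^1$ put $\Phi_g(\mathcal S,\mathcal S')=\log[\mathcal S,\mathcal S']_{\mathrm{can}}-g(\mathcal S)-g(\mathcal S')\in[-\infty,\infty)$ and $U_{g,\nu}(\cdot)=\int_{\mathsf P^1}\Phi_g(\cdot,\mathcal S)\,d\nu(\mathcal S)$ for a Radon measure $\nu$ on $\mathsf P^1$, and let $V_g$ be the supremum of $\int\!\!\int\Phi_g\,d(\nu\times\nu)$ over all probability Radon measures $\nu$ on $\mathsf P^1$. For a non-degenerate homogeneous lift $F:K^2\to K^2$ of $f$ let $g_F=\lim_{n\to\infty}d^{-n}T_{F^n}$, where $T_{F^n}$ is the continuous extension to $\mathsf P^1$ of $\log\|F^n\|-d^n\log\|\cdot\|$. The equilibrium measure of $f$ is the probability Radon measure $\mu_f=\Delta g_F+\Omega_{\mathrm{can}}$, and the dynamical Green function $g_f$ is the unique continuous function on $\mathsf P^1$ with $\Delta g_f+\Omega_{\mathrm{can}}=\mu_f$ and $V_{g_f}=0$. Let $[f,\mathrm{Id}]_{\mathrm{can}}$ be the continuous extension to $\mathsf P^1$ of $z\mapsto[f(z),z]$,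 and $\Phi(f,\mathrm{Id})_{g_f}=\log[f,\mathrm{Id}]_{\mathrm{can}}-g_f\circ f-g_f$. Let $\mathrm{Fix}(f^n)$ and $C(f^n)$ be the sets of fixed points and of critical points of $f^n$ in $\mathbb P^1$, $\mathrm{SAT}(f)=\bigcup_{n\ge1}(\mathrm{Fix}(f^n)\cap C(f^n))$ the set of superattracting periodic points of $f$, and $[f=\mathrm{Id}]=\sum_{w\in\mathbb P^1:\,f(w)=w}\delta_w$, with each $w$ counted with its multiplicity as a root of $f=\mathrm{Id}$. Statement. For every critical point $c\in C(f)$: if $c\notin\mathrm{Fix}(f)$, then $$U_{g_f,[f=\mathrm{Id}]|(\mathsf P^1\setminus\mathrm{SAT}(f))}(c)+\int_{\mathsf P^1}\Phi(f,\mathrm{Id})_{g_f}\,d\mu_f=\Phi_{g_f}(f(c),c)-\int_{\mathrm{SAT}(f)}\Phi_{g_f}(c,\cdot)\,d[f=\mathrm{Id}];$$ and if $c\in\mathrm{Fix}(f)$, then $$U_{g_f,[f=\mathrm{Id}]|(\mathsf P^1\setminus\mathrm{SAT}(f))}(c)+\int_{\mathsf P^1}\Phi(f,\mathrm{Id})_{g_f}\,d\mu_f=-\int_{\mathrm{SAT}(f)\setminus\{c\}}\Phi_{g_f}(c,\cdot)\,d[f=\mathrm{Id}].$$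 -/

import Mathlib

open Polynomial MeasureTheory Filter Topology
open scoped ENNReal OnePoint

noncomputable section

namespace Berkovich

/-! ### Extended-real logarithm and integral -/

/-- `log t ∈ [-∞, ∞)` for `t ≥ 0`, with `log 0 = -∞`. -/
def elog (t : ℝ) : EReal := ENNReal.log (ENNReal.ofReal t)

/-- The integral `∫ φ⁺ dν - ∫ φ⁻ dν` of an extended-real valued function. -/
def eintegral {α : Type*} [MeasurableSpace α] (φ : α → EReal) (ν : Measure α) : EReal :=
  ((∫⁻ x, (φ x).toENNReal ∂ν : ℝ≥0∞) : EReal) - ((∫⁻ x, (-φ x).toENNReal ∂ν : ℝ≥0∞) : EReal)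

section Line

variable (K : Type*) [NontriviallyNormedField K]

/-! ### The Berkovich projective line -/

/-- The Berkovich affine line: multiplicative seminorms on `K[T]` extending the absolute value
of `K`. (If `K` is archimedean these are exactly `P ↦ |P(z)|`, `z ∈ K`.) -/
def A1 : Type _ := {x : MulRingSeminorm K[X] // ∀ a : K, x (C a) = ‖a‖}

variable {K}

/-- The value `|P|_x` of the seminorm `x` at the polynomial `P`. -/
def A1.val (x : A1 K) (P : K[X]) : ℝ := x.1 P

/-- The coarsest topology for which all `x ↦ |P|_x` are continuous. -/
instance : TopologicalSpace (A1 K) :=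
  TopologicalSpace.induced (fun (x : A1 K) (P : K[X]) => x.val P) inferInstance

variable (K) in
/-- The Berkovich projective line `𝖯¹`, the one-point compactification of the affine line. -/
abbrev P1 : Type _ := OnePoint (A1 K)

instance : MeasurableSpace (P1 K) := borel (P1 K)

instance : BorelSpace (P1 K) := ⟨rfl⟩

/-- The seminorm `P ↦ |P(a)|`. -/
def evalPt (a : K) : A1 K :=
  ⟨{ toFun := fun P => ‖P.eval a‖
     map_zero' := by simp
     add_le' := fun P Q => by simpa using norm_add_le (P.eval a) (Q.eval a)
     neg' := fun P => by simp
     map_one' := by simp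
     map_mul' := fun P Q => by simp }, fun b => by
      change ‖(C b).eval a‖ = ‖b‖
      simp⟩

/-- The embedding of the classical line `ℙ¹ = K ∪ {∞}` into `𝖯¹`. -/
def pt : OnePoint K → P1 K
  | ∞ => ∞
  | (a : K) => ((evalPt a : A1 K) : P1 K)

variable (K) in
/-- The Gauss (canonical) point, `|∑ aᵢ Tⁱ| = max |aᵢ|`. -/
def gaussPt [IsUltrametricDist K] : A1 K :=
  have hna : IsNonarchimedean (NormedField.toAbsoluteValue K) :=
    fun a b => IsUltrametricDist.isNonarchimedean_norm a b
  ⟨{ toFun := fun P => P.gaussNorm (NormedField.toAbsoluteValue K) 1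
     map_zero' := by simp
     add_le' := fun P Q =>
       (isNonarchimedean_gaussNorm _ hna zero_le_one P Q).trans
         (max_le_add_of_nonneg (gaussNorm_nonneg _ _ zero_le_one)
           (gaussNorm_nonneg _ _ zero_le_one))
     neg' := fun P => by simp only [gaussNorm, support_neg, coeff_neg, map_neg_eq_map]
     map_one' := by
       rw [← C_1, gaussNorm_C]
       simp
     map_mul' := fun P Q => gaussNorm_mul hna one_pos P Q }, fun a => by
      change (C a).gaussNorm (NormedField.toAbsoluteValue K) 1 = ‖a‖
      rw [gaussNorm_C]
      rfl⟩

/-! ### Norms, the chordal metric and its extension to `𝖯¹`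

A binary form `G(X, Y)` of degree `n` is represented by its dehomogenization `P = G(T, 1)`
together with `n`; its coefficient of `Xⁿ` is `P.coeff n`. -/

open Classical in
variable (K) in
/-- The norm on `K²` as a function of `a = |p₀|`, `b = |p₁|`: the maximum norm if `K` is
non-archimedean, the Euclidean norm if `K` is archimedean. -/
def norm2 (a b : ℝ) : ℝ := if IsUltrametricDist K then max a b else √(a ^ 2 + b ^ 2)

/-- The absolute value at `x ∈ 𝖯¹` of the form of degree `n` with dehomogenization `P`, with
respect to the coordinates `(T, 1)` at the points of the affine line and `(1, 0)` at `∞`. -/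
def formAbs (P : K[X]) (n : ℕ) : P1 K → ℝ
  | ∞ => ‖P.coeff n‖
  | (x : A1 K) => x.val P

/-- The norm `‖(X, Y)‖_x` of the coordinates used in `formAbs`. -/
def coordNorm (x : P1 K) : ℝ := norm2 K (formAbs (X : K[X]) 1 x) (formAbs (1 : K[X]) 1 x)

open Classical in
/-- If `K` is non-archimedean: the Hsia kernel, i.e. the infimum of the radii `r` of the discs
`{|T - a| ≤ r}` containing `x` and `y`.
If `K` is archimedean: the distance; for the classical points `x = z`, `y = w` the infimum of
`|z - a| + |w - a|` is `|z - w|`. -/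
def hsiaAff (x y : A1 K) : ℝ :=
  if IsUltrametricDist K then ⨅ a : K, max (x.val (X - C a)) (y.val (X - C a))
  else ⨅ a : K, (x.val (X - C a) + y.val (X - C a))

/-- The kernel `[x, y]_can` on `𝖯¹`: the generalized Hsia kernel with respect to the Gauss point
if `K` is non-archimedean, the normalized chordal metric if `K` is archimedean. -/
def hsia : P1 K → P1 K → ℝ
  | ∞, ∞ => 0
  | (x : A1 K), ∞ => 1 / coordNorm (x : P1 K)
  | ∞, (y : A1 K) => 1 / coordNorm (y : P1 K)
  | (x : A1 K), (y : A1 K) => hsiaAff x y / (coordNorm (x : P1 K) * coordNorm (y : P1 K))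

/-! ### The measure `Ω_can` and the Laplacian -/

/-- `σ` identifies `K`, with its absolute value, with `ℂ` and its usual absolute value. -/
def IsStdIso (σ : ℂ ≃+* K) : Prop := ∀ z, ‖σ z‖ = ‖z‖

/-- The Fubini-Study area element `dx dy / (π (1 + |z|²)²)`, of total mass one. -/
def fubiniStudy (σ : ℂ ≃+* K) : Measure (P1 K) :=
  ((volume : Measure ℂ).withDensity
    fun z => ENNReal.ofReal (1 / (Real.pi * (1 + ‖z‖ ^ 2) ^ 2))).map fun z => pt (σ z : OnePoint K)

open Classical in
variable (K) in
/-- `Ω_can`: the Dirac measure at the Gauss point if `K` is non-archimedean, the Fubini-Study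
area element if `K` is archimedean. -/
def omegaCan : Measure (P1 K) :=
  if h : IsUltrametricDist K then haveI := h; Measure.dirac ((gaussPt K : A1 K) : P1 K)
  else if h' : ∃ σ : ℂ ≃+* K, IsStdIso σ then fubiniStudy h'.choose
  else 0

/-- Smooth functions on `𝖯¹ = ℙ¹ = ℂ ∪ {∞}` (`K` archimedean), in the charts `z` and `1/z`. -/
def IsSmooth (σ : ℂ ≃+* K) (φ : P1 K → ℝ) : Prop :=
  ContDiff ℝ (⊤ : ℕ∞) (fun z : ℂ => φ (pt (σ z : OnePoint K))) ∧
  ContDiff ℝ (⊤ : ℕ∞) (fun w : ℂ => φ (pt (if w = 0 then ∞ else (σ w⁻¹ : OnePoint K))))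

/-- `Δ g = μ - ν` in the weak sense `∫ g dΔφ = ∫ φ dμ - ∫ φ dν` for all test functions `φ`.
If `K` is non-archimedean, the test functions are `φ = log [S, ·]_can`, `S ∈ 𝖯¹ \ ℙ¹`, with
`Δφ = δ_S - Ω_can`.
If `K` is archimedean, they are the smooth functions, with `Δφ = (1/2π) (∂²φ/∂x² + ∂²φ/∂y²) dx dy`;
then `Δ log [S, ·]_can = δ_S - Ω_can` for every `S`. -/
def HasLaplacian (g : P1 K → ℝ) (μ ν : Measure (P1 K)) : Prop :=
  (IsUltrametricDist K → ∀ S : P1 K, S ∉ Set.range (pt : OnePoint K → P1 K) →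
    g S - ∫ x, g x ∂(omegaCan K)
      = ∫ x, Real.log (hsia S x) ∂μ - ∫ x, Real.log (hsia S x) ∂ν) ∧
  (¬ IsUltrametricDist K → ∀ σ : ℂ ≃+* K, IsStdIso σ → ∀ φ : P1 K → ℝ, IsSmooth σ φ →
    (∫ z : ℂ, g (pt (σ z : OnePoint K)) * ((2 * Real.pi)⁻¹ *
        Laplacian.laplacian (fun z : ℂ => φ (pt (σ z : OnePoint K))) z))
      = ∫ x, φ x ∂μ - ∫ x, φ x ∂ν)

/-! ### Weights, kernels, potentials, energy -/

/-- `μ` is a probability Radon measure and `μ = Δ g + Ω_can`. -/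
def IsCurvature (g : P1 K → ℝ) (μ : Measure (P1 K)) : Prop :=
  IsProbabilityMeasure μ ∧ μ.Regular ∧ HasLaplacian g μ (omegaCan K)

/-- The kernel `Φ_g(x, y) = log [x, y]_can - g(x) - g(y)`, with values in `[-∞, ∞)`. -/
def Phi (g : P1 K → ℝ) (x y : P1 K) : EReal := elog (hsia x y) - (g x : EReal) - (g y : EReal)

/-- The potential `U_{g,ν}(x) = ∫ Φ_g(x, y) dν(y)`. -/
def U (g : P1 K → ℝ) (ν : Measure (P1 K)) (x : P1 K) : EReal := eintegral (fun y => Phi g x y) ν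

/-- The `g`-equilibrium energy `V_g`: the supremum of `∫∫ Φ_g d(ν × ν)` over all probability
Radon measures `ν`. -/
def V (g : P1 K → ℝ) : EReal :=
  ⨆ (ν : Measure (P1 K)) (_ : IsProbabilityMeasure ν) (_ : ν.Regular),
    eintegral (fun x => U g ν x) ν

/-! ### Rational functions -/

/-- `∑ᵢ aᵢ Aⁱ Bⁿ⁻ⁱ` for `P = ∑ aᵢ Tⁱ`: the form of degree `n` with dehomogenization `P`,
evaluated at `(A, B)`. -/
def homComp (P : K[X]) (n : ℕ) (A B : K[X]) : K[X] :=
  ∑ i ∈ Finset.range (n + 1), C (P.coeff i) * A ^ i * B ^ (n - i)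

theorem homComp_eq (P : K[X]) {n : ℕ} (hn : P.natDegree ≤ n) (A : K[X]) {B : K[X]} (hB : B ≠ 0) :
    algebraMap K[X] (RatFunc K) (homComp P n A B)
      = algebraMap K[X] (RatFunc K) B ^ n
        * aeval (algebraMap K[X] (RatFunc K) A / algebraMap K[X] (RatFunc K) B) P := by
  have hB' : algebraMap K[X] (RatFunc K) B ≠ 0 := by simpa using hB
  rw [aeval_eq_sum_range' (Nat.lt_succ_of_le hn), Finset.mul_sum, homComp, map_sum]
  refine Finset.sum_congr rfl fun i hi => ?_
  have hi' : i ≤ n := Nat.lt_succ_iff.mp (Finset.mem_range.mp hi)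
  rw [Algebra.smul_def, map_mul, map_mul, map_pow, map_pow, div_pow,
    ← Nat.sub_add_cancel hi', pow_add, Nat.sub_add_cancel hi',
    IsScalarTower.algebraMap_apply K K[X] (RatFunc K), Polynomial.algebraMap_eq]
  field_simp

theorem homComp_mul (P Q : K[X]) {m n : ℕ} (hm : P.natDegree ≤ m) (hn : Q.natDegree ≤ n)
    (A : K[X]) {B : K[X]} (hB : B ≠ 0) :
    homComp (P * Q) (m + n) A B = homComp P m A B * homComp Q n A B := by
  apply RatFunc.algebraMap_injective K
  rw [map_mul, homComp_eq P hm A hB, homComp_eq Q hn A hB,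
    homComp_eq (P * Q) (natDegree_mul_le.trans (add_le_add hm hn)) A hB, map_mul, pow_add]
  ring

theorem homComp_succ (P : K[X]) {m n : ℕ} (hm : P.natDegree ≤ m) (A : K[X]) {B : K[X]}
    (hB : B ≠ 0) : homComp P (m + n) A B = homComp P m A B * B ^ n := by
  apply RatFunc.algebraMap_injective K
  rw [map_mul, homComp_eq P hm A hB, homComp_eq P (hm.trans (Nat.le_add_right m n)) A hB, map_pow,
    pow_add]
  ring

theorem homComp_add (P Q : K[X]) (n : ℕ) (A B : K[X]) :
    homComp (P + Q) n A B = homComp P n A B + homComp Q n A B := by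
  simp only [homComp, coeff_add, map_add, add_mul, Finset.sum_add_distrib]

theorem homComp_neg (P : K[X]) (n : ℕ) (A B : K[X]) : homComp (-P) n A B = -homComp P n A B := by
  simp only [homComp, coeff_neg, map_neg, neg_mul, Finset.sum_neg_distrib]

/-- The image `P ↦ |P(A/B)|_x` of `x` under `A/B`, where `|B|_x ≠ 0`. -/
def pushAff (A B : K[X]) (x : A1 K) (hx : x.val B ≠ 0) : A1 K :=
  have hB : B ≠ 0 := by
    rintro rfl
    exact hx (map_zero x.1)
  have hpos : 0 < x.1 B := lt_of_le_of_ne (apply_nonneg x.1 B) (Ne.symm hx)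
  have key : ∀ (P : K[X]) (n : ℕ), P.natDegree ≤ n →
      x.1 (homComp P P.natDegree A B) / x.1 B ^ P.natDegree = x.1 (homComp P n A B) / x.1 B ^ n := by
    intro P n hn
    obtain ⟨k, rfl⟩ := Nat.exists_eq_add_of_le hn
    rw [homComp_succ P le_rfl A hB, map_mul, map_pow, pow_add]
    field_simp
  ⟨{ toFun := fun P => x.1 (homComp P P.natDegree A B) / x.1 B ^ P.natDegree
     map_zero' := by simp [homComp]
     add_le' := fun P Q => by
       have hP := le_max_left P.natDegree Q.natDegree
       have hQ := le_max_right P.natDegree Q.natDegree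
       rw [key P _ hP, key Q _ hQ, key (P + Q) _ (natDegree_add_le P Q), homComp_add, ← add_div]
       gcongr
       exact map_add_le_add x.1 _ _
     neg' := fun P => by rw [natDegree_neg, homComp_neg, map_neg_eq_map]
     map_one' := by simp [homComp]
     map_mul' := fun P Q => by
       rw [key (P * Q) _ natDegree_mul_le, homComp_mul P Q le_rfl le_rfl A hB, map_mul, pow_add,
         mul_div_mul_comm] }, fun a => by
      change x.1 (homComp (C a) (C a).natDegree A B) / x.1 B ^ (C a).natDegree = ‖a‖
      rw [natDegree_C]
      simpa [homComp] using x.2 a⟩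

/-- The degree of a rational function. -/
def deg (f : RatFunc K) : ℕ := max f.num.natDegree f.denom.natDegree

open Classical in
/-- The action of `f` on `ℙ¹`. -/
def mapP1 (f : RatFunc K) : OnePoint K → OnePoint K
  | ∞ => if f.denom.coeff (deg f) = 0 then ∞
      else ((f.num.coeff (deg f) / f.denom.coeff (deg f) : K) : OnePoint K)
  | (a : K) => if f.denom.eval a = 0 then ∞
      else ((f.num.eval a / f.denom.eval a : K) : OnePoint K)

open Classical in
/-- The action of `f` on `𝖯¹`. -/
def mapBerk (f : RatFunc K) : P1 K → P1 K
  | ∞ => pt (mapP1 f ∞)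
  | (x : A1 K) => if hx : x.val f.denom = 0 then ∞
      else ((pushAff f.num f.denom x hx : A1 K) : P1 K)

/-- The dehomogenization of the `n`-th iterate `Fⁿ`, of degree `dⁿ`, of the non-degenerate
homogeneous lift `F` of `f` given by the homogenizations of `f.num` and `f.denom` of degree
`d = deg f`. -/
def lift (f : RatFunc K) : ℕ → K[X] × K[X]
  | 0 => (X, 1)
  | n + 1 => (homComp f.num (deg f) (lift f n).1 (lift f n).2,
      homComp f.denom (deg f) (lift f n).1 (lift f n).2)

/-- `‖Fⁿ‖` at `x`, with respect to the coordinates used in `formAbs`. -/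
def liftNorm (f : RatFunc K) (n : ℕ) (x : P1 K) : ℝ :=
  norm2 K (formAbs (lift f n).1 (deg f ^ n) x) (formAbs (lift f n).2 (deg f ^ n) x)

/-- `T_{Fⁿ} = log ‖Fⁿ‖ - dⁿ log ‖·‖` on `𝖯¹`. -/
def T (f : RatFunc K) (n : ℕ) (x : P1 K) : ℝ :=
  Real.log (liftNorm f n x) - (deg f : ℝ) ^ n * Real.log (coordNorm x)

/-- `g_F = lim T_{Fⁿ} / dⁿ`. -/
def gLift (f : RatFunc K) (x : P1 K) : ℝ :=
  limUnder atTop fun n : ℕ => T f n x / (deg f : ℝ) ^ n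

/-- `μ` is the equilibrium measure `μ_f = Δ g_F + Ω_can` of `f`. -/
def IsEquilibriumMeasure (f : RatFunc K) (μ : Measure (P1 K)) : Prop := IsCurvature (gLift f) μ

/-- `g` is the dynamical Green function of the rational function with equilibrium measure `μ`:
the continuous weight with `Δ g + Ω_can = μ` that is normalized by `V_g = 0`. -/
def IsDynamicalGreen (μ : Measure (P1 K)) (g : P1 K → ℝ) : Prop :=
  Continuous g ∧ IsCurvature g μ ∧ V g = 0

/-- `Fix(fⁿ) ⊆ ℙ¹`. -/
def Fix (f : RatFunc K) (n : ℕ) : Set (OnePoint K) := {z | (mapP1 f)^[n] z = z}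

/-- `C(fⁿ) ⊆ ℙ¹`, the zeros of `(fⁿ)'`. For `fⁿ = A/B` the derivatives of `A/B` and `B/A` vanish at
the zeros of the Wronskian of `A` and `B`; at `∞` the coordinate `1/z` is used, in which `fⁿ` is
the quotient of the reflected polynomials. -/
def Crit (f : RatFunc K) (n : ℕ) : Set (OnePoint K) :=
  {z | match z with
    | ∞ => (wronskian (reflect (deg f ^ n) (lift f n).1)
        (reflect (deg f ^ n) (lift f n).2)).eval 0 = 0
    | (a : K) => (wronskian (lift f n).1 (lift f n).2).eval a = 0}

/-- `SAT(f) = ⋃_{n ≥ 1} (Fix(fⁿ) ∩ C(fⁿ))`, as a subset of `𝖯¹`. -/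
def SAT (f : RatFunc K) : Set (P1 K) := pt '' ⋃ n ∈ {n : ℕ | 1 ≤ n}, Fix f n ∩ Crit f n

/-- The dehomogenization of the form `F(X, Y) ∧ (X, Y)` of degree `d + 1`. -/
def fixPoly (f : RatFunc K) : K[X] := f.num - X * f.denom

/-- The multiplicity of a point of `ℙ¹` as a root of `f = Id`; in the coordinate `1/z` at `∞`. -/
def fixMult (f : RatFunc K) : OnePoint K → ℕ
  | ∞ => rootMultiplicity 0 (reflect (deg f + 1) (fixPoly f))
  | (a : K) => rootMultiplicity a (fixPoly f)

/-- The measure `[f = Id]` on `𝖯¹`. -/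
def fixMeasure (f : RatFunc K) : Measure (P1 K) :=
  Measure.sum fun w : OnePoint K => (fixMult f w : ℝ≥0∞) • Measure.dirac (pt w)

/-- `[f, Id]_can`, the continuous extension `|F ∧ p| / (‖F‖ ‖p‖)` to `𝖯¹` of `z ↦ [f(z), z]`. -/
def prox (f : RatFunc K) (x : P1 K) : ℝ :=
  formAbs (fixPoly f) (deg f + 1) x /
    (norm2 K (formAbs f.num (deg f) x) (formAbs f.denom (deg f) x) * coordNorm x)

/-- `Φ(f, Id)_g = log [f, Id]_can - g ∘ f - g`. -/
def PhiProx (f : RatFunc K) (g : P1 K → ℝ) (x : P1 K) : EReal :=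
  elog (prox f x) - (g (mapBerk f x) : EReal) - (g x : EReal)

end Line

end Berkovich

end

noncomputable section

namespace Berkovich

section Seminorms

variable {K : Type*} [NontriviallyNormedField K]

namespace A1

theorem ext {x y : A1 K} (h : ∀ P, x.val P = y.val P) : x = y :=
  Subtype.ext (DFunLike.ext _ _ h)

theorem val_nonneg (x : A1 K) (P : K[X]) : 0 ≤ x.val P := apply_nonneg x.1 P

theorem val_mul (x : A1 K) (P Q : K[X]) : x.val (P * Q) = x.val P * x.val Q := map_mul x.1 P Q

theorem val_pow (x : A1 K) (P : K[X]) (n : ℕ) : x.val (P ^ n) = x.val P ^ n := map_pow x.1 P n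

theorem val_add_le (x : A1 K) (P Q : K[X]) : x.val (P + Q) ≤ x.val P + x.val Q :=
  map_add_le_add x.1 P Q

@[simp] theorem val_C (x : A1 K) (a : K) : x.val (C a) = ‖a‖ := x.2 a

@[simp] theorem val_one (x : A1 K) : x.val 1 = 1 := map_one x.1

@[simp] theorem val_zero (x : A1 K) : x.val 0 = 0 := map_zero x.1

theorem val_neg (x : A1 K) (P : K[X]) : x.val (-P) = x.val P := map_neg_eq_map x.1 P

theorem val_sub_rev (x : A1 K) (P Q : K[X]) : x.val (P - Q) = x.val (Q - P) := by
  rw [← val_neg, neg_sub]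

theorem val_sub_le (x : A1 K) (P Q : K[X]) : x.val (P - Q) ≤ x.val P + x.val Q := by
  rw [sub_eq_add_neg, ← val_neg x Q]
  exact val_add_le x P (-Q)

theorem abs_val_sub_val_le (x : A1 K) (P Q : K[X]) : |x.val P - x.val Q| ≤ x.val (P - Q) := by
  have h1 := x.val_add_le (P - Q) Q
  have h2 := x.val_add_le (Q - P) P
  rw [sub_add_cancel] at h1 h2
  rw [x.val_sub_rev Q P] at h2
  rw [abs_le]
  constructor <;> linarith

theorem val_sum_le {ι : Type*} (x : A1 K) (s : Finset ι) (F : ι → K[X]) :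
    x.val (∑ i ∈ s, F i) ≤ ∑ i ∈ s, x.val (F i) := by
  classical
  induction s using Finset.induction_on with
  | empty => simp
  | insert i s hi ih =>
    rw [Finset.sum_insert hi, Finset.sum_insert hi]
    exact (x.val_add_le _ _).trans (by gcongr)

theorem continuous_val (P : K[X]) : Continuous fun x : A1 K => x.val P :=
  (continuous_apply P).comp continuous_induced_dom

@[simp] theorem val_evalPt (a : K) (P : K[X]) : (evalPt a).val P = ‖P.eval a‖ := rfl

theorem val_le_sum (x : A1 K) {P : K[X]} {n : ℕ} (hn : P.natDegree < n) :
    x.val P ≤ ∑ i ∈ Finset.range n, ‖P.coeff i‖ * x.val X ^ i := by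
  conv_lhs => rw [P.as_sum_range' n hn]
  refine (x.val_sum_le _ _).trans (le_of_eq (Finset.sum_congr rfl fun i _ => ?_))
  rw [← C_mul_X_pow_eq_monomial, val_mul, val_C, val_pow]

/-- A seminorm that vanishes at `T - a` is the evaluation at `a`. -/
theorem eq_evalPt_of_val_eq_zero {x : A1 K} {a : K} (h : x.val (X - C a) = 0) : x = evalPt a := by
  refine ext fun P => ?_
  have h1 := x.abs_val_sub_val_le P (C (P.eval a))
  rw [← Polynomial.mul_divByMonic_eq_iff_isRoot.mpr (show IsRoot (P - C (P.eval a)) a by simp),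
    val_mul, h, zero_mul] at h1
  have h2 := abs_eq_zero.mp (le_antisymm h1 (abs_nonneg _))
  rw [val_C] at h2
  rw [val_evalPt]
  linarith

theorem isEmbedding_val : IsEmbedding fun (x : A1 K) (P : K[X]) => x.val P :=
  ⟨⟨rfl⟩, fun _ _ h => ext fun P => congrFun h P⟩

instance : T2Space (A1 K) := isEmbedding_val.t2Space

theorem isCompact_setOf_val_X_le (R : ℝ) : IsCompact {x : A1 K | x.val X ≤ R} := by
  rw [isEmbedding_val.isCompact_iff]
  let B : K[X] → ℝ := fun P => ∑ i ∈ Finset.range (P.natDegree + 1), ‖P.coeff i‖ * R ^ i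
  have hK : IsCompact (Set.pi Set.univ fun P : K[X] => Set.Icc 0 (B P)) :=
    isCompact_univ_pi fun P => isCompact_Icc
  refine hK.of_isClosed_subset ?_ ?_
  · have : (fun (x : A1 K) (P : K[X]) => x.val P) '' {x : A1 K | x.val X ≤ R}
        = {v : K[X] → ℝ | v X ≤ R} ∩ (⋂ a : K, {v | v (C a) = ‖a‖}) ∩
          (⋂ P : K[X], ⋂ Q : K[X], {v | v (P * Q) = v P * v Q}) ∩
          (⋂ P : K[X], ⋂ Q : K[X], {v | v (P + Q) ≤ v P + v Q}) ∩
          (⋂ P : K[X], {v | v (-P) = v P}) := by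
      ext v
      simp only [Set.mem_image, Set.mem_ofPred_eq, Set.mem_inter_iff, Set.mem_iInter]
      constructor
      · rintro ⟨x, hx, rfl⟩
        exact ⟨⟨⟨⟨hx, x.val_C⟩, x.val_mul⟩, x.val_add_le⟩, x.val_neg⟩
      · rintro ⟨⟨⟨⟨h1, h2⟩, h3⟩, h4⟩, h5⟩
        refine ⟨⟨{ toFun := v
                   map_zero' := by simpa using h2 0
                   add_le' := h4
                   neg' := h5
                   map_one' := by simpa using h2 1
                   map_mul' := h3 }, h2⟩, h1, rfl⟩
    rw [this]
    refine ((((isClosed_le (continuous_apply _) continuous_const).inter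
      (isClosed_iInter fun a => isClosed_eq (continuous_apply _) continuous_const)).inter
      (isClosed_iInter fun P => isClosed_iInter fun Q => isClosed_eq (continuous_apply _)
        (by fun_prop))).inter
      (isClosed_iInter fun P => isClosed_iInter fun Q => isClosed_le (continuous_apply _)
        (by fun_prop))).inter
      (isClosed_iInter fun P => isClosed_eq (continuous_apply _) (continuous_apply _))
  · rintro _ ⟨x, hx, rfl⟩ P -
    refine ⟨x.val_nonneg P, (x.val_le_sum (Nat.lt_succ_self _)).trans ?_⟩
    refine Finset.sum_le_sum fun i _ => ?_
    gcongr
    exacts [x.val_nonneg _, hx]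

theorem tendsto_val_X : Tendsto (fun x : A1 K => x.val X) (coclosedCompact (A1 K)) atTop := by
  refine tendsto_atTop.mpr fun R => ?_
  have h := (isCompact_setOf_val_X_le (K := K) R).compl_mem_coclosedCompact_of_isClosed
    (isClosed_le (continuous_val X) continuous_const)
  filter_upwards [h] with x hx
  rw [Set.mem_compl_iff, Set.mem_ofPred_eq, not_le] at hx
  exact hx.le

end A1

theorem continuous_evalPt : Continuous (evalPt : K → A1 K) := by
  refine A1.isEmbedding_val.continuous_iff.mpr (continuous_pi fun P => ?_)
  exact (Polynomial.continuous P).norm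

@[simp] theorem pt_infty : pt (∞ : OnePoint K) = (∞ : P1 K) := rfl

@[simp] theorem pt_coe (a : K) : pt (a : OnePoint K) = ((evalPt a : A1 K) : P1 K) := rfl

theorem pt_injective : Function.Injective (pt : OnePoint K → P1 K) := by
  intro z w h
  induction z using OnePoint.rec with
  | infty =>
    induction w using OnePoint.rec with
    | infty => rfl
    | coe b => exact absurd h (OnePoint.infty_ne_coe _)
  | coe a =>
    induction w using OnePoint.rec with
    | infty => exact absurd h (OnePoint.coe_ne_infty _)
    | coe b =>
      have h1 : evalPt a = evalPt b := OnePoint.coe_injective h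
      have h2 := congrArg (fun x : A1 K => x.val (X - C b)) h1
      simp only [A1.val_evalPt, eval_sub, eval_X, eval_C, sub_self, norm_zero, norm_eq_zero] at h2
      rw [sub_eq_zero.mp h2]

/-! ### The norm on `K²` -/

variable (K) in
theorem continuous_norm2 : Continuous fun p : ℝ × ℝ => norm2 K p.1 p.2 := by
  unfold norm2
  split_ifs <;> fun_prop

variable (K) in
theorem norm2_mul {s : ℝ} (hs : 0 ≤ s) (a b : ℝ) :
    norm2 K (s * a) (s * b) = s * norm2 K a b := by
  unfold norm2
  split_ifs
  · rw [mul_max_of_nonneg _ _ hs]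
  · rw [mul_pow, mul_pow, ← mul_add, Real.sqrt_mul (sq_nonneg s), Real.sqrt_sq hs]

variable (K) in
theorem le_norm2_left (a b : ℝ) : a ≤ norm2 K a b := by
  unfold norm2
  split_ifs
  · exact le_max_left _ _
  · exact Real.le_sqrt_of_sq_le (by nlinarith [sq_nonneg b])

variable (K) in
theorem le_norm2_right (a b : ℝ) : b ≤ norm2 K a b := by
  unfold norm2
  split_ifs
  · exact le_max_right _ _
  · exact Real.le_sqrt_of_sq_le (by nlinarith [sq_nonneg a])

variable (K) in
theorem norm2_zero_right {a : ℝ} (ha : 0 ≤ a) : norm2 K a 0 = a := by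
  unfold norm2
  split_ifs
  · exact max_eq_left ha
  · simp [Real.sqrt_sq ha]

variable (K) in
theorem norm2_pos {a b : ℝ} (h : 0 < a ∨ 0 < b) : 0 < norm2 K a b :=
  h.elim (fun h => h.trans_le (le_norm2_left K a b)) fun h => h.trans_le (le_norm2_right K a b)

/-! ### Absolute values of forms -/

@[simp] theorem formAbs_infty (P : K[X]) (n : ℕ) : formAbs P n (∞ : P1 K) = ‖P.coeff n‖ := rfl

@[simp] theorem formAbs_coe (P : K[X]) (n : ℕ) (x : A1 K) : formAbs P n (x : P1 K) = x.val P := rfl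

theorem formAbs_nonneg (P : K[X]) (n : ℕ) (x : P1 K) : 0 ≤ formAbs P n x := by
  induction x using OnePoint.rec with
  | infty => exact norm_nonneg _
  | coe x => exact x.val_nonneg P

theorem formAbs_mul {P Q : K[X]} {m n : ℕ} (hP : P.natDegree ≤ m) (hQ : Q.natDegree ≤ n)
    (x : P1 K) : formAbs (P * Q) (m + n) x = formAbs P m x * formAbs Q n x := by
  induction x using OnePoint.rec with
  | infty => simp [coeff_mul_add_eq_of_natDegree_le hP hQ]
  | coe x => exact x.val_mul P Q

theorem formAbs_C (a : K) (x : P1 K) : formAbs (C a) 0 x = ‖a‖ := by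
  induction x using OnePoint.rec with
  | infty => simp
  | coe x => exact x.val_C a

@[simp] theorem coordNorm_infty : coordNorm (∞ : P1 K) = 1 := by
  rw [coordNorm, formAbs_infty, formAbs_infty, coeff_X_one, norm_one, coeff_one]
  simpa using norm2_zero_right K zero_le_one

theorem coordNorm_coe (x : A1 K) : coordNorm (x : P1 K) = norm2 K (x.val X) 1 := by
  rw [coordNorm, formAbs_coe, formAbs_coe, A1.val_one]

theorem one_le_coordNorm (x : P1 K) : 1 ≤ coordNorm x := by
  induction x using OnePoint.rec with
  | infty => simp
  | coe x => rw [coordNorm_coe]; exact le_norm2_right K _ _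

theorem coordNorm_pos (x : P1 K) : 0 < coordNorm x := zero_lt_one.trans_le (one_le_coordNorm x)

/-- The norm of a form of degree `n` with respect to the coordinate norm. -/
def formNorm (P : K[X]) (n : ℕ) (x : P1 K) : ℝ := formAbs P n x / coordNorm x ^ n

theorem tendsto_norm2_div : Tendsto (fun t : ℝ => norm2 K t 1 / t) atTop (𝓝 1) := by
  have h : Tendsto (fun t : ℝ => norm2 K 1 t⁻¹) atTop (𝓝 (norm2 K 1 0)) :=
    ((continuous_norm2 K).tendsto (1, 0)).comp
      (tendsto_const_nhds.prodMk_nhds tendsto_inv_atTop_zero)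
  rw [norm2_zero_right K zero_le_one] at h
  refine h.congr' ?_
  filter_upwards [eventually_gt_atTop 0] with t ht
  rw [eq_div_iff ht.ne', mul_comm, ← norm2_mul K ht.le, mul_one, mul_inv_cancel₀ ht.ne']

theorem continuous_formNorm {P : K[X]} {n : ℕ} (hP : P.natDegree ≤ n) :
    Continuous (formNorm P n : P1 K → ℝ) := by
  rw [continuous_iff_continuousAt]
  intro x
  induction x using OnePoint.rec with
  | coe x =>
    rw [OnePoint.continuousAt_coe]
    refine Continuous.continuousAt ?_
    have h1 : ∀ y : A1 K, (formNorm P n ∘ ((↑) : A1 K → P1 K)) y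
        = y.val P / norm2 K (y.val X) 1 ^ n := fun y => by
      simp only [Function.comp_apply, formNorm, formAbs_coe, coordNorm_coe]
    have h2 : Continuous fun y : A1 K => y.val P / norm2 K (y.val X) 1 ^ n := by
      refine (A1.continuous_val P).div (((continuous_norm2 K).comp
        ((A1.continuous_val X).prodMk continuous_const)).pow n) fun y => ?_
      exact pow_ne_zero _ (norm2_pos K (Or.inr one_pos)).ne'
    exact h2.congr fun y => (h1 y).symm
  | infty =>
    rw [OnePoint.continuousAt_infty']
    have hlim : Tendsto (fun y : A1 K => y.val P / y.val X ^ n) (coclosedCompact (A1 K))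
        (𝓝 ‖P.coeff n‖) := by
      let S := ∑ i ∈ Finset.range n, ‖P.coeff i‖
      have h0 : Tendsto (fun y : A1 K => S / y.val X) (coclosedCompact (A1 K)) (𝓝 0) :=
        Tendsto.div_atTop tendsto_const_nhds A1.tendsto_val_X
      refine tendsto_iff_dist_tendsto_zero.mpr (squeeze_zero' (Eventually.of_forall fun _ =>
        dist_nonneg) ?_ h0)
      filter_upwards [A1.tendsto_val_X.eventually_ge_atTop 1] with y hy
      have hy0 : 0 < y.val X := zero_lt_one.trans_le hy
      have h1 : |y.val P - ‖P.coeff n‖ * y.val X ^ n| ≤ S * y.val X ^ (n - 1) := by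
        have h2 := y.abs_val_sub_val_le P (C (P.coeff n) * X ^ n)
        rw [A1.val_mul, A1.val_pow, A1.val_C] at h2
        refine h2.trans ?_
        have h3 : P - C (P.coeff n) * X ^ n
            = ∑ i ∈ Finset.range n, C (P.coeff i) * X ^ i := by
          conv_lhs => rw [P.as_sum_range_C_mul_X_pow' (Nat.lt_succ_of_le hP), Finset.sum_range_succ]
          simp
        rw [h3, Finset.sum_mul]
        refine (y.val_sum_le _ _).trans (Finset.sum_le_sum fun i hi => ?_)
        rw [A1.val_mul, A1.val_pow, A1.val_C]
        have := Finset.mem_range.mp hi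
        gcongr
        omega
      rw [Real.dist_eq]
      rcases Nat.eq_zero_or_pos n with rfl | hn
      · have : S = 0 := Finset.sum_range_zero _
        rw [this, zero_mul] at h1
        simpa [this] using h1
      · have h4 : y.val P / y.val X ^ n - ‖P.coeff n‖
            = (y.val P - ‖P.coeff n‖ * y.val X ^ n) / y.val X ^ n := by
          field_simp
        rw [h4, abs_div, abs_of_pos (pow_pos hy0 n), div_le_div_iff₀ (pow_pos hy0 n) hy0]
        calc _ ≤ S * y.val X ^ (n - 1) * y.val X := by gcongr
          _ = S * y.val X ^ n := by
            rw [mul_assoc, ← pow_succ, Nat.sub_add_cancel hn]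
    have hlim2 := hlim.div ((tendsto_norm2_div (K := K).comp A1.tendsto_val_X).pow n) (by simp)
    have h5 : formNorm P n (∞ : P1 K) = ‖P.coeff n‖ / 1 ^ n := by simp [formNorm]
    rw [h5]
    refine hlim2.congr' ?_
    filter_upwards [A1.tendsto_val_X.eventually_gt_atTop 0] with y hy
    simp only [Function.comp_apply, Pi.div_apply, formNorm, formAbs_coe,
      coordNorm_coe, div_pow]
    field_simp

/-! ### The kernel at classical points -/

/-- The linear form vanishing at the point `w`. -/
def ell : OnePoint K → K[X]
  | ∞ => 1
  | (a : K) => X - C a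

@[simp] theorem ell_infty : ell (∞ : OnePoint K) = 1 := rfl

@[simp] theorem ell_coe (a : K) : ell (a : OnePoint K) = X - C a := rfl

theorem natDegree_ell_le (w : OnePoint K) : (ell w).natDegree ≤ 1 := by
  induction w using OnePoint.rec with
  | infty => simp
  | coe a => simp

theorem hsia_comm (x y : P1 K) : hsia x y = hsia y x := by
  have h : ∀ x y : A1 K, hsiaAff x y = hsiaAff y x := fun x y => by
    unfold hsiaAff
    simp only [max_comm, add_comm]
  induction x using OnePoint.rec with
  | infty => induction y using OnePoint.rec <;> rfl
  | coe x =>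
    induction y using OnePoint.rec with
    | infty => rfl
    | coe y =>
      change hsiaAff x y / _ = hsiaAff y x / _
      rw [h, mul_comm]

end Seminorms

section Ultrametric

variable {K : Type*} [NontriviallyNormedField K] [IsUltrametricDist K]

theorem A1.val_add_le_max (x : A1 K) (P Q : K[X]) : x.val (P + Q) ≤ max (x.val P) (x.val Q) := by
  set M := max (x.val P) (x.val Q) with hM
  have hM0 : 0 ≤ M := (x.val_nonneg P).trans (le_max_left _ _)
  have key : ∀ n : ℕ, x.val (P + Q) ^ n ≤ (n + 1) * M ^ n := by
    intro n
    rw [← x.val_pow, add_pow]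
    refine (x.val_sum_le _ _).trans ?_
    have : ∀ i ∈ Finset.range (n + 1),
        x.val (P ^ i * Q ^ (n - i) * (n.choose i : K[X])) ≤ M ^ n := by
      intro i hi
      have hi' : i ≤ n := Nat.lt_succ_iff.mp (Finset.mem_range.mp hi)
      rw [x.val_mul, x.val_mul, x.val_pow, x.val_pow, ← C_eq_natCast, x.val_C]
      calc _ ≤ M ^ i * M ^ (n - i) * 1 := by
            gcongr
            · exact pow_nonneg (x.val_nonneg _) _
            · exact x.val_nonneg _
            · exact le_max_left _ _
            · exact x.val_nonneg _
            · exact le_max_right _ _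
            · exact IsUltrametricDist.norm_natCast_le_one K _
        _ = M ^ n := by rw [mul_one, ← pow_add, Nat.add_sub_cancel' hi']
    refine (Finset.sum_le_sum this).trans ?_
    simp
  by_contra! hlt
  rcases hM0.eq_or_lt with h0 | h0
  · have := key 1
    rw [← h0] at this hlt
    simp at this
    linarith
  · have h1 : 1 < x.val (P + Q) / M := (one_lt_div h0).mpr hlt
    have h2 : ∀ n : ℕ, (x.val (P + Q) / M) ^ n ≤ n + 1 := fun n => by
      rw [div_pow, div_le_iff₀ (pow_pos h0 n)]
      exact key n
    have h3 := tendsto_pow_const_div_const_pow_of_one_lt 1 h1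
    have h4 : Tendsto (fun n : ℕ => ((n : ℝ) + 1) / (x.val (P + Q) / M) ^ n) atTop (𝓝 0) := by
      have h5 := tendsto_pow_const_div_const_pow_of_one_lt 0 h1
      simpa [add_div] using h3.add h5
    have h6 := h4.eventually_lt_const (zero_lt_one' ℝ)
    obtain ⟨n, hn⟩ := h6.exists
    rw [div_lt_one (by positivity)] at hn
    exact absurd (h2 n) (not_le.mpr hn)

theorem A1.val_sub_le_max (x : A1 K) (P Q : K[X]) : x.val (P - Q) ≤ max (x.val P) (x.val Q) := by
  rw [sub_eq_add_neg, ← x.val_neg Q]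
  exact x.val_add_le_max P (-Q)

end Ultrametric

section Kernel

variable {K : Type*} [NontriviallyNormedField K]

theorem hsiaAff_evalPt (x : A1 K) (a : K) : hsiaAff x (evalPt a) = x.val (X - C a) := by
  unfold hsiaAff
  have hb : ∀ b : K, (evalPt a).val (X - C b) = x.val (C a - C b) := fun b => by
    rw [← C_sub, A1.val_C, A1.val_evalPt]; simp
  simp only [hb]
  split_ifs with h
  · refine le_antisymm ?_ (le_ciInf fun b => ?_)
    · refine (ciInf_le ⟨0, ?_⟩ a).trans ?_
      · rintro _ ⟨b, rfl⟩
        exact (x.val_nonneg _).trans (le_max_left _ _)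
      · simp [x.val_nonneg]
    · calc _ = x.val ((X - C b) - (C a - C b)) := by congr 1; ring
        _ ≤ _ := x.val_sub_le_max _ _
  · refine le_antisymm ?_ (le_ciInf fun b => ?_)
    · refine (ciInf_le ⟨0, ?_⟩ a).trans ?_
      · rintro _ ⟨b, rfl⟩
        exact add_nonneg (x.val_nonneg _) (x.val_nonneg _)
      · simp
    · calc _ = x.val ((X - C b) - (C a - C b)) := by congr 1; ring
        _ ≤ _ := x.val_sub_le _ _

theorem hsia_pt (x : P1 K) (w : OnePoint K) :
    hsia x (pt w) = formAbs (ell w) 1 x / (coordNorm x * coordNorm (pt w)) := by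
  induction x using OnePoint.rec with
  | infty =>
    induction w using OnePoint.rec with
    | infty => simp [hsia, coeff_one]
    | coe b =>
      rw [pt_coe, ell_coe]
      change 1 / coordNorm _ = _
      simp [coeff_X]
  | coe x =>
    induction w using OnePoint.rec with
    | infty =>
      change 1 / coordNorm _ = _
      simp
    | coe b =>
      change hsiaAff x (evalPt b) / _ = _
      rw [hsiaAff_evalPt]
      rfl

theorem hsia_pt_eq_formNorm (x : P1 K) (w : OnePoint K) :
    hsia x (pt w) = formNorm (ell w) 1 x / coordNorm (pt w) := by
  rw [hsia_pt, formNorm, pow_one, div_div]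

theorem continuous_hsia_pt (w : OnePoint K) : Continuous fun x : P1 K => hsia x (pt w) := by
  simp only [hsia_pt_eq_formNorm]
  exact (continuous_formNorm (natDegree_ell_le w)).div_const _

theorem hsiaAff_nonneg (x y : A1 K) : 0 ≤ hsiaAff x y := by
  unfold hsiaAff
  split_ifs
  · exact Real.iInf_nonneg fun a => (x.val_nonneg _).trans (le_max_left _ _)
  · exact Real.iInf_nonneg fun a => add_nonneg (x.val_nonneg _) (y.val_nonneg _)

theorem hsia_nonneg (x y : P1 K) : 0 ≤ hsia x y := by
  induction x using OnePoint.rec with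
  | infty =>
    induction y using OnePoint.rec with
    | infty => exact le_rfl
    | coe y => exact div_nonneg zero_le_one (coordNorm_pos _).le
  | coe x =>
    induction y using OnePoint.rec with
    | infty => exact div_nonneg zero_le_one (coordNorm_pos _).le
    | coe y =>
      exact div_nonneg (hsiaAff_nonneg x y) (mul_nonneg (coordNorm_pos _).le (coordNorm_pos _).le)

end Kernel

end Berkovich

end

noncomputable section

namespace Berkovich

/-! ### Extended integrals of differences -/

section ExtendedIntegral

variable {α : Type*} [MeasurableSpace α]

theorem toENNReal_sub_add (b : ℝ) (l : ℝ≥0∞) :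
    ((b : EReal) - l).toENNReal + l + ENNReal.ofReal (-b)
      = (-((b : EReal) - l)).toENNReal + ENNReal.ofReal b := by
  induction l using ENNReal.recTopCoe with
  | top => simp
  | coe l =>
    have h1 : (b : EReal) - ((l : ℝ≥0∞) : EReal) = ((b - l : ℝ) : EReal) := by
      rw [EReal.coe_sub]; rfl
    rw [h1, ← EReal.coe_neg, EReal.toENNReal_of_ne_top (EReal.coe_ne_top _),
      EReal.toENNReal_of_ne_top (EReal.coe_ne_top _), EReal.toReal_coe, EReal.toReal_coe,
      ← ENNReal.ofReal_coe_nnreal]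
    rcases le_total b 0 with hb | hb
    · have hl := l.coe_nonneg
      rw [ENNReal.ofReal_of_nonpos (by linarith : b - l ≤ 0), ENNReal.ofReal_of_nonpos hb,
        zero_add, add_zero, ← ENNReal.ofReal_add hl (by linarith)]
      congr 1
      ring
    · rw [ENNReal.ofReal_of_nonpos (by linarith : -b ≤ 0), add_zero]
      rcases le_total b l with h | h
      · rw [ENNReal.ofReal_of_nonpos (by linarith : b - l ≤ 0), zero_add,
          ← ENNReal.ofReal_add (by linarith) hb]
        congr 1
        ring
      · rw [ENNReal.ofReal_of_nonpos (by linarith : -(b - l) ≤ 0), zero_add,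
          ← ENNReal.ofReal_add (by linarith) l.coe_nonneg]
        congr 1
        ring

theorem eintegral_sub {ν : Measure α} {b : α → ℝ} (hb : Integrable b ν) (hbm : Measurable b)
    {l : α → ℝ≥0∞} (hl : Measurable l) :
    eintegral (fun x => (b x : EReal) - l x) ν
      = ((∫ x, b x ∂ν : ℝ) : EReal) - ((∫⁻ x, l x ∂ν : ℝ≥0∞) : EReal) := by
  unfold eintegral
  set p : ℝ≥0∞ := ∫⁻ x, ((b x : EReal) - l x).toENNReal ∂ν with hp
  set n : ℝ≥0∞ := ∫⁻ x, (-((b x : EReal) - l x)).toENNReal ∂ν with hn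
  have hmp : Measurable fun x => ((b x : EReal) - l x).toENNReal := by
    have h1 : Measurable fun x => (b x : EReal) := measurable_coe_real_ereal.comp hbm
    have h2 : Measurable fun x => ((l x : ℝ≥0∞) : EReal) := measurable_coe_ennreal_ereal.comp hl
    exact measurable_ereal_toENNReal.comp (h1.sub h2)
  have key : p + ∫⁻ x, l x ∂ν + ∫⁻ x, ENNReal.ofReal (-b x) ∂ν
      = n + ∫⁻ x, ENNReal.ofReal (b x) ∂ν := by
    have hmpl : Measurable fun x => ((b x : EReal) - l x).toENNReal + l x := hmp.add hl
    rw [hp, hn, ← lintegral_add_left hmp, ← lintegral_add_left hmpl,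
      ← lintegral_add_right _ hbm.ennreal_ofReal]
    exact lintegral_congr fun x => toENNReal_sub_add (b x) (l x)
  have hbp : ∫⁻ x, ENNReal.ofReal (b x) ∂ν ≠ ⊤ := hb.lintegral_lt_top.ne
  have hbn : ∫⁻ x, ENNReal.ofReal (-b x) ∂ν ≠ ⊤ := hb.neg.lintegral_lt_top.ne
  have hpt : p ≠ ⊤ := by
    refine ne_top_of_le_ne_top hbp (lintegral_mono fun x => ?_)
    calc ((b x : EReal) - l x).toENNReal ≤ ((b x : EReal)).toENNReal :=
          EReal.toENNReal_le_toENNReal (EReal.sub_le_of_le_add (by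
            exact le_add_of_nonneg_right (EReal.coe_ennreal_nonneg (l x))))
      _ = ENNReal.ofReal (b x) := by
          rw [EReal.toENNReal_of_ne_top (EReal.coe_ne_top _), EReal.toReal_coe]
  rw [integral_eq_lintegral_pos_part_sub_lintegral_neg_part hb]
  clear_value p n
  generalize ∫⁻ x, l x ∂ν = L at *
  generalize ∫⁻ x, ENNReal.ofReal (b x) ∂ν = B at *
  generalize ∫⁻ x, ENNReal.ofReal (-b x) ∂ν = B' at *
  lift p to NNReal using hpt
  lift B to NNReal using hbp
  lift B' to NNReal using hbn
  induction L using ENNReal.recTopCoe with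
  | top =>
    have : n = ⊤ := by
      rw [add_top, top_add] at key
      by_contra h
      exact ENNReal.add_ne_top.mpr ⟨h, ENNReal.coe_ne_top⟩ key.symm
    rw [this]
    simp
  | coe L =>
    have hnt : n ≠ ⊤ := fun h => by
      rw [h, top_add] at key
      exact absurd key (by simp)
    lift n to NNReal using hnt
    have h : (p : ℝ) + L + B' = n + B := by exact_mod_cast key
    have e : ∀ a : NNReal, (((a : ℝ≥0∞)) : EReal) = ((a : ℝ) : EReal) := fun a => rfl
    simp only [e, ENNReal.coe_toReal, ← EReal.coe_sub]
    congr 1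
    linarith

theorem integrable_of_continuous [TopologicalSpace α] [CompactSpace α] [OpensMeasurableSpace α]
    {φ : α → ℝ} (hφ : Continuous φ) (ν : Measure α) [IsFiniteMeasure ν] : Integrable φ ν := by
  obtain ⟨M, hM⟩ := isCompact_univ.exists_bound_of_continuousOn hφ.continuousOn
  exact Integrable.of_bound hφ.measurable.aestronglyMeasurable M
    (ae_of_all _ fun x => hM x (Set.mem_univ x))

end ExtendedIntegral

/-! ### The logarithmic kernel -/

/-- `-log t` for `0 ≤ t ≤ 1`. -/
def negLog (t : ℝ) : ℝ≥0∞ := (-elog t).toENNReal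

theorem measurable_elog : Measurable elog :=
  ENNReal.measurable_log.comp ENNReal.measurable_ofReal

theorem measurable_negLog : Measurable negLog :=
  measurable_ereal_toENNReal.comp measurable_elog.neg

theorem elog_nonpos {t : ℝ} (ht : t ≤ 1) : elog t ≤ 0 := by
  rw [elog, ← ENNReal.log_one]
  exact ENNReal.log_monotone (by simpa using ht)

theorem elog_eq_neg_negLog {t : ℝ} (ht : t ≤ 1) : elog t = -(negLog t : EReal) := by
  rw [negLog, EReal.coe_toENNReal, neg_neg]
  exact EReal.neg_nonneg.mpr (elog_nonpos ht)

theorem elog_of_pos {t : ℝ} (ht : 0 < t) : elog t = (Real.log t : EReal) := by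
  rw [elog, ENNReal.log_ofReal_of_pos ht]

theorem negLog_of_pos {t : ℝ} (ht : 0 < t) : negLog t = ENNReal.ofReal (-Real.log t) := by
  rw [negLog, elog_of_pos ht, ← EReal.coe_neg, EReal.toENNReal_of_ne_top (EReal.coe_ne_top _),
    EReal.toReal_coe]

theorem negLog_zero : negLog 0 = ⊤ := by simp [negLog, elog]

theorem negLog_antitone : Antitone negLog := by
  intro s t h
  refine EReal.toENNReal_le_toENNReal (EReal.neg_le_neg_iff.mpr ?_)
  exact ENNReal.log_monotone (ENNReal.ofReal_le_ofReal h)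

theorem continuous_negLog : Continuous negLog := by
  unfold negLog elog
  refine EReal.continuous_toENNReal.comp ?_
  exact continuous_neg.comp (ENNReal.continuous_log.comp ENNReal.continuous_ofReal)

section Energy

variable {K : Type*} [NontriviallyNormedField K]

/-- The kernel `-log [x, y]_can`. -/
def logKer (x y : P1 K) : ℝ≥0∞ := negLog (hsia x y)

theorem logKer_comm (x y : P1 K) : logKer x y = logKer y x := by
  rw [logKer, hsia_comm, logKer]

/-- The properties of the kernel `-log [x, y]_can` behind the energy formalism: it is
non-negative, its potentials are measurable, and it is conditionally positive definite. -/
structure KernelProps (K : Type*) [NontriviallyNormedField K] : Prop where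
  hsia_le_one : ∀ x y : P1 K, hsia x y ≤ 1
  measurable_hsia : ∀ x : P1 K, Measurable (hsia x)
  measurable_potential : ∀ ν : Measure (P1 K), IsProbabilityMeasure ν →
    Measurable fun x => ∫⁻ y, logKer x y ∂ν
  energy_le : ∀ ν μ : Measure (P1 K), IsProbabilityMeasure ν → IsProbabilityMeasure μ →
    2 * ∫⁻ x, ∫⁻ y, logKer x y ∂μ ∂ν
      ≤ ∫⁻ x, ∫⁻ y, logKer x y ∂ν ∂ν + ∫⁻ x, ∫⁻ y, logKer x y ∂μ ∂μ

theorem KernelProps.measurable_logKer (hK : KernelProps K) (x : P1 K) : Measurable (logKer x) :=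
  measurable_negLog.comp (hK.measurable_hsia x)

theorem coe_sub_coe_eq (a b : ℝ) (l : ℝ≥0∞) :
    -(l : EReal) - (a : EReal) - (b : EReal) = ((-a - b : ℝ) : EReal) - l := by
  rw [EReal.coe_sub, EReal.coe_neg]
  induction l using ENNReal.recTopCoe with
  | top => simp [sub_eq_add_neg]
  | coe l =>
    have e : (((l : ℝ≥0∞)) : EReal) = ((l : ℝ) : EReal) := rfl
    rw [e]
    norm_cast
    ring

theorem KernelProps.Phi_eq (hK : KernelProps K) (g : P1 K → ℝ) (x y : P1 K) :
    Phi g x y = ((-g x - g y : ℝ) : EReal) - (logKer x y : EReal) := by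
  rw [Phi, elog_eq_neg_negLog (hK.hsia_le_one x y), coe_sub_coe_eq]
  rfl

theorem KernelProps.U_eq (hK : KernelProps K) {g : P1 K → ℝ} (hg : Continuous g)
    (ν : Measure (P1 K)) [IsProbabilityMeasure ν] (x : P1 K) :
    U g ν x = ((-g x - ∫ y, g y ∂ν : ℝ) : EReal) - ((∫⁻ y, logKer x y ∂ν : ℝ≥0∞) : EReal) := by
  have hi := integrable_of_continuous hg ν
  have hi' : Integrable (fun y => -g x - g y) ν := (integrable_const _).sub hi
  have hm' : Measurable fun y => -g x - g y := measurable_const.sub hg.measurable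
  simp only [U, hK.Phi_eq]
  rw [eintegral_sub hi' hm' (hK.measurable_logKer x), integral_sub (integrable_const _) hi]
  simp

theorem KernelProps.eintegral_U_eq (hK : KernelProps K) {g : P1 K → ℝ} (hg : Continuous g)
    (ν : Measure (P1 K)) [IsProbabilityMeasure ν] :
    eintegral (fun x => U g ν x) ν = ((-(2 * ∫ y, g y ∂ν) : ℝ) : EReal)
      - ((∫⁻ x, ∫⁻ y, logKer x y ∂ν ∂ν : ℝ≥0∞) : EReal) := by
  have hi := integrable_of_continuous hg ν
  have hn : Integrable (fun x => -g x) ν := hi.neg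
  have hi' : Integrable (fun x => -g x - ∫ y, g y ∂ν) ν := hn.sub (integrable_const _)
  have hm' : Measurable fun x => -g x - ∫ y, g y ∂ν := hg.measurable.neg.sub measurable_const
  simp only [hK.U_eq hg]
  rw [eintegral_sub hi' hm' (hK.measurable_potential ν inferInstance),
    integral_sub hn (integrable_const _), integral_neg]
  simp only [integral_const, probReal_univ, smul_eq_mul, one_mul]
  congr 3
  ring

/-- If the potential of `μ` is `A - g`, then `V_g = - A - ∫ g dμ`. -/
theorem KernelProps.V_eq (hK : KernelProps K) {g : P1 K → ℝ} (hg : Continuous g)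
    {μ : Measure (P1 K)} [IsProbabilityMeasure μ] (hμ : μ.Regular) {A : ℝ}
    (hA : ∀ x, g x ≤ A) (hpot : ∀ x, ∫⁻ y, logKer x y ∂μ = ENNReal.ofReal (A - g x)) :
    V g = ((-A - ∫ x, g x ∂μ : ℝ) : EReal) := by
  have hE : ∀ ν : Measure (P1 K), IsProbabilityMeasure ν →
      ∫⁻ x, ∫⁻ y, logKer x y ∂μ ∂ν = ENNReal.ofReal (A - ∫ x, g x ∂ν) := by
    intro ν hν
    have hi := integrable_of_continuous hg ν
    have hi' : Integrable (fun x => A - g x) ν := (integrable_const A).sub hi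
    simp only [hpot]
    rw [← ofReal_integral_eq_lintegral_ofReal hi'
      (ae_of_all _ fun x => sub_nonneg.mpr (hA x)), integral_sub (integrable_const _) hi]
    simp
  have hAi : ∀ ν : Measure (P1 K), IsProbabilityMeasure ν → ∫ x, g x ∂ν ≤ A := by
    intro ν hν
    calc ∫ x, g x ∂ν ≤ ∫ _, A ∂ν :=
          integral_mono (integrable_of_continuous hg ν) (integrable_const _) hA
      _ = A := by simp
  have e : ∀ r : ℝ, 0 ≤ r → ((ENNReal.ofReal r : ℝ≥0∞) : EReal) = (r : EReal) := fun r hr => by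
    rw [EReal.coe_ennreal_ofReal, max_eq_left hr]
  apply le_antisymm
  · refine iSup_le fun ν => iSup_le fun hν => iSup_le fun _ => ?_
    rw [hK.eintegral_U_eq hg ν]
    have h := hK.energy_le ν μ hν inferInstance
    rw [hE ν hν, hE μ inferInstance] at h
    generalize ∫⁻ x, ∫⁻ y, logKer x y ∂ν ∂ν = E at h ⊢
    induction E using ENNReal.recTopCoe with
    | top => simp
    | coe E =>
      have h1 : 2 * (A - ∫ x, g x ∂ν) ≤ E + (A - ∫ x, g x ∂μ) := by
        rw [← ENNReal.ofReal_coe_nnreal, ← ENNReal.ofReal_add E.coe_nonneg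
          (sub_nonneg.mpr (hAi μ inferInstance)), ← ENNReal.ofReal_ofNat 2,
          ← ENNReal.ofReal_mul (by norm_num)] at h
        refine (ENNReal.ofReal_le_ofReal_iff ?_).mp h
        have := hAi μ inferInstance
        have := E.coe_nonneg
        linarith
      have e : (((E : ℝ≥0∞)) : EReal) = ((E : ℝ) : EReal) := rfl
      rw [e, ← EReal.coe_sub, EReal.coe_le_coe_iff]
      linarith
  · refine le_trans (le_of_eq ?_) (le_iSup_of_le μ (le_iSup_of_le inferInstance
      (le_iSup_of_le hμ le_rfl)))
    rw [hK.eintegral_U_eq hg μ, hE μ inferInstance,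
      e _ (sub_nonneg.mpr (hAi μ inferInstance)), ← EReal.coe_sub]
    congr 1
    ring

end Energy

end Berkovich

end

noncomputable section

namespace Berkovich

/-! ### Positivity of partial equivalence relations -/

theorem two_mul_mul_le_add_mul_self (a b : ℝ≥0∞) : 2 * (a * b) ≤ a * a + b * b := by
  wlog h : a ≤ b generalizing a b
  · rw [mul_comm a b, add_comm]
    exact this b a (le_of_not_ge h)
  obtain ⟨c, rfl⟩ := exists_add_of_le h
  calc 2 * (a * (a + c)) ≤ 2 * (a * (a + c)) + c * c := le_self_add
    _ = a * a + (a + c) * (a + c) := by ring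

section PartialEquivalence

variable {α : Type*} [MeasurableSpace α] {R : α → α → Prop}

theorem exists_measure_setOf_eq_tsum (hs : ∀ x y, R x y → R y x)
    (ht : ∀ x y z, R x y → R y z → R x z) (hm : ∀ x, MeasurableSet {y | R x y})
    (ν μ : Measure α) [IsProbabilityMeasure ν] [IsProbabilityMeasure μ] :
    ∃ D : Set (Set α), D.Countable ∧ (∀ A ∈ D, MeasurableSet A) ∧
      (∀ x, ν {y | R x y} = ∑' A : D, ν A * (A : Set α).indicator 1 x) ∧
      (∀ x, μ {y | R x y} = ∑' A : D, μ A * (A : Set α).indicator 1 x) := by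
  classical
  let ι := Set.range fun x => {y | R x y}
  have hcls : ∀ i : ι, ∀ x ∈ (i : Set α), {y | R x y} = (i : Set α) := by
    rintro ⟨_, z, rfl⟩ x (hx : R z x)
    ext y
    exact ⟨fun h => ht _ _ _ hx h, fun h => ht _ _ _ (hs _ _ hx) h⟩
  have hdisj : Pairwise fun i j : ι => Disjoint (i : Set α) (j : Set α) := by
    intro i j hij
    rw [Set.disjoint_left]
    intro x hi hj
    exact hij (Subtype.ext ((hcls i x hi).symm.trans (hcls j x hj)))
  have hmeas : ∀ i : ι, MeasurableSet (i : Set α) := by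
    rintro ⟨_, z, rfl⟩
    exact hm z
  have hcν := Measure.countable_meas_pos_of_disjoint_iUnion (μ := ν) hmeas hdisj
  have hcμ := Measure.countable_meas_pos_of_disjoint_iUnion (μ := μ) hmeas hdisj
  let D : Set (Set α) := Subtype.val '' ({i : ι | 0 < ν i} ∪ {i : ι | 0 < μ i})
  have key : ∀ ρ : Measure α, (∀ i : ι, 0 < ρ i → (i : Set α) ∈ D) →
      ∀ x, ρ {y | R x y} = ∑' A : D, ρ A * (A : Set α).indicator 1 x := by
    intro ρ hρ x
    by_cases hx : {y | R x y} ∈ D ∧ x ∈ {y | R x y}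
    · rw [tsum_eq_single ⟨_, hx.1⟩]
      · simp [Set.indicator_of_mem hx.2]
      · rintro ⟨A, hA⟩ hne
        have hA' : x ∉ A := by
          intro hxA
          have h1 : {y | R x y} = A := by
            obtain ⟨i, -, rfl⟩ := hA
            exact hcls i x hxA
          exact hne (Subtype.ext h1.symm)
        simp [hA']
    · have h0 : ρ {y | R x y} = 0 := by
        by_contra h
        have h1 : 0 < ρ {y | R x y} := pos_iff_ne_zero.mpr h
        refine hx ⟨hρ ⟨_, x, rfl⟩ h1, ?_⟩
        obtain ⟨y, hy⟩ := nonempty_of_measure_ne_zero h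
        exact ht _ _ _ hy (hs _ _ hy)
      rw [h0, eq_comm, ENNReal.tsum_eq_zero]
      rintro ⟨A, hA⟩
      have hA' : x ∉ A := by
        intro hxA
        obtain ⟨i, hi, rfl⟩ := id hA
        have hi' := hcls i x hxA
        exact hx ⟨hi' ▸ hA, hi' ▸ hxA⟩
      simp [hA']
  refine ⟨D, (hcν.union hcμ).image _, ?_, key ν ?_, key μ ?_⟩
  · rintro _ ⟨i, -, rfl⟩
    exact hmeas i
  · intro i hi
    exact ⟨i, Or.inl hi, rfl⟩
  · intro i hi
    exact ⟨i, Or.inr hi, rfl⟩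

theorem measurable_measure_setOf (hs : ∀ x y, R x y → R y x)
    (ht : ∀ x y z, R x y → R y z → R x z) (hm : ∀ x, MeasurableSet {y | R x y})
    (ν : Measure α) [IsProbabilityMeasure ν] : Measurable fun x => ν {y | R x y} := by
  obtain ⟨D, hD, hDm, h, -⟩ := exists_measure_setOf_eq_tsum hs ht hm ν ν
  have := hD.to_subtype
  simp only [h]
  exact Measurable.tsum fun A =>
    (measurable_one.indicator (hDm A A.2)).const_mul _

/-- The indicator function of a partial equivalence relation is a positive definite kernel. -/
theorem two_mul_lintegral_measure_setOf_le (hs : ∀ x y, R x y → R y x)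
    (ht : ∀ x y z, R x y → R y z → R x z) (hm : ∀ x, MeasurableSet {y | R x y})
    (ν μ : Measure α) [IsProbabilityMeasure ν] [IsProbabilityMeasure μ] :
    2 * ∫⁻ x, μ {y | R x y} ∂ν ≤ ∫⁻ x, ν {y | R x y} ∂ν + ∫⁻ x, μ {y | R x y} ∂μ := by
  obtain ⟨D, hD, hDm, hν, hμ⟩ := exists_measure_setOf_eq_tsum hs ht hm ν μ
  have := hD.to_subtype
  have key : ∀ ρ ρ' : Measure α,
      ∫⁻ x, ∑' A : D, ρ A * (A : Set α).indicator 1 x ∂ρ' = ∑' A : D, ρ A * ρ' A := by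
    intro ρ ρ'
    rw [lintegral_tsum fun A : D =>
      ((measurable_one.indicator (hDm A A.2)).const_mul _).aemeasurable]
    refine tsum_congr fun A => ?_
    rw [lintegral_const_mul _ (measurable_one.indicator (hDm A A.2)),
      lintegral_indicator_one (hDm A A.2)]
  simp only [hν, hμ]
  rw [key, key, key, ← ENNReal.tsum_mul_left, ← ENNReal.tsum_add]
  refine ENNReal.tsum_le_tsum fun A => ?_
  rw [mul_comm (μ A)]
  exact two_mul_mul_le_add_mul_self _ _

end PartialEquivalence

/-! ### Discretization of a non-negative number -/

/-- `δ` times the number of `k ≥ 1` with `k δ < l`. -/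
def stepSum (δ l : ℝ≥0∞) : ℝ≥0∞ := ∑' k : ℕ, δ * (Set.Ioi ((k + 1) * δ)).indicator 1 l

theorem stepSum_le (δ l : ℝ≥0∞) : stepSum δ l ≤ l := by
  refine ENNReal.tsum_le_of_sum_range_le fun N => ?_
  induction N with
  | zero => simp
  | succ N ih =>
    by_cases h : (N + 1) * δ < l
    · calc _ ≤ ∑ k ∈ Finset.range (N + 1), δ := by
            refine Finset.sum_le_sum fun k _ => ?_
            by_cases hk : l ∈ Set.Ioi ((k + 1) * δ) <;> simp [hk]
        _ = (N + 1) * δ := by simp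
        _ ≤ l := h.le
    · rw [Finset.sum_range_succ, Set.indicator_of_notMem (by simpa using h), mul_zero, add_zero]
      exact ih

theorem le_stepSum_add {δ : ℝ≥0∞} (hδ : δ ≠ 0) (l : ℝ≥0∞) : l ≤ stepSum δ l + δ := by
  by_contra! h
  have key : ∀ N : ℕ, N * δ ≤ stepSum δ l := by
    intro N
    induction N with
    | zero => simp
    | succ N ih =>
      have h1 : (N + 1) * δ < l := by
        rw [add_mul, one_mul]
        exact (add_le_add_left ih δ).trans_lt h
      calc ((N + 1 : ℕ) : ℝ≥0∞) * δ = ∑ k ∈ Finset.range (N + 1), δ := by simp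
        _ = ∑ k ∈ Finset.range (N + 1), δ * (Set.Ioi ((k + 1) * δ)).indicator 1 l := by
            refine Finset.sum_congr rfl fun k hk => ?_
            have hk' : (k : ℝ≥0∞) ≤ N := by
              exact_mod_cast Nat.lt_succ_iff.mp (Finset.mem_range.mp hk)
            have h2 : l ∈ Set.Ioi (((k : ℝ≥0∞) + 1) * δ) := lt_of_le_of_lt (by gcongr) h1
            simp [h2]
        _ ≤ _ := ENNReal.sum_le_tsum _
  have htop : stepSum δ l = ⊤ := by
    refine ENNReal.eq_top_of_forall_nnreal_le fun r => ?_
    rcases eq_or_ne δ ⊤ with rfl | hδt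
    · have := key 1
      simp at this
      simp [this]
    · obtain ⟨N, hN⟩ := ENNReal.exists_nat_mul_gt hδ (ENNReal.coe_ne_top (r := r))
      exact hN.le.trans (key N)
  rw [htop, top_add] at h
  exact not_top_lt h

end Berkovich

end

noncomputable section

namespace Berkovich

section Coordinates

variable {K : Type*} [NontriviallyNormedField K]

theorem formAbs_C_mul (a : K) (P : K[X]) (n : ℕ) (x : P1 K) :
    formAbs (C a * P) n x = ‖a‖ * formAbs P n x := by
  induction x using OnePoint.rec with
  | infty => simp
  | coe x => rw [formAbs_coe, A1.val_mul, A1.val_C]; rfl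

/-- The first coordinate of the standard lift of a point of `ℙ¹`. -/
def coord0 : OnePoint K → K
  | ∞ => 1
  | (a : K) => a

/-- The second coordinate of the standard lift of a point of `ℙ¹`. -/
def coord1 : OnePoint K → K
  | ∞ => 0
  | (_ : K) => 1

theorem formAbs_ell (w : OnePoint K) (x : P1 K) :
    formAbs (ell w) 1 x = formAbs (C (coord1 w) * X - C (coord0 w)) 1 x := by
  induction w using OnePoint.rec with
  | infty =>
    simp only [coord0, coord1, ell_infty]
    induction x using OnePoint.rec with
    | infty => simp [coeff_one]
    | coe x => simp [A1.val_neg]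
  | coe a => simp [coord0, coord1]

theorem coordNorm_pt (w : OnePoint K) : coordNorm (pt w) = norm2 K ‖coord0 w‖ ‖coord1 w‖ := by
  induction w using OnePoint.rec with
  | infty => simpa [coord0, coord1] using (norm2_zero_right K zero_le_one).symm
  | coe a => simp [coord0, coord1, coordNorm_coe]

theorem formAbs_ell_pt (w z : OnePoint K) :
    formAbs (ell w) 1 (pt z) = ‖coord1 w * coord0 z - coord0 w * coord1 z‖ := by
  rw [formAbs_ell]
  induction z using OnePoint.rec with
  | infty => simp [coord0, coord1]
  | coe a => simp [coord0, coord1]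

theorem bddBelow_hsiaAff (x y : A1 K) :
    BddBelow (Set.range fun a : K => max (x.val (X - C a)) (y.val (X - C a))) := by
  refine ⟨0, ?_⟩
  rintro _ ⟨a, rfl⟩
  exact (x.val_nonneg _).trans (le_max_left _ _)

theorem hsia_coe_pt_coe (x : A1 K) (a : K) : hsia (x : P1 K) (pt (a : OnePoint K))
    = x.val (X - C a) / (coordNorm (x : P1 K) * coordNorm (pt (a : OnePoint K))) := hsia_pt _ _

/-- The discretization, of step `δ`, of the kernel `-log [x, y]_can`. -/
def stepKer (δ : ℝ≥0∞) (x y : P1 K) : ℝ≥0∞ := stepSum δ (logKer x y)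

theorem lt_negLog_iff {r t : ℝ} (hr : 0 ≤ r) (ht : 0 ≤ t) :
    ENNReal.ofReal r < negLog t ↔ t < Real.exp (-r) := by
  rcases ht.eq_or_lt with rfl | ht
  · simp [negLog_zero, Real.exp_pos]
  · rw [negLog_of_pos ht, ENNReal.ofReal_lt_ofReal_iff_of_nonneg hr, ← Real.log_lt_iff_lt_exp ht]
    exact lt_neg

theorem setOf_lt_logKer {r : ℝ} (hr : 0 ≤ r) (x : P1 K) :
    {y | ENNReal.ofReal r < logKer x y} = {y | hsia x y < Real.exp (-r)} := by
  ext y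
  exact lt_negLog_iff hr (hsia_nonneg x y)

theorem lintegral_stepKer_le (δ : ℝ≥0∞) (x : P1 K) (ν : Measure (P1 K)) :
    ∫⁻ y, stepKer δ x y ∂ν ≤ ∫⁻ y, logKer x y ∂ν :=
  lintegral_mono fun _ => stepSum_le _ _

theorem lintegral_logKer_le {δ : ℝ≥0∞} (hδ : δ ≠ 0) (x : P1 K) (ν : Measure (P1 K))
    [IsProbabilityMeasure ν] : ∫⁻ y, logKer x y ∂ν ≤ ∫⁻ y, stepKer δ x y ∂ν + δ := by
  calc ∫⁻ y, logKer x y ∂ν ≤ ∫⁻ y, (stepKer δ x y + δ) ∂ν :=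
        lintegral_mono fun _ => le_stepSum_add hδ _
    _ = _ := by rw [lintegral_add_right _ measurable_const]; simp

end Coordinates

section Ultrametric

variable {K : Type*} [NontriviallyNormedField K] [hu : IsUltrametricDist K]

/-! ### The Hsia kernel of a non-archimedean field -/

variable (K) in
theorem norm2_eq_max (a b : ℝ) : norm2 K a b = max a b := if_pos hu

theorem coordNorm_coe_eq_max (x : A1 K) : coordNorm (x : P1 K) = max (x.val X) 1 := by
  rw [coordNorm_coe, norm2_eq_max]

theorem hsiaAff_eq (x y : A1 K) :
    hsiaAff x y = ⨅ a : K, max (x.val (X - C a)) (y.val (X - C a)) := if_pos hu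

theorem hsiaAff_le (x y : A1 K) (a : K) :
    hsiaAff x y ≤ max (x.val (X - C a)) (y.val (X - C a)) := by
  rw [hsiaAff_eq]
  exact ciInf_le (bddBelow_hsiaAff x y) a

theorem hsiaAff_lt_iff (x y : A1 K) (r : ℝ) :
    hsiaAff x y < r ↔ ∃ a : K, x.val (X - C a) < r ∧ y.val (X - C a) < r := by
  rw [hsiaAff_eq, ciInf_lt_iff (bddBelow_hsiaAff x y)]
  simp only [max_lt_iff]

theorem hsiaAff_le_max (x y : A1 K) :
    hsiaAff x y ≤ max (coordNorm (x : P1 K)) (coordNorm (y : P1 K)) := by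
  refine (hsiaAff_le x y 0).trans ?_
  rw [C_0, sub_zero, coordNorm_coe_eq_max, coordNorm_coe_eq_max]
  exact max_le_max (le_max_left _ _) (le_max_left _ _)

theorem hsia_le_one_of_ultrametric (x y : P1 K) : hsia x y ≤ 1 := by
  induction x using OnePoint.rec with
  | infty =>
    induction y using OnePoint.rec with
    | infty => exact zero_le_one
    | coe y => exact div_le_one_of_le₀ (one_le_coordNorm _) (coordNorm_pos _).le
  | coe x =>
    induction y using OnePoint.rec with
    | infty => exact div_le_one_of_le₀ (one_le_coordNorm _) (coordNorm_pos _).le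
    | coe y =>
      have hx := one_le_coordNorm (x : P1 K)
      have hy := one_le_coordNorm (y : P1 K)
      refine div_le_one_of_le₀ ((hsiaAff_le_max x y).trans ?_) (by positivity)
      exact max_le (by nlinarith) (by nlinarith)

theorem coordNorm_evalPt (a : K) : coordNorm ((evalPt a : A1 K) : P1 K) = max ‖a‖ 1 := by
  rw [coordNorm_coe_eq_max]; simp

theorem coordNorm_coe_le_max (x : A1 K) (a : K) :
    coordNorm (x : P1 K) ≤ max (x.val (X - C a)) (coordNorm (pt (a : OnePoint K))) := by
  rw [coordNorm_coe_eq_max, pt_coe, coordNorm_evalPt]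
  refine max_le ?_ ((le_max_right _ _).trans (le_max_right _ _))
  calc x.val X = x.val ((X - C a) + C a) := by rw [sub_add_cancel]
    _ ≤ max (x.val (X - C a)) (x.val (C a)) := x.val_add_le_max _ _
    _ ≤ _ := by
      rw [A1.val_C]
      exact max_le_max le_rfl (le_max_left _ _)

theorem coordNorm_pt_le_max (x : A1 K) (a : K) :
    coordNorm (pt (a : OnePoint K)) ≤ max (x.val (X - C a)) (coordNorm (x : P1 K)) := by
  rw [coordNorm_coe_eq_max, pt_coe, coordNorm_evalPt]
  refine max_le ?_ ((le_max_right _ _).trans (le_max_right _ _))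
  calc ‖a‖ = x.val (C a) := (x.val_C a).symm
    _ = x.val (X - (X - C a)) := by rw [sub_sub_cancel]
    _ ≤ max (x.val X) (x.val (X - C a)) := x.val_sub_le_max _ _
    _ ≤ _ := by
      rw [max_comm]
      exact max_le_max le_rfl (le_max_left _ _)

theorem formAbs_sub_le_max (P Q : K[X]) (n : ℕ) (x : P1 K) :
    formAbs (P - Q) n x ≤ max (formAbs P n x) (formAbs Q n x) := by
  induction x using OnePoint.rec with
  | infty =>
    simp only [formAbs_infty, coeff_sub]
    rw [sub_eq_add_neg, ← norm_neg (Q.coeff n)]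
    exact IsUltrametricDist.norm_add_le_max _ _
  | coe x => exact x.val_sub_le_max P Q

theorem hsia_pt_le_max (x : P1 K) (w z : OnePoint K) :
    hsia x (pt w) ≤ max (hsia x (pt z)) (hsia (pt w) (pt z)) := by
  have hx := coordNorm_pos x
  have hw := coordNorm_pos (pt w)
  have hz := coordNorm_pos (pt z)
  have key : formAbs (ell w) 1 x * coordNorm (pt z) ≤
      max (formAbs (ell z) 1 x * coordNorm (pt w)) (formAbs (ell z) 1 (pt w) * coordNorm x) := by
    rw [coordNorm_pt z, norm2_eq_max, mul_max_of_nonneg _ _ (formAbs_nonneg _ _ _)]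
    have hcx : coordNorm x = max (formAbs X 1 x) (formAbs 1 1 x) := by
      rw [coordNorm, norm2_eq_max]
    have hcw : coordNorm (pt w) = max ‖coord0 w‖ ‖coord1 w‖ := by rw [coordNorm_pt, norm2_eq_max]
    rw [formAbs_ell_pt, formAbs_ell w, formAbs_ell z, mul_comm _ ‖coord0 z‖, mul_comm _ ‖coord1 z‖,
      ← formAbs_C_mul, ← formAbs_C_mul]
    refine max_le ?_ ?_
    · have e : C (coord0 z) * (C (coord1 w) * X - C (coord0 w))
          = C (coord0 w) * (C (coord1 z) * X - C (coord0 z))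
            - C (coord1 z * coord0 w - coord0 z * coord1 w) * X := by
        simp only [map_sub, map_mul]; ring
      rw [e]
      refine (formAbs_sub_le_max _ _ _ _).trans (max_le_max ?_ ?_)
      · rw [formAbs_C_mul, mul_comm, hcw]
        exact mul_le_mul_of_nonneg_left (le_max_left _ _) (formAbs_nonneg _ _ _)
      · rw [formAbs_C_mul, hcx]
        exact mul_le_mul_of_nonneg_left (le_max_left _ _) (norm_nonneg _)
    · have e : C (coord1 z) * (C (coord1 w) * X - C (coord0 w))
          = C (coord1 w) * (C (coord1 z) * X - C (coord0 z))
            - C (coord1 z * coord0 w - coord0 z * coord1 w) * 1 := by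
        simp only [map_sub, map_mul]; ring
      rw [e]
      refine (formAbs_sub_le_max _ _ _ _).trans (max_le_max ?_ ?_)
      · rw [formAbs_C_mul, mul_comm, hcw]
        exact mul_le_mul_of_nonneg_left (le_max_right _ _) (formAbs_nonneg _ _ _)
      · rw [formAbs_C_mul, hcx]
        exact mul_le_mul_of_nonneg_left (le_max_right _ _) (norm_nonneg _)
  rw [hsia_pt, hsia_pt, hsia_pt, div_le_iff₀ (by positivity), max_mul_of_nonneg _ _ (by positivity)]
  have h1 := div_le_div_of_nonneg_right key hz.le
  rw [mul_div_cancel_right₀ _ hz.ne', ← max_div_div_right hz.le] at h1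
  refine h1.trans (le_of_eq ?_)
  congr 1 <;> field_simp

theorem hsia_pt_pt_le_max (x : P1 K) (w z : OnePoint K) :
    hsia (pt w) (pt z) ≤ max (hsia x (pt w)) (hsia x (pt z)) := by
  have hx := coordNorm_pos x
  have hw := coordNorm_pos (pt w)
  have hz := coordNorm_pos (pt z)
  have key : formAbs (ell z) 1 (pt w) * coordNorm x ≤
      max (formAbs (ell w) 1 x * coordNorm (pt z)) (formAbs (ell z) 1 x * coordNorm (pt w)) := by
    have hcx : coordNorm x = max (formAbs X 1 x) (formAbs 1 1 x) := by
      rw [coordNorm, norm2_eq_max]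
    rw [hcx, mul_max_of_nonneg _ _ (formAbs_nonneg _ _ _), formAbs_ell_pt, formAbs_ell w,
      formAbs_ell z, coordNorm_pt, coordNorm_pt, norm2_eq_max, norm2_eq_max, ← formAbs_C_mul,
      ← formAbs_C_mul, max_comm]
    refine max_le ?_ ?_
    · have e : C (coord1 z * coord0 w - coord0 z * coord1 w) * 1
          = C (coord1 w) * (C (coord1 z) * X - C (coord0 z))
            - C (coord1 z) * (C (coord1 w) * X - C (coord0 w)) := by
        simp only [map_sub, map_mul]; ring
      rw [e]
      refine (formAbs_sub_le_max _ _ _ _).trans ?_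
      rw [formAbs_C_mul, formAbs_C_mul, max_comm, mul_comm, mul_comm ‖coord1 w‖]
      exact max_le_max (mul_le_mul_of_nonneg_left (le_max_right _ _) (formAbs_nonneg _ _ _))
        (mul_le_mul_of_nonneg_left (le_max_right _ _) (formAbs_nonneg _ _ _))
    · have e : C (coord1 z * coord0 w - coord0 z * coord1 w) * X
          = C (coord0 w) * (C (coord1 z) * X - C (coord0 z))
            - C (coord0 z) * (C (coord1 w) * X - C (coord0 w)) := by
        simp only [map_sub, map_mul]; ring
      rw [e]
      refine (formAbs_sub_le_max _ _ _ _).trans ?_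
      rw [formAbs_C_mul, formAbs_C_mul, max_comm, mul_comm, mul_comm ‖coord0 w‖]
      exact max_le_max (mul_le_mul_of_nonneg_left (le_max_left _ _) (formAbs_nonneg _ _ _))
        (mul_le_mul_of_nonneg_left (le_max_left _ _) (formAbs_nonneg _ _ _))
  rw [hsia_pt, hsia_pt, hsia_pt, div_le_iff₀ (by positivity), max_mul_of_nonneg _ _ (by positivity)]
  have h1 := div_le_div_of_nonneg_right key hx.le
  rw [mul_div_cancel_right₀ _ hx.ne', ← max_div_div_right hx.le] at h1
  refine h1.trans (le_of_eq ?_)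
  congr 1 <;> field_simp

theorem exists_hsia_pt_lt_of_mul_le_one {x y : A1 K} {s : ℝ}
    (hsx : s * coordNorm (x : P1 K) ≤ 1) (h : hsia (x : P1 K) (y : P1 K) < s) :
    ∃ w : OnePoint K, hsia (x : P1 K) (pt w) < s ∧ hsia (y : P1 K) (pt w) < s := by
  have hx := coordNorm_pos (x : P1 K)
  have hy := coordNorm_pos (y : P1 K)
  change hsiaAff x y / _ < s at h
  rw [div_lt_iff₀ (mul_pos hx hy), hsiaAff_lt_iff] at h
  obtain ⟨b, hu, hv⟩ := h
  refine ⟨(b : OnePoint K), ?_⟩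
  have hb := coordNorm_pos (pt (b : OnePoint K))
  rw [hsia_coe_pt_coe, hsia_coe_pt_coe, div_lt_iff₀ (mul_pos hx hb), div_lt_iff₀ (mul_pos hy hb)]
  have a1 := coordNorm_coe_le_max x b
  have a2 := coordNorm_coe_le_max y b
  have a3 := coordNorm_pt_le_max x b
  have a4 := coordNorm_pt_le_max y b
  generalize coordNorm (x : P1 K) = Mx at *
  generalize coordNorm (y : P1 K) = My at *
  generalize coordNorm (pt (b : OnePoint K)) = Mb at *
  generalize x.val (X - C b) = u at *
  generalize y.val (X - C b) = v at *
  have h1 : s * (Mx * My) ≤ My := by nlinarith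
  have h2 : My ≤ Mb := (le_max_iff.mp a2).resolve_left (by linarith)
  have h3 : Mb ≤ Mx := (le_max_iff.mp a3).resolve_left (by linarith)
  have h4 : s * (Mx * My) ≤ Mx := by nlinarith
  have h5 : Mx ≤ Mb := (le_max_iff.mp a1).resolve_left (by linarith)
  have h6 : Mb ≤ My := (le_max_iff.mp a4).resolve_left (by linarith)
  have e1 : Mb = Mx := le_antisymm h3 h5
  have e2 : My = Mx := by linarith
  subst e1 e2
  exact ⟨hu, hv⟩

theorem hsia_lt_of_hsia_pt_lt {x y : A1 K} {s : ℝ} {a : K}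
    (hxy : coordNorm (x : P1 K) ≤ coordNorm (y : P1 K))
    (h1 : hsia (x : P1 K) (pt (a : OnePoint K)) < s)
    (h2 : hsia (y : P1 K) (pt (a : OnePoint K)) < s) : hsia (x : P1 K) (y : P1 K) < s := by
  have hx := coordNorm_pos (x : P1 K)
  have hy := coordNorm_pos (y : P1 K)
  have ha := coordNorm_pos (pt (a : OnePoint K))
  change hsiaAff x y / _ < s
  rw [hsia_coe_pt_coe, div_lt_iff₀ (mul_pos hx ha)] at h1
  rw [hsia_coe_pt_coe, div_lt_iff₀ (mul_pos hy ha)] at h2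
  rw [div_lt_iff₀ (mul_pos hx hy)]
  have a1 := coordNorm_coe_le_max x a
  have a2 := coordNorm_coe_le_max y a
  have a3 := coordNorm_pt_le_max x a
  have a5 := hsiaAff_le x y a
  have a6 := hsiaAff_le_max x y
  rw [max_eq_right hxy] at a6
  generalize coordNorm (x : P1 K) = Mx at *
  generalize coordNorm (y : P1 K) = My at *
  generalize coordNorm (pt (a : OnePoint K)) = Ma at *
  generalize x.val (X - C a) = u at *
  generalize y.val (X - C a) = v at *
  rcases lt_or_ge 1 (s * Mx) with h | h
  · nlinarith
  · have h3 : s * (Mx * Ma) ≤ Ma := by nlinarith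
    have h4 : Mx ≤ Ma := a1.trans (max_le (by linarith) le_rfl)
    have h5 : Ma ≤ Mx := (le_max_iff.mp a3).resolve_left (by linarith)
    have e1 : Ma = Mx := le_antisymm h5 h4
    subst e1
    have h6 : s * (My * Ma) ≤ My := by nlinarith
    have h7 : My ≤ Ma := (le_max_iff.mp a2).resolve_left (by linarith)
    have e2 : My = Ma := le_antisymm h7 hxy
    subst e2
    exact a5.trans_lt (max_lt h1 h2)

/-- A chordal disc contains two points if and only if it contains them
together with a classical point. -/
theorem hsia_lt_iff {s : ℝ} (hs0 : 0 < s) (x y : P1 K) :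
    hsia x y < s ↔ ∃ w : OnePoint K, hsia x (pt w) < s ∧ hsia y (pt w) < s := by
  have hinf : ∀ z : P1 K, hsia (∞ : P1 K) z < s ↔
      ∃ w : OnePoint K, hsia (∞ : P1 K) (pt w) < s ∧ hsia z (pt w) < s := by
    intro z
    constructor
    · intro h
      exact ⟨∞, hs0, (hsia_comm z _).trans_lt h⟩
    · rintro ⟨w, h1, h2⟩
      rw [hsia_comm, ← pt_infty]
      refine (hsia_pt_le_max z ∞ w).trans_lt (max_lt h2 h1)
  induction x using OnePoint.rec with
  | infty => exact hinf y
  | coe x =>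
    induction y using OnePoint.rec with
    | infty =>
      rw [hsia_comm, hinf]
      simp only [and_comm]
    | coe y =>
      have hx := coordNorm_pos (x : P1 K)
      have hy := coordNorm_pos (y : P1 K)
      have ex : hsia (x : P1 K) (pt ∞) = 1 / coordNorm (x : P1 K) := rfl
      have ey : hsia (y : P1 K) (pt ∞) = 1 / coordNorm (y : P1 K) := rfl
      constructor
      · intro h
        rcases le_or_gt (s * coordNorm (x : P1 K)) 1 with h1 | h1
        · exact exists_hsia_pt_lt_of_mul_le_one h1 h
        · rcases le_or_gt (s * coordNorm (y : P1 K)) 1 with h2 | h2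
          · obtain ⟨w, hw1, hw2⟩ := exists_hsia_pt_lt_of_mul_le_one h2
              ((hsia_comm _ _).trans_lt h)
            exact ⟨w, hw2, hw1⟩
          · refine ⟨∞, ?_, ?_⟩
            · rwa [ex, div_lt_iff₀ hx]
            · rwa [ey, div_lt_iff₀ hy]
      · rintro ⟨w, h1, h2⟩
        induction w using OnePoint.rec with
        | infty =>
          rw [ex, div_lt_iff₀ hx] at h1
          rw [ey, div_lt_iff₀ hy] at h2
          change hsiaAff x y / _ < s
          rw [div_lt_iff₀ (mul_pos hx hy)]
          refine (hsiaAff_le_max x y).trans_lt (max_lt ?_ ?_) <;> nlinarith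
        | coe a =>
          rcases le_total (coordNorm (x : P1 K)) (coordNorm (y : P1 K)) with h | h
          · exact hsia_lt_of_hsia_pt_lt h h1 h2
          · rw [hsia_comm]
            exact hsia_lt_of_hsia_pt_lt h h2 h1

theorem isOpen_setOf_hsia_lt {s : ℝ} (hs0 : 0 < s) (x : P1 K) :
    IsOpen {y | hsia x y < s} := by
  have : {y | hsia x y < s} = ⋃ (w : OnePoint K) (_ : hsia x (pt w) < s),
      {y | hsia y (pt w) < s} := by
    ext y
    simp [hsia_lt_iff hs0 x y]
  rw [this]
  exact isOpen_iUnion fun w => isOpen_iUnion fun _ =>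
    isOpen_lt (continuous_hsia_pt w) continuous_const

theorem measurable_hsia_of_ultrametric (x : P1 K) : Measurable (hsia x) := by
  refine measurable_of_Iio fun s => ?_
  rcases le_or_gt s 0 with h0 | h0
  · have : hsia x ⁻¹' Set.Iio s = ∅ := by
      ext y
      simpa using h0.trans (hsia_nonneg x y)
    rw [this]
    exact MeasurableSet.empty
  · exact (isOpen_setOf_hsia_lt h0 x).measurableSet

theorem hsia_lt_trans {s : ℝ} (hs0 : 0 < s) {x y z : P1 K} (h1 : hsia x y < s)
    (h2 : hsia y z < s) : hsia x z < s := by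
  obtain ⟨w, hw1, hw2⟩ := (hsia_lt_iff hs0 x y).mp h1
  obtain ⟨v, hv1, hv2⟩ := (hsia_lt_iff hs0 y z).mp h2
  refine (hsia_lt_iff hs0 x z).mpr ⟨w, hw1, ?_⟩
  refine (hsia_pt_le_max z w v).trans_lt (max_lt hv2 ?_)
  exact (hsia_pt_pt_le_max y w v).trans_lt (max_lt hw2 hv1)

/-! ### Energy -/

theorem measurable_logKer_of_ultrametric (x : P1 K) : Measurable (logKer x) :=
  measurable_negLog.comp (measurable_hsia_of_ultrametric x)

theorem lintegral_stepKer {r : ℝ} (hr : 0 < r) (x : P1 K) (ν : Measure (P1 K)) :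
    ∫⁻ y, stepKer (ENNReal.ofReal r) x y ∂ν
      = ∑' k : ℕ, ENNReal.ofReal r * ν {y | hsia x y < Real.exp (-((k + 1) * r))} := by
  have hm : ∀ k : ℕ, MeasurableSet {y | hsia x y < Real.exp (-((k + 1) * r))} := fun k =>
    (isOpen_setOf_hsia_lt (Real.exp_pos _) x).measurableSet
  have he : ∀ (k : ℕ) (y : P1 K),
      (Set.Ioi ((k + 1) * ENNReal.ofReal r)).indicator (1 : ℝ≥0∞ → ℝ≥0∞) (logKer x y)
        = {y | hsia x y < Real.exp (-((k + 1) * r))}.indicator 1 y := by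
    intro k y
    rw [← setOf_lt_logKer (by positivity) x]
    have : ENNReal.ofReal ((k + 1) * r) = (k + 1) * ENNReal.ofReal r := by
      rw [ENNReal.ofReal_mul (by positivity), ENNReal.ofReal_add (by positivity) zero_le_one,
        ENNReal.ofReal_natCast, ENNReal.ofReal_one]
    rw [this]
    rfl
  simp only [stepKer, stepSum, he]
  rw [lintegral_tsum fun k => ((measurable_one.indicator (hm k)).const_mul _).aemeasurable]
  refine tsum_congr fun k => ?_
  rw [lintegral_const_mul _ (measurable_one.indicator (hm k)), lintegral_indicator_one (hm k)]

theorem measurable_lintegral_stepKer {r : ℝ} (hr : 0 < r) (ν : Measure (P1 K))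
    [IsProbabilityMeasure ν] :
    Measurable fun x => ∫⁻ y, stepKer (ENNReal.ofReal r) x y ∂ν := by
  simp only [lintegral_stepKer hr]
  refine Measurable.tsum fun k => Measurable.const_mul ?_ _
  have hs0 := Real.exp_pos (-((k + 1) * r))
  exact measurable_measure_setOf (R := fun x y => hsia x y < Real.exp (-((k + 1) * r)))
    (fun x y h => (hsia_comm y x).trans_lt h) (fun x y z h1 h2 => hsia_lt_trans hs0 h1 h2)
    (fun x => (isOpen_setOf_hsia_lt hs0 x).measurableSet) ν

theorem two_mul_lintegral_stepKer_le {r : ℝ} (hr : 0 < r) (ν μ : Measure (P1 K))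
    [IsProbabilityMeasure ν] [IsProbabilityMeasure μ] :
    2 * ∫⁻ x, ∫⁻ y, stepKer (ENNReal.ofReal r) x y ∂μ ∂ν
      ≤ ∫⁻ x, ∫⁻ y, stepKer (ENNReal.ofReal r) x y ∂ν ∂ν
        + ∫⁻ x, ∫⁻ y, stepKer (ENNReal.ofReal r) x y ∂μ ∂μ := by
  have hs0 : ∀ k : ℕ, 0 < Real.exp (-((k + 1) * r)) := fun k => Real.exp_pos _
  have hm : ∀ (k : ℕ) (ρ : Measure (P1 K)), IsProbabilityMeasure ρ →
      Measurable fun x => ρ {y | hsia x y < Real.exp (-((k + 1) * r))} := fun k ρ hρ =>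
    measurable_measure_setOf (R := fun x y => hsia x y < Real.exp (-((k + 1) * r)))
      (fun x y h => (hsia_comm y x).trans_lt h)
      (fun x y z h1 h2 => hsia_lt_trans (hs0 k) h1 h2)
      (fun x => (isOpen_setOf_hsia_lt (hs0 k) x).measurableSet) ρ
  have key : ∀ ρ ρ' : Measure (P1 K), IsProbabilityMeasure ρ →
      ∫⁻ x, ∫⁻ y, stepKer (ENNReal.ofReal r) x y ∂ρ ∂ρ' = ∑' k : ℕ, ENNReal.ofReal r *
        ∫⁻ x, ρ {y | hsia x y < Real.exp (-((k + 1) * r))} ∂ρ' := by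
    intro ρ ρ' hρ
    simp only [lintegral_stepKer hr]
    rw [lintegral_tsum fun k => ((hm k ρ hρ).const_mul _).aemeasurable]
    exact tsum_congr fun k => lintegral_const_mul _ (hm k ρ hρ)
  rw [key μ ν inferInstance, key ν ν inferInstance, key μ μ inferInstance,
    ← ENNReal.tsum_mul_left, ← ENNReal.tsum_add]
  refine ENNReal.tsum_le_tsum fun k => ?_
  rw [← mul_add, mul_left_comm]
  gcongr
  exact two_mul_lintegral_measure_setOf_le (R := fun x y => hsia x y < Real.exp (-((k + 1) * r)))
    (fun x y h => (hsia_comm y x).trans_lt h)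
    (fun x y z h1 h2 => hsia_lt_trans (hs0 k) h1 h2)
    (fun x => (isOpen_setOf_hsia_lt (hs0 k) x).measurableSet) ν μ

variable (K) in
theorem kernelProps_of_ultrametric : KernelProps K where
  hsia_le_one := hsia_le_one_of_ultrametric
  measurable_hsia := measurable_hsia_of_ultrametric
  measurable_potential ν _ := by
    have hpos : ∀ n : ℕ, 0 < (1 : ℝ) / (n + 1) := fun n => Nat.one_div_pos_of_nat
    have : (fun x => ∫⁻ y, logKer x y ∂ν)
        = fun x => ⨆ n : ℕ, ∫⁻ y, stepKer (ENNReal.ofReal (1 / (n + 1))) x y ∂ν := by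
      ext x
      refine le_antisymm ?_ (iSup_le fun n => lintegral_stepKer_le _ x ν)
      refine ENNReal.le_of_forall_pos_le_add fun ε hε _ => ?_
      obtain ⟨n, hn⟩ := exists_nat_one_div_lt (show (0 : ℝ) < ε from hε)
      have h1 := lintegral_logKer_le (by simpa using hpos n) x ν
        (δ := ENNReal.ofReal (1 / ((n : ℝ) + 1)))
      refine h1.trans (add_le_add (le_iSup (fun n : ℕ =>
        ∫⁻ y, stepKer (ENNReal.ofReal (1 / (n + 1))) x y ∂ν) n) ?_)
      rw [← ENNReal.ofReal_coe_nnreal]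
      exact ENNReal.ofReal_le_ofReal hn.le
    rw [this]
    exact Measurable.iSup fun n => measurable_lintegral_stepKer (hpos n) ν
  energy_le ν μ _ _ := by
    refine ENNReal.le_of_forall_pos_le_add fun ε hε _ => ?_
    have hr : (0 : ℝ) < ε / 2 := by positivity
    set δ := ENNReal.ofReal (ε / 2) with hδ
    have hδ0 : δ ≠ 0 := by simpa [hδ] using hε
    have h2 : 2 * δ = ε := by
      rw [hδ, ← ENNReal.ofReal_ofNat 2, ← ENNReal.ofReal_mul (by norm_num),
        mul_div_cancel₀ _ two_ne_zero, ENNReal.ofReal_coe_nnreal]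
    calc 2 * ∫⁻ x, ∫⁻ y, logKer x y ∂μ ∂ν
        ≤ 2 * ∫⁻ x, (∫⁻ y, stepKer δ x y ∂μ + δ) ∂ν := by
          gcongr with x
          exact lintegral_logKer_le hδ0 x μ
      _ = 2 * ∫⁻ x, ∫⁻ y, stepKer δ x y ∂μ ∂ν + ε := by
          rw [lintegral_add_right _ measurable_const, mul_add]
          simp [h2]
      _ ≤ _ := by
          gcongr
          refine (two_mul_lintegral_stepKer_le hr ν μ).trans ?_
          gcongr <;> exact stepSum_le _ _

end Ultrametric

end Berkovich

end

noncomputable section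

namespace Berkovich

/-- The potential of `μ` with respect to the kernel `-log [x, y]_can` is `A - g`. -/
def HasPotential {K : Type*} [NontriviallyNormedField K] (g : P1 K → ℝ) (μ : Measure (P1 K))
    (A : ℝ) : Prop :=
  ∀ x, g x ≤ A ∧ ∫⁻ y, logKer x y ∂μ = ENNReal.ofReal (A - g x)

theorem A1.tendsto_coe_infty_of_val_X {K : Type*} [NontriviallyNormedField K] {ι : Type*}
    {l : Filter ι} {S : ι → A1 K} (h : Tendsto (fun i => (S i).val X) l atTop) :
    Tendsto (fun i => (S i : P1 K)) l (𝓝 ∞) := by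
  refine OnePoint.tendsto_coe_infty.comp ?_
  refine hasBasis_coclosedCompact.tendsto_right_iff.mpr fun Z hZ => ?_
  obtain ⟨R, hR⟩ := hZ.2.bddAbove_image (A1.continuous_val X).continuousOn
  filter_upwards [h.eventually_gt_atTop R] with i hi hmem
  exact absurd (hR (Set.mem_image_of_mem _ hmem)) (not_le.mpr hi)

section Ultrametric

variable {K : Type*} [NontriviallyNormedField K] [hu : IsUltrametricDist K]

/-! ### Discs -/

variable (K) in
theorem isNonarchimedean_toAbsoluteValue : IsNonarchimedean (NormedField.toAbsoluteValue K) :=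
  fun a b => IsUltrametricDist.isNonarchimedean_norm a b

/-- The point of the Berkovich affine line given by the disc of centre `a` and radius `r`. -/
def discPt (a : K) (r : ℝ) (hr : 0 < r) : A1 K :=
  ⟨{ toFun := fun P => (P.comp (X + C a)).gaussNorm (NormedField.toAbsoluteValue K) r
     map_zero' := by simp
     add_le' := fun P Q => by
       rw [add_comp]
       exact (isNonarchimedean_gaussNorm _ (isNonarchimedean_toAbsoluteValue K) hr.le _ _).trans
         (max_le_add_of_nonneg (gaussNorm_nonneg _ _ hr.le) (gaussNorm_nonneg _ _ hr.le))
     neg' := fun P => by simp only [neg_comp, gaussNorm, support_neg, coeff_neg, map_neg_eq_map]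
     map_one' := by
       rw [one_comp, ← C_1, gaussNorm_C]
       simp
     map_mul' := fun P Q => by
       rw [mul_comp]
       exact gaussNorm_mul (isNonarchimedean_toAbsoluteValue K) hr _ _ }, fun b => by
      change ((C b).comp (X + C a)).gaussNorm (NormedField.toAbsoluteValue K) r = ‖b‖
      rw [C_comp, gaussNorm_C]
      rfl⟩

theorem val_discPt_X_sub_C (a : K) {r : ℝ} (hr : 0 < r) (b : K) :
    (discPt a r hr).val (X - C b) = max r ‖a - b‖ := by
  change ((X - C b).comp (X + C a)).gaussNorm (NormedField.toAbsoluteValue K) r = _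
  have e : (X - C b).comp (X + C a) = X + C (a - b) := by simp; ring
  have hX : (X : K[X]).gaussNorm (NormedField.toAbsoluteValue K) r = r := by
    rw [← monomial_one_one_eq_X, gaussNorm_monomial]
    simp
  rw [e]
  refine le_antisymm ?_ (max_le ?_ ?_)
  · refine (isNonarchimedean_gaussNorm _ (isNonarchimedean_toAbsoluteValue K) hr.le _ _).trans ?_
    rw [hX, gaussNorm_C]
    rfl
  · have := le_gaussNorm (NormedField.toAbsoluteValue K) (X + C (a - b)) hr.le 1
    simpa [coeff_C] using this
  · have := le_gaussNorm (NormedField.toAbsoluteValue K) (X + C (a - b)) hr.le 0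
    simp only [coeff_add, coeff_X_zero, coeff_C_zero, zero_add, pow_zero, mul_one] at this
    exact this

theorem val_discPt_X (a : K) {r : ℝ} (hr : 0 < r) : (discPt a r hr).val X = max r ‖a‖ := by
  have := val_discPt_X_sub_C a hr 0
  rwa [C_0, sub_zero, sub_zero] at this

variable (K) in
theorem gaussPt_eq_discPt : gaussPt K = discPt 0 1 one_pos := by
  refine A1.ext fun P => ?_
  change P.gaussNorm (NormedField.toAbsoluteValue K) 1
    = (P.comp (X + C 0)).gaussNorm (NormedField.toAbsoluteValue K) 1
  simp

theorem coe_discPt_notMem_range_pt (a : K) {r : ℝ} (hr : 0 < r) :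
    ((discPt a r hr : A1 K) : P1 K) ∉ Set.range (pt : OnePoint K → P1 K) := by
  rintro ⟨w, hw⟩
  induction w using OnePoint.rec with
  | infty => exact OnePoint.infty_ne_coe _ hw
  | coe b =>
    have h1 : evalPt b = discPt a r hr := OnePoint.coe_injective hw
    have h2 := val_discPt_X_sub_C a hr b
    rw [← h1, A1.val_evalPt] at h2
    simp only [eval_sub, eval_X, eval_C, sub_self, norm_zero] at h2
    exact absurd (le_max_left r ‖a - b‖) (by rw [← h2]; exact not_le.mpr hr)

theorem hsiaAff_discPt (a : K) {r : ℝ} (hr : 0 < r) (y : A1 K) :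
    hsiaAff (discPt a r hr) y = max r (y.val (X - C a)) := by
  refine le_antisymm ?_ ?_
  · refine (hsiaAff_le _ y a).trans (le_of_eq ?_)
    rw [val_discPt_X_sub_C, sub_self, norm_zero, max_eq_left hr.le]
  · rw [hsiaAff_eq]
    refine le_ciInf fun b => ?_
    rw [val_discPt_X_sub_C]
    refine max_le ((le_max_left _ _).trans (le_max_left _ _)) ?_
    calc y.val (X - C a) = y.val ((X - C b) - C (a - b)) := by
          congr 1; rw [C_sub]; ring
      _ ≤ max (y.val (X - C b)) (y.val (C (a - b))) := y.val_sub_le_max _ _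
      _ ≤ _ := by
        rw [A1.val_C, max_comm]
        exact max_le_max (le_max_right _ _) le_rfl

theorem hsia_discPt_coe (a : K) {r : ℝ} (hr : 0 < r) (y : A1 K) :
    hsia ((discPt a r hr : A1 K) : P1 K) (y : P1 K)
      = max r (y.val (X - C a)) / (max (max r ‖a‖) 1 * coordNorm (y : P1 K)) := by
  change hsiaAff _ y / _ = _
  rw [hsiaAff_discPt, coordNorm_coe_eq_max (discPt a r hr), val_discPt_X]

theorem hsia_discPt_infty (a : K) {r : ℝ} (hr : 0 < r) :
    hsia ((discPt a r hr : A1 K) : P1 K) ∞ = 1 / max (max r ‖a‖) 1 := by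
  change 1 / _ = _
  rw [coordNorm_coe_eq_max, val_discPt_X]

theorem hsia_gaussPt (y : P1 K) : hsia ((gaussPt K : A1 K) : P1 K) y = 1 := by
  rw [gaussPt_eq_discPt]
  induction y using OnePoint.rec with
  | infty =>
    rw [hsia_discPt_infty]
    simp
  | coe y =>
    rw [hsia_discPt_coe, C_0, sub_zero, max_comm, ← coordNorm_coe_eq_max]
    have := coordNorm_pos (y : P1 K)
    simp [this.ne']

/-! ### Potentials -/

theorem integral_omegaCan_of_ultrametric (φ : P1 K → ℝ) :
    ∫ x, φ x ∂(omegaCan K) = φ ((gaussPt K : A1 K) : P1 K) := by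
  have : omegaCan K = Measure.dirac ((gaussPt K : A1 K) : P1 K) := dif_pos hu
  rw [this, integral_dirac]

theorem integral_log_hsia {g : P1 K → ℝ} {μ : Measure (P1 K)}
    (h : HasLaplacian g μ (omegaCan K)) {S : P1 K}
    (hS : S ∉ Set.range (pt : OnePoint K → P1 K)) :
    ∫ x, -Real.log (hsia S x) ∂μ = g ((gaussPt K : A1 K) : P1 K) - g S := by
  have := h.1 hu S hS
  rw [integral_omegaCan_of_ultrametric, integral_omegaCan_of_ultrametric, hsia_comm S,
    hsia_gaussPt, Real.log_one] at this
  rw [integral_neg]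
  linarith

theorem exists_le_val_X_sub_C [CompleteSpace K] {x : A1 K} (hx : ∀ a, x ≠ evalPt a) :
    ∃ δ > 0, ∀ a : K, δ ≤ x.val (X - C a) := by
  by_contra! h
  choose a ha using fun n : ℕ => h (1 / (n + 1)) Nat.one_div_pos_of_nat
  have h0 : Tendsto (fun n => x.val (X - C (a n))) atTop (𝓝 0) :=
    squeeze_zero (fun n => x.val_nonneg _) (fun n => (ha n).le)
      tendsto_one_div_add_atTop_nhds_zero_nat
  have hd : ∀ m n, ‖a m - a n‖ ≤ max (x.val (X - C (a n))) (x.val (X - C (a m))) := by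
    intro m n
    calc ‖a m - a n‖ = x.val ((X - C (a n)) - (X - C (a m))) := by
          rw [← x.val_C, C_sub]; congr 1; ring
      _ ≤ _ := x.val_sub_le_max _ _
  have hc : CauchySeq a := by
    rw [Metric.cauchySeq_iff']
    intro ε hε
    obtain ⟨N, hN⟩ := eventually_atTop.mp (h0.eventually_lt_const hε)
    refine ⟨N, fun n hn => ?_⟩
    rw [dist_eq_norm]
    exact (hd n N).trans_lt (max_lt (hN N le_rfl) (hN n hn))
  obtain ⟨b, hb⟩ := cauchySeq_tendsto_of_complete hc
  refine hx b (A1.eq_evalPt_of_val_eq_zero ?_)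
  have h1 : Tendsto (fun n => x.val (X - C (a n)) + ‖a n - b‖) atTop (𝓝 (0 + 0)) :=
    h0.add (tendsto_iff_norm_sub_tendsto_zero.mp hb)
  rw [add_zero] at h1
  refine le_antisymm (ge_of_tendsto' h1 fun n => ?_) (x.val_nonneg _)
  calc x.val (X - C b) = x.val ((X - C (a n)) + C (a n - b)) := by
        rw [C_sub]; congr 1; ring
    _ ≤ _ := by
      rw [← x.val_C (a n - b)]
      exact x.val_add_le _ _

theorem exists_le_hsia [CompleteSpace K] {x : P1 K}
    (hx : x ∉ Set.range (pt : OnePoint K → P1 K)) : ∃ δ > 0, ∀ y, δ ≤ hsia x y := by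
  induction x using OnePoint.rec with
  | infty => exact absurd ⟨∞, rfl⟩ hx
  | coe x =>
    obtain ⟨δ, hδ, h⟩ := exists_le_val_X_sub_C (x := x) fun a ha => hx ⟨a, by rw [ha]; rfl⟩
    have hM := coordNorm_pos (x : P1 K)
    have hM1 := one_le_coordNorm (x : P1 K)
    set M := coordNorm (x : P1 K) with hMdef
    refine ⟨min δ 1 / (M * M), by positivity, fun y => ?_⟩
    by_contra! hlt
    obtain ⟨w, hw, -⟩ := (hsia_lt_iff (by positivity) _ _).mp hlt
    refine absurd hw (not_lt.mpr ?_)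
    induction w using OnePoint.rec with
    | infty =>
      change _ ≤ 1 / M
      rw [div_le_div_iff₀ (by positivity) hM]
      nlinarith [min_le_right δ 1]
    | coe a =>
      have ha := coordNorm_pos (pt (a : OnePoint K))
      have h1 := coordNorm_pt_le_max x a
      rw [hsia_coe_pt_coe, ← hMdef, div_le_div_iff₀ (by positivity) (by positivity)]
      rw [← hMdef] at h1
      have h2 := h a
      have h3 := min_le_left δ 1
      have h4 := min_le_right δ 1
      have h5 : 0 ≤ min δ 1 := by positivity
      generalize coordNorm (pt (a : OnePoint K)) = Ma at *
      generalize x.val (X - C a) = u at *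
      generalize min δ 1 = m at *
      have h7 : 0 ≤ u := hδ.le.trans h2
      rcases le_max_iff.mp h1 with h6 | h6
      · calc m * (M * Ma) ≤ 1 * (M * Ma) := by gcongr
          _ = Ma * (1 * M) := by ring
          _ ≤ u * (M * M) := by gcongr
      · have h8 := h3.trans h2
        gcongr

theorem lintegral_logKer_of_notMem_range_pt [CompleteSpace K] {g : P1 K → ℝ} {μ : Measure (P1 K)}
    [IsProbabilityMeasure μ] (h : HasLaplacian g μ (omegaCan K)) {S : P1 K}
    (hS : S ∉ Set.range (pt : OnePoint K → P1 K)) :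
    g S ≤ g ((gaussPt K : A1 K) : P1 K) ∧
      ∫⁻ y, logKer S y ∂μ = ENNReal.ofReal (g ((gaussPt K : A1 K) : P1 K) - g S) := by
  obtain ⟨δ, hδ, hle⟩ := exists_le_hsia hS
  have hnn : ∀ y, 0 ≤ -Real.log (hsia S y) := fun y => neg_nonneg.mpr
    (Real.log_nonpos (hsia_nonneg S y) (hsia_le_one_of_ultrametric S y))
  have hint : Integrable (fun y => -Real.log (hsia S y)) μ := by
    refine Integrable.of_bound
      (Real.measurable_log.comp (measurable_hsia_of_ultrametric S)).neg.aestronglyMeasurable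
      (-Real.log δ) (ae_of_all _ fun y => ?_)
    rw [Real.norm_of_nonneg (hnn y)]
    exact neg_le_neg (Real.log_le_log hδ (hle y))
  have hI := integral_log_hsia h hS
  refine ⟨?_, ?_⟩
  · have : 0 ≤ ∫ y, -Real.log (hsia S y) ∂μ := integral_nonneg fun y => hnn y
    linarith
  · rw [← hI, ofReal_integral_eq_lintegral_ofReal hint (ae_of_all _ hnn)]
    exact lintegral_congr fun y => negLog_of_pos (hδ.trans_le (hle y))

theorem lintegral_logKer_of_tendsto [CompleteSpace K] {g : P1 K → ℝ} (hg : Continuous g)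
    {μ : Measure (P1 K)} [IsProbabilityMeasure μ] (h : HasLaplacian g μ (omegaCan K)) {x : P1 K}
    {S : ℕ → P1 K} (hS : ∀ n, S n ∉ Set.range (pt : OnePoint K → P1 K))
    (hx : Tendsto S atTop (𝓝 x)) (hanti : ∀ y, Antitone fun n => hsia (S n) y)
    (hlim : ∀ y, Tendsto (fun n => hsia (S n) y) atTop (𝓝 (hsia x y))) :
    g x ≤ g ((gaussPt K : A1 K) : P1 K) ∧
      ∫⁻ y, logKer x y ∂μ = ENNReal.ofReal (g ((gaussPt K : A1 K) : P1 K) - g x) := by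
  have hgx : Tendsto (fun n => g (S n)) atTop (𝓝 (g x)) := (hg.tendsto x).comp hx
  refine ⟨le_of_tendsto' hgx fun n => (lintegral_logKer_of_notMem_range_pt h (hS n)).1, ?_⟩
  have h1 : Tendsto (fun n => ∫⁻ y, logKer (S n) y ∂μ) atTop (𝓝 (∫⁻ y, logKer x y ∂μ)) := by
    refine lintegral_tendsto_of_tendsto_of_monotone
      (fun n => (measurable_logKer_of_ultrametric (S n)).aemeasurable)
      (ae_of_all _ fun y m n hmn => negLog_antitone (hanti y hmn)) (ae_of_all _ fun y => ?_)
    exact (continuous_negLog.tendsto _).comp (hlim y)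
  have h2 : Tendsto (fun n => ∫⁻ y, logKer (S n) y ∂μ) atTop
      (𝓝 (ENNReal.ofReal (g ((gaussPt K : A1 K) : P1 K) - g x))) := by
    simp only [fun n => (lintegral_logKer_of_notMem_range_pt h (hS n)).2]
    exact (ENNReal.continuous_ofReal.tendsto _).comp (tendsto_const_nhds.sub hgx)
  exact tendsto_nhds_unique h1 h2

theorem tendsto_discPt (a : K) {r : ℕ → ℝ} (hr : ∀ n, 0 < r n) (h1 : ∀ n, r n ≤ 1)
    (hlim : Tendsto r atTop (𝓝 0)) :
    Tendsto (fun n => discPt a (r n) (hr n)) atTop (𝓝 (evalPt a)) := by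
  rw [A1.isEmbedding_val.tendsto_nhds_iff, tendsto_pi_nhds]
  intro P
  obtain ⟨Q, hQ⟩ : ∃ Q, P - C (P.eval a) = (X - C a) * Q :=
    ⟨_, (Polynomial.mul_divByMonic_eq_iff_isRoot.mpr
      (show IsRoot (P - C (P.eval a)) a by simp)).symm⟩
  let B := ∑ i ∈ Finset.range (Q.natDegree + 1), ‖Q.coeff i‖ * max 1 ‖a‖ ^ i
  have hb : Tendsto (fun n => r n * B) atTop (𝓝 0) := by
    simpa using hlim.mul_const B
  refine tendsto_iff_dist_tendsto_zero.mpr (squeeze_zero (fun _ => dist_nonneg) (fun n => ?_) hb)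
  simp only [Function.comp_apply, A1.val_evalPt]
  have h2 := (discPt a (r n) (hr n)).abs_val_sub_val_le P (C (P.eval a))
  rw [hQ, A1.val_mul, val_discPt_X_sub_C, sub_self, norm_zero, max_eq_left (hr n).le,
    A1.val_C] at h2
  rw [Real.dist_eq]
  refine h2.trans (mul_le_mul_of_nonneg_left ?_ (hr n).le)
  refine ((discPt a (r n) (hr n)).val_le_sum (Nat.lt_succ_self _)).trans ?_
  refine Finset.sum_le_sum fun i _ => ?_
  rw [val_discPt_X]
  gcongr
  exact h1 n

theorem exists_hasPotential_of_ultrametric [CompleteSpace K] {g : P1 K → ℝ} (hg : Continuous g)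
    {μ : Measure (P1 K)} [IsProbabilityMeasure μ] (h : HasLaplacian g μ (omegaCan K)) :
    ∃ A, HasPotential g μ A := by
  refine ⟨g ((gaussPt K : A1 K) : P1 K), fun x => ?_⟩
  by_cases hx : x ∈ Set.range (pt : OnePoint K → P1 K)
  · obtain ⟨w, rfl⟩ := hx
    induction w using OnePoint.rec with
    | infty =>
      have hr : ∀ n : ℕ, (0 : ℝ) < n + 1 := fun n => by positivity
      have hr1 : ∀ n : ℕ, (1 : ℝ) ≤ n + 1 := fun n => by simp
      have hS : Tendsto (fun n : ℕ => ((discPt (0 : K) (n + 1) (hr n) : A1 K) : P1 K)) atTop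
          (𝓝 ∞) := by
        refine A1.tendsto_coe_infty_of_val_X ?_
        simp only [val_discPt_X, norm_zero, max_eq_left (hr _).le]
        exact tendsto_atTop_add_const_right _ _ tendsto_natCast_atTop_atTop
      have hlim1 : Tendsto (fun n : ℕ => 1 / ((n : ℝ) + 1)) atTop (𝓝 0) :=
        tendsto_one_div_add_atTop_nhds_zero_nat
      have hval : ∀ (y : A1 K) (n : ℕ),
          hsia ((discPt (0 : K) (n + 1) (hr n) : A1 K) : P1 K) (y : P1 K)
            = max 1 (y.val X * (1 / (n + 1))) / coordNorm (y : P1 K) := by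
        intro y n
        have hy := coordNorm_pos (y : P1 K)
        rw [hsia_discPt_coe, C_0, sub_zero, norm_zero, max_eq_left (hr n).le,
          max_eq_left (hr1 n), ← div_div, ← max_div_div_right (hr n).le, div_self (hr n).ne',
          mul_one_div]
      have hval' : ∀ n : ℕ, hsia ((discPt (0 : K) (n + 1) (hr n) : A1 K) : P1 K) ∞
          = 1 / ((n : ℝ) + 1) := by
        intro n
        rw [hsia_discPt_infty, norm_zero, max_eq_left (hr n).le, max_eq_left (hr1 n)]
      refine lintegral_logKer_of_tendsto hg h
        (fun n => coe_discPt_notMem_range_pt 0 (hr n)) hS ?_ ?_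
      · intro y
        induction y using OnePoint.rec with
        | infty =>
          simp only [hval']
          exact fun m n hmn => Nat.one_div_le_one_div hmn
        | coe y =>
          simp only [hval]
          intro m n hmn
          have := Nat.one_div_le_one_div (α := ℝ) hmn
          have hy := coordNorm_pos (y : P1 K)
          have hy0 := y.val_nonneg X
          dsimp only
          gcongr
      · intro y
        induction y using OnePoint.rec with
        | infty =>
          simp only [hval']
          exact hlim1
        | coe y =>
          simp only [hval]
          have h3 := ((tendsto_const_nhds (x := (1 : ℝ))).max (hlim1.const_mul (y.val X))).div_const
            (coordNorm (y : P1 K))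
          rw [mul_zero, max_eq_left zero_le_one] at h3
          exact h3
    | coe a =>
      have hr : ∀ n : ℕ, (0 : ℝ) < 1 / (n + 1) := fun n => Nat.one_div_pos_of_nat
      have hr1 : ∀ n : ℕ, (1 : ℝ) / (n + 1) ≤ 1 := fun n => by
        rw [div_le_one (by positivity)]
        simp
      have hlim1 : Tendsto (fun n : ℕ => 1 / ((n : ℝ) + 1)) atTop (𝓝 0) :=
        tendsto_one_div_add_atTop_nhds_zero_nat
      have hM : ∀ n : ℕ, max (max (1 / ((n : ℝ) + 1)) ‖a‖) 1 = max ‖a‖ 1 := by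
        intro n
        rw [max_assoc, max_eq_right ((hr1 n).trans (le_max_right _ _))]
      refine lintegral_logKer_of_tendsto hg h
        (fun n => coe_discPt_notMem_range_pt a (hr n))
        ((OnePoint.continuous_coe.tendsto _).comp (tendsto_discPt a hr hr1 hlim1)) ?_ ?_
      · intro y
        induction y using OnePoint.rec with
        | infty =>
          simp only [hsia_discPt_infty, hM]
          exact antitone_const
        | coe y =>
          simp only [hsia_discPt_coe, hM]
          intro m n hmn
          have := Nat.one_div_le_one_div (α := ℝ) hmn
          have hy := coordNorm_pos (y : P1 K)
          dsimp only
          gcongr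
      · intro y
        rw [pt_coe]
        induction y using OnePoint.rec with
        | infty =>
          simp only [hsia_discPt_infty, hM]
          have : hsia ((evalPt a : A1 K) : P1 K) ∞ = 1 / max ‖a‖ 1 := by
            rw [← coordNorm_evalPt]; rfl
          rw [this]
          exact tendsto_const_nhds
        | coe y =>
          simp only [hsia_discPt_coe, hM]
          have : hsia ((evalPt a : A1 K) : P1 K) (y : P1 K)
              = y.val (X - C a) / (max ‖a‖ 1 * coordNorm (y : P1 K)) := by
            rw [hsia_comm, ← pt_coe, hsia_coe_pt_coe, pt_coe, coordNorm_evalPt, mul_comm]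
          rw [this]
          have h3 := (hlim1.max (tendsto_const_nhds (x := y.val (X - C a)))).div_const
            (max ‖a‖ 1 * coordNorm (y : P1 K))
          rw [max_eq_right (y.val_nonneg _)] at h3
          exact h3
  · exact lintegral_logKer_of_notMem_range_pt h hx

end Ultrametric

end Berkovich

end

noncomputable section

namespace Berkovich

section Dynamics

variable {K : Type*} [NontriviallyNormedField K]

/-! ### Composition of forms -/

theorem homComp_zero_right (P : K[X]) (n : ℕ) (A : K[X]) :
    homComp P n A 0 = C (P.coeff n) * A ^ n := by
  rw [homComp, Finset.sum_range_succ, Finset.sum_eq_zero]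
  · simp
  · intro i hi
    have := Finset.mem_range.mp hi
    rw [zero_pow (by omega), mul_zero]

theorem homComp_mul_of_natDegree_le {P Q : K[X]} {m n : ℕ} (hm : P.natDegree ≤ m)
    (hn : Q.natDegree ≤ n) (A B : K[X]) :
    homComp (P * Q) (m + n) A B = homComp P m A B * homComp Q n A B := by
  rcases eq_or_ne B 0 with rfl | hB
  · simp only [homComp_zero_right, coeff_mul_add_eq_of_natDegree_le hm hn, map_mul, pow_add]
    ring
  · exact homComp_mul P Q hm hn A hB

theorem homComp_pow {P : K[X]} {m : ℕ} (hm : P.natDegree ≤ m) (A B : K[X]) (k : ℕ) :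
    homComp (P ^ k) (k * m) A B = homComp P m A B ^ k := by
  induction k with
  | zero => simp [homComp]
  | succ k ih =>
    rw [pow_succ, Nat.succ_mul, homComp_mul_of_natDegree_le
      (natDegree_pow_le.trans (Nat.mul_le_mul_left k hm)) hm, ih, pow_succ]

theorem homComp_C_mul (a : K) (P : K[X]) (n : ℕ) (A B : K[X]) :
    homComp (C a * P) n A B = C a * homComp P n A B := by
  simp only [homComp, coeff_C_mul, map_mul, Finset.mul_sum]
  exact Finset.sum_congr rfl fun i _ => by ring

theorem homComp_sum {ι : Type*} (s : Finset ι) (F : ι → K[X]) (n : ℕ) (A B : K[X]) :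
    homComp (∑ i ∈ s, F i) n A B = ∑ i ∈ s, homComp (F i) n A B := by
  classical
  induction s using Finset.induction_on with
  | empty => simp [homComp]
  | insert i s hi ih => rw [Finset.sum_insert hi, Finset.sum_insert hi, homComp_add, ih]

theorem homComp_homComp (P : K[X]) (m : ℕ) {N D : K[X]} {d : ℕ} (hN : N.natDegree ≤ d)
    (hD : D.natDegree ≤ d) (A B : K[X]) :
    homComp P m (homComp N d A B) (homComp D d A B)
      = homComp (homComp P m N D) (m * d) A B := by
  rw [homComp, show homComp P m N D = ∑ i ∈ Finset.range (m + 1),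
    C (P.coeff i) * N ^ i * D ^ (m - i) from rfl, homComp_sum]
  refine Finset.sum_congr rfl fun i hi => ?_
  have hi' : i ≤ m := Nat.lt_succ_iff.mp (Finset.mem_range.mp hi)
  have e : m * d = i * d + (m - i) * d := by rw [← Nat.add_mul, Nat.add_sub_cancel' hi']
  rw [mul_assoc, mul_assoc, homComp_C_mul, e, homComp_mul_of_natDegree_le
    (natDegree_pow_le.trans (Nat.mul_le_mul_left _ hN))
    (natDegree_pow_le.trans (Nat.mul_le_mul_left _ hD)), homComp_pow hN, homComp_pow hD]

theorem homComp_X_one {P : K[X]} {n : ℕ} (hn : P.natDegree ≤ n) : homComp P n X 1 = P := by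
  conv_rhs => rw [P.as_sum_range_C_mul_X_pow' (Nat.lt_succ_of_le hn)]
  simp [homComp]

theorem homComp_X (A B : K[X]) : homComp X 1 A B = A := by
  simp [homComp, Finset.sum_range_succ]

theorem homComp_one (A B : K[X]) : homComp 1 1 A B = B := by
  simp [homComp, coeff_one]

theorem natDegree_homComp_le (P : K[X]) (m : ℕ) {A B : K[X]} {k : ℕ} (hA : A.natDegree ≤ k)
    (hB : B.natDegree ≤ k) : (homComp P m A B).natDegree ≤ m * k := by
  refine natDegree_sum_le_of_forall_le _ _ fun i hi => ?_
  have hi' : i ≤ m := Nat.lt_succ_iff.mp (Finset.mem_range.mp hi)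
  have e : m * k = i * k + (m - i) * k := by rw [← Nat.add_mul, Nat.add_sub_cancel' hi']
  rw [mul_assoc, e]
  refine (natDegree_C_mul_le _ _).trans (natDegree_mul_le.trans (add_le_add ?_ ?_))
  · exact natDegree_pow_le.trans (Nat.mul_le_mul_left _ hA)
  · exact natDegree_pow_le.trans (Nat.mul_le_mul_left _ hB)

theorem coeff_homComp (P : K[X]) (m : ℕ) {A B : K[X]} {k : ℕ} (hA : A.natDegree ≤ k)
    (hB : B.natDegree ≤ k) : (homComp P m A B).coeff (m * k)
      = ∑ i ∈ Finset.range (m + 1), P.coeff i * A.coeff k ^ i * B.coeff k ^ (m - i) := by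
  rw [homComp, finsetSum_coeff]
  refine Finset.sum_congr rfl fun i hi => ?_
  have hi' : i ≤ m := Nat.lt_succ_iff.mp (Finset.mem_range.mp hi)
  have e : m * k = i * k + (m - i) * k := by rw [← Nat.add_mul, Nat.add_sub_cancel' hi']
  rw [mul_assoc, coeff_C_mul, e, coeff_mul_add_eq_of_natDegree_le
    (natDegree_pow_le.trans (Nat.mul_le_mul_left _ hA))
    (natDegree_pow_le.trans (Nat.mul_le_mul_left _ hB)),
    coeff_pow_of_natDegree_le hA, coeff_pow_of_natDegree_le hB, mul_assoc]

/-! ### The action of a rational function on forms -/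

theorem natDegree_num_le (f : RatFunc K) : f.num.natDegree ≤ deg f := le_max_left _ _

theorem natDegree_denom_le (f : RatFunc K) : f.denom.natDegree ≤ deg f := le_max_right _ _

theorem coeff_deg_ne_zero (f : RatFunc K) :
    f.num.coeff (deg f) ≠ 0 ∨ f.denom.coeff (deg f) ≠ 0 := by
  rcases le_total f.num.natDegree f.denom.natDegree with h | h
  · right
    rw [deg, max_eq_right h]
    exact leadingCoeff_ne_zero.mpr f.denom_ne_zero
  · rcases eq_or_ne f.num 0 with h0 | h0
    · right
      have : deg f = f.denom.natDegree := max_eq_right (by simp [h0])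
      rw [this]
      exact leadingCoeff_ne_zero.mpr f.denom_ne_zero
    · left
      rw [deg, max_eq_left h]
      exact leadingCoeff_ne_zero.mpr h0

theorem A1.val_num_ne_zero {f : RatFunc K} {x : A1 K} (hx : x.val f.denom = 0) :
    x.val f.num ≠ 0 := by
  intro h
  obtain ⟨u, v, huv⟩ := f.isCoprime_num_denom
  have h1 := x.val_add_le (u * f.num) (v * f.denom)
  rw [huv, val_mul, val_mul, hx, h] at h1
  simp at h1
  linarith

theorem val_pushAff {A B : K[X]} {x : A1 K} (hx : x.val B ≠ 0) {P : K[X]} {m : ℕ}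
    (hm : P.natDegree ≤ m) :
    (pushAff A B x hx).val P = x.val (homComp P m A B) / x.val B ^ m := by
  have hB : B ≠ 0 := by
    rintro rfl
    exact hx x.val_zero
  obtain ⟨k, rfl⟩ := Nat.exists_eq_add_of_le hm
  change x.val (homComp P P.natDegree A B) / x.val B ^ P.natDegree = _
  rw [homComp_succ P le_rfl A hB, A1.val_mul, A1.val_pow, pow_add]
  field_simp

theorem exists_formAbs_homComp_eq (f : RatFunc K) (y : P1 K) :
    ∃ s : ℝ, 0 < s ∧ ∀ (P : K[X]) (m : ℕ), P.natDegree ≤ m →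
      formAbs (homComp P m f.num f.denom) (m * deg f) y = s ^ m * formAbs P m (mapBerk f y) := by
  induction y using OnePoint.rec with
  | infty =>
    have hmap : mapBerk f (∞ : P1 K) = pt (mapP1 f ∞) := rfl
    by_cases h : f.denom.coeff (deg f) = 0
    · have h1 : mapP1 f ∞ = (∞ : OnePoint K) := if_pos h
      refine ⟨‖f.num.coeff (deg f)‖, norm_pos_iff.mpr
        ((coeff_deg_ne_zero f).resolve_right (not_not.mpr h)), fun P m hm => ?_⟩
      rw [hmap, h1, pt_infty, formAbs_infty, formAbs_infty,
        coeff_homComp P m (natDegree_num_le f) (natDegree_denom_le f), Finset.sum_range_succ,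
        Finset.sum_eq_zero]
      · simp [mul_comm]
      · intro i hi
        have := Finset.mem_range.mp hi
        rw [h, zero_pow (by omega), mul_zero]
    · have h1 : mapP1 f ∞ = ((f.num.coeff (deg f) / f.denom.coeff (deg f) : K) : OnePoint K) :=
        if_neg h
      refine ⟨‖f.denom.coeff (deg f)‖, norm_pos_iff.mpr h, fun P m hm => ?_⟩
      rw [hmap, h1, pt_coe, formAbs_infty, formAbs_coe, A1.val_evalPt,
        coeff_homComp P m (natDegree_num_le f) (natDegree_denom_le f), ← norm_pow, ← norm_mul,
        eval_eq_sum_range' (Nat.lt_succ_of_le hm), Finset.mul_sum]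
      congr 1
      refine Finset.sum_congr rfl fun i hi => ?_
      have hi' : i ≤ m := Nat.lt_succ_iff.mp (Finset.mem_range.mp hi)
      obtain ⟨k, rfl⟩ := Nat.exists_eq_add_of_le hi'
      rw [Nat.add_sub_cancel_left, pow_add, div_pow]
      field_simp
  | coe x =>
    by_cases h : x.val f.denom = 0
    · have hmap : mapBerk f (x : P1 K) = (∞ : P1 K) := dif_pos h
      refine ⟨x.val f.num, lt_of_le_of_ne (x.val_nonneg _) (A1.val_num_ne_zero h).symm,
        fun P m hm => ?_⟩
      rw [hmap, formAbs_infty, formAbs_coe]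
      have h1 := x.abs_val_sub_val_le (homComp P m f.num f.denom) (C (P.coeff m) * f.num ^ m)
      have h2 : x.val (homComp P m f.num f.denom - C (P.coeff m) * f.num ^ m) ≤ 0 := by
        rw [homComp, Finset.sum_range_succ]
        simp only [Nat.sub_self, pow_zero, mul_one, add_sub_cancel_right]
        refine (x.val_sum_le _ _).trans (le_of_eq (Finset.sum_eq_zero fun i hi => ?_))
        have := Finset.mem_range.mp hi
        rw [A1.val_mul, A1.val_pow, h, zero_pow (by omega), mul_zero]
      have h3 := abs_eq_zero.mp (le_antisymm (h1.trans h2) (abs_nonneg _))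
      rw [A1.val_mul, A1.val_C, A1.val_pow] at h3
      linarith
    · have hmap : mapBerk f (x : P1 K) = ((pushAff f.num f.denom x h : A1 K) : P1 K) := dif_neg h
      refine ⟨x.val f.denom, lt_of_le_of_ne (x.val_nonneg _) (Ne.symm h), fun P m hm => ?_⟩
      rw [hmap, formAbs_coe, formAbs_coe, val_pushAff h hm]
      field_simp

theorem exists_formAbs_lift_eq (f : RatFunc K) (n : ℕ) (x : P1 K) :
    ∃ s : ℝ, 0 < s ∧ ∀ (P : K[X]) (m : ℕ), P.natDegree ≤ m →
      formAbs (homComp P m (lift f n).1 (lift f n).2) (m * deg f ^ n) x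
        = s ^ m * formAbs P m ((mapBerk f)^[n] x) := by
  induction n with
  | zero =>
    refine ⟨1, one_pos, fun P m hm => ?_⟩
    simp [lift, homComp_X_one hm]
  | succ n ih =>
    obtain ⟨s, hs, h⟩ := ih
    obtain ⟨t, ht, h'⟩ := exists_formAbs_homComp_eq f ((mapBerk f)^[n] x)
    refine ⟨s ^ deg f * t, by positivity, fun P m hm => ?_⟩
    rw [lift, homComp_homComp P m (natDegree_num_le f) (natDegree_denom_le f), pow_succ',
      ← mul_assoc, h _ _ (natDegree_homComp_le P m (natDegree_num_le f) (natDegree_denom_le f)),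
      h' P m hm, Function.iterate_succ_apply']
    ring

theorem lift_one (f : RatFunc K) : lift f 1 = (f.num, f.denom) := by
  simp [lift, homComp_X_one (natDegree_num_le f), homComp_X_one (natDegree_denom_le f)]

theorem liftNorm_one (f : RatFunc K) (x : P1 K) :
    liftNorm f 1 x = norm2 K (formAbs f.num (deg f) x) (formAbs f.denom (deg f) x) := by
  rw [liftNorm, lift_one, pow_one]

theorem natDegree_lift_le (f : RatFunc K) (n : ℕ) :
    (lift f n).1.natDegree ≤ deg f ^ n ∧ (lift f n).2.natDegree ≤ deg f ^ n := by
  induction n with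
  | zero => simp [lift]
  | succ n ih =>
    rw [pow_succ']
    exact ⟨natDegree_homComp_le _ _ ih.1 ih.2, natDegree_homComp_le _ _ ih.1 ih.2⟩

theorem exists_liftNorm_eq (f : RatFunc K) (n : ℕ) (x : P1 K) :
    ∃ s : ℝ, 0 < s ∧ liftNorm f n x = s * coordNorm ((mapBerk f)^[n] x) ∧
      liftNorm f (n + 1) x = s ^ deg f * liftNorm f 1 ((mapBerk f)^[n] x) := by
  obtain ⟨s, hs, h⟩ := exists_formAbs_lift_eq f n x
  refine ⟨s, hs, ?_, ?_⟩
  · have h1 := h X 1 natDegree_X_le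
    have h2 := h 1 1 (by simp)
    rw [homComp_X, one_mul, pow_one] at h1
    rw [homComp_one, one_mul, pow_one] at h2
    rw [liftNorm, h1, h2, norm2_mul K hs.le, coordNorm]
  · have h1 := h f.num _ (natDegree_num_le f)
    have h2 := h f.denom _ (natDegree_denom_le f)
    rw [liftNorm, lift, pow_succ', h1, h2, norm2_mul K (pow_nonneg hs.le _), liftNorm_one]

theorem liftNorm_pos (f : RatFunc K) (n : ℕ) (x : P1 K) : 0 < liftNorm f n x := by
  obtain ⟨s, hs, h, -⟩ := exists_liftNorm_eq f n x
  rw [h]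
  exact mul_pos hs (coordNorm_pos _)

theorem T_succ (f : RatFunc K) (n : ℕ) (x : P1 K) :
    T f (n + 1) x = T f 1 ((mapBerk f)^[n] x) + deg f * T f n x := by
  obtain ⟨s, hs, h1, h2⟩ := exists_liftNorm_eq f n x
  rw [T, T, T, h1, h2, Real.log_mul (pow_pos hs _).ne' (liftNorm_pos f 1 _).ne',
    Real.log_mul hs.ne' (coordNorm_pos _).ne', Real.log_pow, pow_succ]
  ring

theorem continuous_T (f : RatFunc K) (n : ℕ) : Continuous (T f n : P1 K → ℝ) := by
  have h : ∀ x : P1 K, T f n x = Real.log (norm2 K (formNorm (lift f n).1 (deg f ^ n) x)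
      (formNorm (lift f n).2 (deg f ^ n) x)) := by
    intro x
    have hc := pow_pos (coordNorm_pos x) (deg f ^ n)
    have e : norm2 K (formNorm (lift f n).1 (deg f ^ n) x) (formNorm (lift f n).2 (deg f ^ n) x)
        = liftNorm f n x / coordNorm x ^ (deg f ^ n) := by
      simp only [formNorm, div_eq_inv_mul]
      rw [norm2_mul K (inv_nonneg.mpr hc.le)]
      rfl
    rw [e, Real.log_div (liftNorm_pos f n x).ne' hc.ne', Real.log_pow, T]
    push_cast
    rfl
  have hpos : ∀ x : P1 K, norm2 K (formNorm (lift f n).1 (deg f ^ n) x)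
      (formNorm (lift f n).2 (deg f ^ n) x) ≠ 0 := by
    intro x
    have hc := pow_pos (coordNorm_pos x) (deg f ^ n)
    simp only [formNorm, div_eq_inv_mul]
    rw [norm2_mul K (inv_nonneg.mpr hc.le)]
    exact mul_ne_zero (inv_ne_zero hc.ne') (liftNorm_pos f n x).ne'
  have hc := ((continuous_norm2 K).comp ((continuous_formNorm (natDegree_lift_le f n).1).prodMk
    (continuous_formNorm (natDegree_lift_le f n).2))).log hpos
  exact hc.congr fun x => (h x).symm

theorem T_zero (f : RatFunc K) (x : P1 K) : T f 0 x = 0 := by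
  simp [T, liftNorm, lift, coordNorm]

theorem T_div_eq_sum {f : RatFunc K} (hd : 1 < deg f) (n : ℕ) (x : P1 K) :
    T f n x / (deg f : ℝ) ^ n
      = ∑ k ∈ Finset.range n, T f 1 ((mapBerk f)^[k] x) / (deg f : ℝ) ^ (k + 1) := by
  have hd0 : (deg f : ℝ) ≠ 0 := by positivity
  induction n with
  | zero => simp [T_zero]
  | succ n ih =>
    rw [Finset.sum_range_succ, ← ih, T_succ, pow_succ]
    field_simp
    ring

theorem exists_summable_bound {f : RatFunc K} (hd : 1 < deg f) : ∃ u : ℕ → ℝ, Summable u ∧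
    ∀ (k : ℕ) (x : P1 K), ‖T f 1 ((mapBerk f)^[k] x) / (deg f : ℝ) ^ (k + 1)‖ ≤ u k := by
  obtain ⟨M, hM⟩ := isCompact_univ.exists_bound_of_continuousOn
    (continuous_T (K := K) f 1).continuousOn
  have hd1 : (1 : ℝ) < deg f := by exact_mod_cast hd
  have hd0 : (0 : ℝ) < deg f := by positivity
  refine ⟨fun k => M * (1 / (deg f : ℝ)) ^ (k + 1), ?_, fun k x => ?_⟩
  · refine Summable.mul_left _ ((summable_nat_add_iff 1).mpr
      (summable_geometric_of_lt_one (by positivity) ?_))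
    rwa [div_lt_one hd0]
  · beta_reduce
    rw [norm_div, norm_pow, Real.norm_of_nonneg hd0.le, div_pow, one_pow, mul_one_div]
    gcongr
    exact hM _ (Set.mem_univ _)

theorem tendsto_T_div {f : RatFunc K} (hd : 1 < deg f) :
    TendstoUniformly (fun (n : ℕ) (x : P1 K) => T f n x / (deg f : ℝ) ^ n)
      (fun x => ∑' k, T f 1 ((mapBerk f)^[k] x) / (deg f : ℝ) ^ (k + 1)) atTop := by
  obtain ⟨u, hu, h⟩ := exists_summable_bound (K := K) hd
  have := tendstoUniformly_tsum_nat hu h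
  simpa only [T_div_eq_sum hd] using this

theorem gLift_eq_tsum {f : RatFunc K} (hd : 1 < deg f) (x : P1 K) :
    gLift f x = ∑' k, T f 1 ((mapBerk f)^[k] x) / (deg f : ℝ) ^ (k + 1) :=
  ((tendsto_T_div hd).tendsto_at x).limUnder_eq

theorem continuous_gLift {f : RatFunc K} (hd : 1 < deg f) : Continuous (gLift f : P1 K → ℝ) := by
  have h := (tendsto_T_div (K := K) hd).continuous
    (Eventually.of_forall fun n => (continuous_T f n).div_const _).frequently
  exact h.congr fun x => (gLift_eq_tsum hd x).symm

theorem gLift_mapBerk {f : RatFunc K} (hd : 1 < deg f) (x : P1 K) :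
    gLift f (mapBerk f x) = deg f * gLift f x - T f 1 x := by
  obtain ⟨u, hu, h⟩ := exists_summable_bound (K := K) hd
  have hd0 : (deg f : ℝ) ≠ 0 := by positivity
  have hs := Summable.of_norm_bounded hu fun k => h k x
  rw [gLift_eq_tsum hd, gLift_eq_tsum hd, hs.tsum_eq_zero_add, mul_add, ← tsum_mul_left]
  have e : ∀ k : ℕ, (deg f : ℝ) * (T f 1 ((mapBerk f)^[k + 1] x) / (deg f : ℝ) ^ (k + 1 + 1))
      = T f 1 ((mapBerk f)^[k] (mapBerk f x)) / (deg f : ℝ) ^ (k + 1) := by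
    intro k
    rw [Function.iterate_succ_apply, pow_succ _ (k + 1)]
    field_simp
  simp only [e, Function.iterate_zero, id, zero_add, pow_one]
  field_simp
  ring

end Dynamics

end Berkovich

end

noncomputable section

namespace Berkovich

section Archimedean

variable {K : Type*} [NontriviallyNormedField K]

/-! ### Archimedean fields -/

theorem norm_natCast_of_norm_two (h2 : ‖(2 : K)‖ = 2) (n : ℕ) : ‖(n : K)‖ = n := by
  have hle : ∀ m : ℕ, ‖(m : K)‖ ≤ m := fun m => by
    simpa using Nat.norm_cast_le (α := K) m
  refine le_antisymm (hle n) ?_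
  have hn : n ≤ 2 ^ n := Nat.lt_two_pow_self.le
  have h : ‖((2 ^ n : ℕ) : K)‖ ≤ ‖(n : K)‖ + ‖((2 ^ n - n : ℕ) : K)‖ := by
    conv_lhs => rw [← Nat.add_sub_cancel' hn, Nat.cast_add]
    exact norm_add_le _ _
  have h' : ‖((2 ^ n - n : ℕ) : K)‖ ≤ 2 ^ n - n :=
    (hle _).trans_eq (by rw [Nat.cast_sub hn]; push_cast; rfl)
  rw [Nat.cast_pow, Nat.cast_ofNat, norm_pow, h2] at h
  linarith

theorem norm_ratCast_of_norm_two [CharZero K] (h2 : ‖(2 : K)‖ = 2) (q : ℚ) :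
    ‖(q : K)‖ = |(q : ℝ)| := by
  have hz : ∀ m : ℤ, ‖(m : K)‖ = |(m : ℝ)| := by
    intro m
    obtain ⟨n, rfl | rfl⟩ := m.eq_nat_or_neg <;> simp [norm_natCast_of_norm_two h2]
  rw [Rat.cast_def, Rat.cast_def, norm_div, abs_div, hz, norm_natCast_of_norm_two h2, Nat.abs_cast]

theorem exists_ringHom_real [CompleteSpace K] [CharZero K] (h2 : ‖(2 : K)‖ = 2) :
    ∃ φ : ℝ →+* K, ∀ r, ‖φ r‖ = |r| := by
  have hi : IsUniformInducing (Rat.castHom ℝ) := Rat.isUniformEmbedding_coe_real.isUniformInducing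
  have hd : DenseRange (Rat.castHom ℝ) := Rat.isDenseEmbedding_coe_real.dense
  have hf : Isometry (Rat.castHom K) := AddMonoidHomClass.isometry_of_norm _ fun q => by
    rw [← Rat.norm_cast_real, Real.norm_eq_abs]
    exact norm_ratCast_of_norm_two h2 q
  let φ := IsDenseInducing.extendRingHom hi hd hf.uniformContinuous
  have hc : Continuous φ :=
    (uniformContinuous_uniformly_extend hi hd hf.uniformContinuous).continuous
  have he : ∀ q : ℚ, φ q = q := fun q =>
    (hi.isDenseInducing hd).extend_eq hf.continuous q
  refine ⟨φ, fun r => ?_⟩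
  refine hd.induction_on (p := fun r => ‖φ r‖ = |r|) r
    (isClosed_eq hc.norm continuous_abs) fun q => ?_
  change ‖φ (q : ℝ)‖ = |(q : ℝ)|
  rw [he, norm_ratCast_of_norm_two h2]

theorem norm_eq_of_multiplicative {σ : ℂ ≃+* K} (h : ∀ r : ℝ, ‖σ r‖ = |r|) : IsStdIso σ := by
  have hI : ‖σ Complex.I‖ = 1 := by
    have h1 : ‖σ Complex.I‖ ^ 4 = 1 := by
      rw [← norm_pow, ← map_pow, Complex.I_pow_four, map_one, norm_one]
    exact (pow_eq_one_iff_of_nonneg (norm_nonneg _) (by norm_num)).mp h1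
  have hle : ∀ z : ℂ, ‖σ z‖ ≤ 2 * ‖z‖ := by
    intro z
    have h1 : ‖σ z‖ ≤ ‖σ (z.re : ℂ)‖ + ‖σ (z.im : ℂ)‖ * ‖σ Complex.I‖ := by
      conv_lhs => rw [← Complex.re_add_im z, map_add, map_mul]
      rw [← norm_mul]
      exact norm_add_le _ _
    rw [h, h, hI] at h1
    have := Complex.abs_re_le_norm z
    have := Complex.abs_im_le_norm z
    linarith
  have hle1 : ∀ z : ℂ, ‖σ z‖ ≤ ‖z‖ := by
    intro z
    rcases eq_or_ne z 0 with rfl | hz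
    · simp
    · have hz0 : 0 < ‖z‖ := norm_pos_iff.mpr hz
      by_contra! hlt
      have h1 : 1 < ‖σ z‖ / ‖z‖ := (one_lt_div hz0).mpr hlt
      obtain ⟨n, hn⟩ := pow_unbounded_of_one_lt 2 h1
      have h2 := hle (z ^ n)
      rw [map_pow, norm_pow, norm_pow] at h2
      rw [div_pow, lt_div_iff₀ (by positivity)] at hn
      linarith
  intro z
  refine le_antisymm (hle1 z) ?_
  rcases eq_or_ne z 0 with rfl | hz
  · simp
  · have h1 := hle1 z⁻¹
    rw [map_inv₀, norm_inv, norm_inv] at h1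
    have hz' : 0 < ‖σ z‖ := norm_pos_iff.mpr (by simpa using hz)
    exact (inv_le_inv₀ hz' (norm_pos_iff.mpr hz)).mp h1

theorem exists_isStdIso [CompleteSpace K] [IsAlgClosed K] [CharZero K] (h2 : ‖(2 : K)‖ = 2) :
    ∃ σ : ℂ ≃+* K, IsStdIso σ := by
  obtain ⟨φ, hφ⟩ := exists_ringHom_real h2
  let _ : Algebra ℝ K := φ.toAlgebra
  let _ : NormedAlgebra ℝ K :=
    { norm_smul_le := fun r x => by
        rw [Algebra.smul_def, norm_mul]
        exact (congrArg (· * ‖x‖) (hφ r)).le }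
  rcases NormedAlgebra.Real.nonempty_algEquiv_or K with he | he
  · obtain ⟨e⟩ := he
    obtain ⟨i, hi⟩ := IsAlgClosed.exists_pow_nat_eq (-1 : K) two_pos
    have h1 : (e i) ^ 2 = -1 := by rw [← map_pow, hi, map_neg, map_one]
    nlinarith [sq_nonneg (e i)]
  · obtain ⟨e⟩ := he
    refine ⟨e.symm.toRingEquiv, norm_eq_of_multiplicative fun r => ?_⟩
    have h1 : e.symm (algebraMap ℝ ℂ r) = algebraMap ℝ K r := e.symm.commutes r
    change ‖e.symm (r : ℂ)‖ = _
    exact (congrArg norm h1).trans (hφ r)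

end Archimedean

section Complex

variable {K : Type*} [NontriviallyNormedField K] {σ : ℂ ≃+* K}

theorem IsStdIso.isometry (hσ : IsStdIso σ) : Isometry σ :=
  AddMonoidHomClass.isometry_of_norm σ hσ

theorem IsStdIso.not_isUltrametricDist (hσ : IsStdIso σ) : ¬ IsUltrametricDist K := by
  intro h
  have h1 : ‖((2 : ℕ) : K)‖ ≤ 1 := IsUltrametricDist.norm_natCast_le_one K 2
  have h2 := hσ 2
  rw [map_ofNat] at h2
  simp at h1 h2
  rw [h2] at h1
  norm_num at h1

theorem A1.pow_le_val_of_monic [IsAlgClosed K] (x : A1 K) {m : ℝ} (hm : 0 ≤ m)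
    (h : ∀ a, m ≤ x.val (X - C a)) {P : K[X]} (hP : P.Monic) : m ^ P.natDegree ≤ x.val P := by
  have key : ∀ s : Multiset K, m ^ Multiset.card s ≤ x.val (s.map fun a => X - C a).prod := by
    intro s
    induction s using Multiset.induction_on with
    | empty => simp
    | cons a s ih =>
      rw [Multiset.card_cons, Multiset.map_cons, Multiset.prod_cons, val_mul, pow_succ']
      exact mul_le_mul (h a) ih (pow_nonneg hm _) (x.val_nonneg _)
  have hs := IsAlgClosed.splits P
  have h1 := key P.roots
  rwa [← hs.eq_prod_roots_of_monic hP, ← hs.natDegree_eq_card_roots] at h1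

/-- Over an archimedean field every point of the Berkovich line is classical. -/
theorem A1.exists_eq_evalPt_of_isStdIso [IsAlgClosed K] (hσ : IsStdIso σ) (x : A1 K) :
    ∃ a, x = evalPt a := by
  let h : ℂ → ℝ := fun z => x.val (X - C (σ z))
  have hlip : ∀ z w, |h z - h w| ≤ ‖z - w‖ := by
    intro z w
    refine (x.abs_val_sub_val_le _ _).trans (le_of_eq ?_)
    rw [sub_sub_sub_cancel_left, ← C_sub, val_C, ← map_sub, hσ, norm_sub_rev]
  have hcont : Continuous h := by
    refine LipschitzWith.continuous (K := 1) (LipschitzWith.of_dist_le_mul fun z w => ?_)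
    rw [Real.dist_eq, dist_eq_norm, NNReal.coe_one, one_mul]
    exact hlip z w
  have hlow : ∀ z, ‖z‖ - x.val X ≤ h z := by
    intro z
    have h1 := x.val_sub_le X (X - C (σ z))
    rw [sub_sub_cancel, val_C, hσ] at h1
    linarith
  have htend : Tendsto h (cocompact ℂ) atTop :=
    tendsto_atTop_mono hlow (tendsto_atTop_add_const_right _ _ tendsto_norm_cocompact_atTop)
  obtain ⟨z₀, hz₀⟩ := hcont.exists_forall_le htend
  rcases (x.val_nonneg (X - C (σ z₀))).eq_or_lt with h0 | h0
  · exact ⟨σ z₀, eq_evalPt_of_val_eq_zero h0.symm⟩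
  exfalso
  set m := h z₀ with hm
  have hm0 : 0 < m := h0
  have hall : ∀ a, m ≤ x.val (X - C a) := fun a => by
    have := hz₀ (σ.symm a)
    simpa [h] using this
  have hstep : ∀ z w, h z = m → ‖w - z‖ < m → h w = m := by
    intro z w hz hw
    refine le_antisymm ?_ (hz₀ w)
    have hbd : ∀ n : ℕ, h w ≤ m * (1 + (‖w - z‖ / m) ^ (n + 1)) := by
      intro n
      let b := σ (w - z)
      let P : K[X] := (X - C (σ z)) ^ (n + 1) - C (b ^ (n + 1))
      have hPm : P.Monic := by
        refine ((monic_X_sub_C _).pow _).sub_of_left ?_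
        rw [degree_pow, degree_X_sub_C]
        refine degree_C_le.trans_lt ?_
        simp only [nsmul_eq_mul, mul_one]
        exact_mod_cast Nat.succ_pos n
      have hPd : P.natDegree = n + 1 := by
        rw [natDegree_sub_C, natDegree_pow, natDegree_X_sub_C, mul_one]
      have hroot : P.IsRoot (σ w) := by
        simp [P, b]
      obtain ⟨Q, hQ⟩ := dvd_iff_isRoot.mpr hroot
      have hQm : Q.Monic := (monic_X_sub_C (σ w)).of_mul_monic_left (hQ ▸ hPm)
      have hQd : Q.natDegree = n := by
        have := congrArg natDegree hQ
        rw [(monic_X_sub_C (σ w)).natDegree_mul hQm, natDegree_X_sub_C, hPd] at this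
        omega
      have h1 : x.val P ≤ m ^ (n + 1) + ‖w - z‖ ^ (n + 1) := by
        refine (x.val_sub_le _ _).trans (le_of_eq ?_)
        rw [val_pow, val_C, norm_pow, hσ, ← hz]
      have h2 := x.pow_le_val_of_monic hm0.le hall hQm
      rw [hQd] at h2
      rw [hQ, val_mul] at h1
      have h3 : h w * m ^ n ≤ m ^ (n + 1) + ‖w - z‖ ^ (n + 1) :=
        (mul_le_mul_of_nonneg_left h2 (x.val_nonneg _)).trans h1
      have h4 : m * (1 + (‖w - z‖ / m) ^ (n + 1)) * m ^ n
          = m ^ (n + 1) + ‖w - z‖ ^ (n + 1) := by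
        rw [div_pow]
        field_simp
        ring
      exact le_of_mul_le_mul_right (h3.trans h4.ge) (pow_pos hm0 n)
    have hlim : Tendsto (fun n : ℕ => m * (1 + (‖w - z‖ / m) ^ (n + 1))) atTop
        (𝓝 (m * (1 + 0))) := by
      refine Tendsto.const_mul _ (Tendsto.const_add _ ?_)
      exact (tendsto_pow_atTop_nhds_zero_of_lt_one (by positivity)
        ((div_lt_one hm0).mpr hw)).comp (tendsto_add_atTop_nat 1)
    rw [add_zero, mul_one] at hlim
    exact ge_of_tendsto' hlim hbd
  have huniv : {z | h z = m} = Set.univ := by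
    refine IsClopen.eq_univ ⟨isClosed_eq hcont continuous_const, ?_⟩ ⟨z₀, rfl⟩
    rw [Metric.isOpen_iff]
    intro z hz
    refine ⟨m, hm0, fun w hw => hstep z w hz ?_⟩
    rwa [← dist_eq_norm]
  have hlast : h ((x.val X + m + 1 : ℝ) : ℂ) = m := by
    have : ((x.val X + m + 1 : ℝ) : ℂ) ∈ {z | h z = m} := by rw [huniv]; trivial
    exact this
  have h5 := hlow ((x.val X + m + 1 : ℝ) : ℂ)
  rw [hlast, Complex.norm_real, Real.norm_of_nonneg (by linarith [x.val_nonneg X])] at h5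
  linarith

theorem exists_eq_pt_of_isStdIso [IsAlgClosed K] (hσ : IsStdIso σ) (x : P1 K) : ∃ w, x = pt w := by
  induction x using OnePoint.rec with
  | infty => exact ⟨∞, rfl⟩
  | coe x =>
    obtain ⟨a, rfl⟩ := A1.exists_eq_evalPt_of_isStdIso hσ x
    exact ⟨a, rfl⟩

end Complex

end Berkovich

end

noncomputable section

namespace Berkovich

/-! ### The logarithm as a sum of powers -/

theorem negLog_eq_tsum {t : ℝ} (h0 : 0 ≤ t) (h1 : t ≤ 1) :
    negLog t = ∑' k : ℕ, ENNReal.ofReal ((2 * ((k : ℝ) + 1))⁻¹ * (1 - t ^ 2) ^ (k + 1)) := by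
  rcases h0.eq_or_lt with rfl | h0
  · rw [negLog_zero, eq_comm]
    by_contra h
    have hs := ENNReal.summable_toReal h
    have h2 : Summable fun k : ℕ => (1 : ℝ) / (k + 1) := by
      refine (hs.mul_left 2).congr fun k => ?_
      have hk : (0 : ℝ) ≤ (2 * ((k : ℝ) + 1))⁻¹ * (1 - 0 ^ 2) ^ (k + 1) := by
        norm_num
        positivity
      rw [ENNReal.toReal_ofReal hk]
      norm_num
      field_simp
    have h3 : Summable fun k : ℕ => (1 : ℝ) / ((k + 1 : ℕ) : ℝ) := by simpa using h2
    exact Real.not_summable_one_div_natCast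
      ((summable_nat_add_iff (f := fun k : ℕ => (1 : ℝ) / k) 1).mp h3)
  · have hv : |1 - t ^ 2| < 1 := by
      rw [abs_lt]
      constructor <;> nlinarith
    have hs := (Real.hasSum_pow_div_log_of_abs_lt_one hv).mul_left (1 / 2)
    have e : (1 / 2 : ℝ) * -Real.log (1 - (1 - t ^ 2)) = -Real.log t := by
      rw [sub_sub_cancel, Real.log_pow]
      push_cast
      ring
    rw [e] at hs
    have e2 : ∀ k : ℕ, (1 / 2 : ℝ) * ((1 - t ^ 2) ^ (k + 1) / (k + 1))
        = (2 * ((k : ℝ) + 1))⁻¹ * (1 - t ^ 2) ^ (k + 1) := fun k => by field_simp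
    simp only [e2] at hs
    rw [negLog_of_pos h0, ← hs.tsum_eq, ENNReal.ofReal_tsum_of_nonneg _ hs.summable]
    intro k
    have : 0 ≤ 1 - t ^ 2 := by nlinarith
    positivity

/-! ### Positive definite kernels of finite rank -/

section FiniteRank

variable {α : Type*} [TopologicalSpace α] [CompactSpace α] [MeasurableSpace α]
  [OpensMeasurableSpace α] {ι : Type*} [Fintype ι]

theorem lintegral_finiteRank {H : ι → α → ℝ} (hH : ∀ i, Continuous (H i)) (c : ι → ℝ)
    (hnn : ∀ y, 0 ≤ ∑ i, c i * H i y) (ν : Measure α) [IsFiniteMeasure ν] :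
    ∫⁻ y, ENNReal.ofReal (∑ i, c i * H i y) ∂ν
      = ENNReal.ofReal (∑ i, c i * ∫ y, H i y ∂ν) := by
  have hi : ∀ i, Integrable (fun y => c i * H i y) ν := fun i =>
    (integrable_of_continuous (hH i) ν).const_mul _
  have hs : Integrable (fun y => ∑ i, c i * H i y) ν := integrable_finsetSum _ fun i _ => hi i
  rw [← ofReal_integral_eq_lintegral_ofReal hs (ae_of_all _ hnn),
    integral_finsetSum _ fun i _ => hi i]
  simp only [integral_const_mul]

end FiniteRank

section Complex

variable {K : Type*} [NontriviallyNormedField K] {σ : ℂ ≃+* K}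

theorem IsStdIso.norm2_eq (hσ : IsStdIso σ) (a b : ℝ) : norm2 K a b = √(a ^ 2 + b ^ 2) :=
  if_neg hσ.not_isUltrametricDist

/-- The point of `𝖯¹` with affine coordinate `z ∈ ℂ`. -/
def cpt (σ : ℂ ≃+* K) (z : ℂ) : P1 K := pt (σ z : OnePoint K)

theorem IsStdIso.continuous_cpt (hσ : IsStdIso σ) : Continuous (cpt σ) :=
  OnePoint.continuous_coe.comp (continuous_evalPt.comp hσ.isometry.continuous)

theorem IsStdIso.cases [IsAlgClosed K] (hσ : IsStdIso σ) (x : P1 K) :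
    x = (∞ : P1 K) ∨ ∃ z, x = cpt σ z := by
  obtain ⟨w, rfl⟩ := exists_eq_pt_of_isStdIso hσ x
  induction w using OnePoint.rec with
  | infty => exact Or.inl rfl
  | coe a => exact Or.inr ⟨σ.symm a, by simp [cpt]⟩

theorem IsStdIso.coordNorm_cpt (hσ : IsStdIso σ) (z : ℂ) :
    coordNorm (cpt σ z) = √(‖z‖ ^ 2 + 1) := by
  rw [cpt, pt_coe, coordNorm_coe, hσ.norm2_eq, A1.val_evalPt, eval_X, hσ, one_pow]

theorem IsStdIso.hsia_cpt_cpt (hσ : IsStdIso σ) (z w : ℂ) :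
    hsia (cpt σ z) (cpt σ w) = ‖z - w‖ / (√(‖z‖ ^ 2 + 1) * √(‖w‖ ^ 2 + 1)) := by
  rw [← hσ.coordNorm_cpt, ← hσ.coordNorm_cpt, cpt, cpt, hsia_pt]
  simp [← map_sub, hσ _]

theorem IsStdIso.hsia_cpt_infty (hσ : IsStdIso σ) (z : ℂ) :
    hsia (cpt σ z) ∞ = 1 / √(‖z‖ ^ 2 + 1) := by
  rw [← hσ.coordNorm_cpt]
  rfl

theorem IsStdIso.hsia_sq_cpt_cpt (hσ : IsStdIso σ) (z w : ℂ) :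
    hsia (cpt σ z) (cpt σ w) ^ 2 = ((z.re - w.re) ^ 2 + (z.im - w.im) ^ 2) /
      ((z.re ^ 2 + z.im ^ 2 + 1) * (w.re ^ 2 + w.im ^ 2 + 1)) := by
  rw [hσ.hsia_cpt_cpt, div_pow, mul_pow, Real.sq_sqrt (by positivity), Real.sq_sqrt (by positivity),
    ← Complex.normSq_eq_norm_sq, ← Complex.normSq_eq_norm_sq, ← Complex.normSq_eq_norm_sq,
    Complex.normSq_apply, Complex.normSq_apply, Complex.normSq_apply, Complex.sub_re,
    Complex.sub_im]
  congr 1 <;> ring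

theorem IsStdIso.hsia_sq_cpt_infty (hσ : IsStdIso σ) (z : ℂ) :
    hsia (cpt σ z) ∞ ^ 2 = 1 / (z.re ^ 2 + z.im ^ 2 + 1) := by
  rw [hσ.hsia_cpt_infty, div_pow, Real.sq_sqrt (by positivity), one_pow,
    ← Complex.normSq_eq_norm_sq, Complex.normSq_apply, ← sq, ← sq]

variable (σ) in
/-- Real coordinates on the sphere `𝖯¹`, in which `1 - [x, y]²` is a scalar product. -/
def sphereCoord (i : Fin 4) (x : P1 K) : ℝ :=
  (√2)⁻¹ * ![1, 1 - 2 * hsia x (cpt σ 1) ^ 2, 1 - 2 * hsia x (cpt σ Complex.I) ^ 2,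
    1 - 2 * hsia x ∞ ^ 2] i

theorem continuous_sphereCoord (i : Fin 4) : Continuous (sphereCoord σ i : P1 K → ℝ) := by
  have h : ∀ w : OnePoint K, Continuous fun x : P1 K => 1 - 2 * hsia x (pt w) ^ 2 := fun w =>
    continuous_const.sub (((continuous_hsia_pt w).pow 2).const_mul 2)
  refine Continuous.const_mul ?_ _
  fin_cases i
  · exact continuous_const
  · exact h _
  · exact h _
  · exact h ∞

theorem IsStdIso.sum_sphereCoord [IsAlgClosed K] (hσ : IsStdIso σ) (x y : P1 K) :
    ∑ i, sphereCoord σ i x * sphereCoord σ i y = 1 - hsia x y ^ 2 := by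
  have h2 : (√2)⁻¹ * (√2)⁻¹ = (1 / 2 : ℝ) := by
    rw [← mul_inv, Real.mul_self_sqrt (by norm_num)]
    norm_num
  have e : ∑ i, sphereCoord σ i x * sphereCoord σ i y = 1 / 2 * (1 * 1
      + (1 - 2 * hsia x (cpt σ 1) ^ 2) * (1 - 2 * hsia y (cpt σ 1) ^ 2)
      + (1 - 2 * hsia x (cpt σ Complex.I) ^ 2) * (1 - 2 * hsia y (cpt σ Complex.I) ^ 2)
      + (1 - 2 * hsia x ∞ ^ 2) * (1 - 2 * hsia y ∞ ^ 2)) := by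
    rw [Fin.sum_univ_four, ← h2]
    simp [sphereCoord]
    ring
  rw [e]
  have hii : hsia (∞ : P1 K) ∞ = 0 := rfl
  rcases hσ.cases x with rfl | ⟨z, rfl⟩ <;> rcases hσ.cases y with rfl | ⟨w, rfl⟩
  · rw [hsia_comm ∞ (cpt σ 1), hsia_comm ∞ (cpt σ Complex.I), hσ.hsia_sq_cpt_infty,
      hσ.hsia_sq_cpt_infty, hii]
    norm_num
  · rw [hsia_comm ∞ (cpt σ 1), hsia_comm ∞ (cpt σ Complex.I), hsia_comm ∞ (cpt σ w), hii]
    simp only [hσ.hsia_sq_cpt_infty, hσ.hsia_sq_cpt_cpt, Complex.one_re, Complex.one_im,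
      Complex.I_re, Complex.I_im]
    have : w.re ^ 2 + w.im ^ 2 + 1 ≠ 0 := by positivity
    norm_num
    field_simp
    ring
  · rw [hsia_comm ∞ (cpt σ 1), hsia_comm ∞ (cpt σ Complex.I), hii]
    simp only [hσ.hsia_sq_cpt_infty, hσ.hsia_sq_cpt_cpt, Complex.one_re, Complex.one_im,
      Complex.I_re, Complex.I_im]
    have : z.re ^ 2 + z.im ^ 2 + 1 ≠ 0 := by positivity
    norm_num
    field_simp
    ring
  · simp only [hσ.hsia_sq_cpt_infty, hσ.hsia_sq_cpt_cpt, Complex.one_re, Complex.one_im,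
      Complex.I_re, Complex.I_im]
    have : z.re ^ 2 + z.im ^ 2 + 1 ≠ 0 := by positivity
    have : w.re ^ 2 + w.im ^ 2 + 1 ≠ 0 := by positivity
    norm_num
    field_simp
    ring

theorem IsStdIso.hsia_le_one [IsAlgClosed K] (hσ : IsStdIso σ) (x y : P1 K) : hsia x y ≤ 1 := by
  have hii : hsia (∞ : P1 K) ∞ = 0 := rfl
  have key : ∀ z : ℂ, hsia (cpt σ z) ∞ ≤ 1 := fun z => by
    rw [← sq_le_one_iff₀ (hsia_nonneg _ _), hσ.hsia_sq_cpt_infty,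
      div_le_one (by positivity)]
    nlinarith [sq_nonneg z.re, sq_nonneg z.im]
  rcases hσ.cases x with rfl | ⟨z, rfl⟩ <;> rcases hσ.cases y with rfl | ⟨w, rfl⟩
  · rw [hii]; exact zero_le_one
  · rw [hsia_comm]; exact key w
  · exact key z
  · rw [← sq_le_one_iff₀ (hsia_nonneg _ _), hσ.hsia_sq_cpt_cpt, div_le_one (by positivity)]
    nlinarith [sq_nonneg (z.re * w.re + z.im * w.im + 1), sq_nonneg (z.re * w.im - z.im * w.re)]

theorem IsStdIso.continuous_hsia [IsAlgClosed K] (hσ : IsStdIso σ) (x : P1 K) :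
    Continuous (hsia x) := by
  obtain ⟨w, rfl⟩ := exists_eq_pt_of_isStdIso hσ x
  exact (continuous_hsia_pt w).congr fun y => hsia_comm _ _

variable (σ) in
/-- The products of the coordinates `sphereCoord`, indexed by the monomials of degree `k`. -/
def sphereMonomial (k : ℕ) (t : Fin k → Fin 4) (x : P1 K) : ℝ := ∏ j, sphereCoord σ (t j) x

theorem continuous_sphereMonomial (k : ℕ) (t : Fin k → Fin 4) :
    Continuous (sphereMonomial σ k t : P1 K → ℝ) :=
  continuous_finsetProd _ fun j _ => continuous_sphereCoord (t j)

theorem IsStdIso.one_sub_hsia_sq_pow [IsAlgClosed K] (hσ : IsStdIso σ) (k : ℕ) (x y : P1 K) :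
    (1 - hsia x y ^ 2) ^ k = ∑ t, sphereMonomial σ k t x * sphereMonomial σ k t y := by
  rw [← hσ.sum_sphereCoord, Fintype.sum_pow]
  simp only [sphereMonomial, Finset.prod_mul_distrib]

theorem IsStdIso.lintegral_logKer [IsAlgClosed K] (hσ : IsStdIso σ) (x : P1 K)
    (ν : Measure (P1 K)) [IsFiniteMeasure ν] :
    ∫⁻ y, logKer x y ∂ν = ∑' k : ℕ, ENNReal.ofReal (∑ t : Fin (k + 1) → Fin 4,
      ((2 * ((k : ℝ) + 1))⁻¹ * sphereMonomial σ (k + 1) t x)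
        * ∫ y, sphereMonomial σ (k + 1) t y ∂ν) := by
  have hnn : ∀ y : P1 K, 0 ≤ 1 - hsia x y ^ 2 := fun y => by
    nlinarith [hσ.hsia_le_one x y, hsia_nonneg x y]
  have e : ∀ (k : ℕ) (y : P1 K), (2 * ((k : ℝ) + 1))⁻¹ * (1 - hsia x y ^ 2) ^ (k + 1)
      = ∑ t : Fin (k + 1) → Fin 4, ((2 * ((k : ℝ) + 1))⁻¹ * sphereMonomial σ (k + 1) t x)
        * sphereMonomial σ (k + 1) t y := fun k y => by
    rw [hσ.one_sub_hsia_sq_pow, Finset.mul_sum]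
    exact Finset.sum_congr rfl fun t _ => by ring
  have hm : ∀ k : ℕ, Measurable fun y : P1 K => ENNReal.ofReal (∑ t : Fin (k + 1) → Fin 4,
      ((2 * ((k : ℝ) + 1))⁻¹ * sphereMonomial σ (k + 1) t x) * sphereMonomial σ (k + 1) t y) :=
    fun k => (Finset.measurable_fun_sum _ fun t _ =>
      (continuous_sphereMonomial _ t).measurable.const_mul _).ennreal_ofReal
  simp only [logKer, fun y => negLog_eq_tsum (hsia_nonneg x y) (hσ.hsia_le_one x y), e]
  rw [lintegral_tsum fun k => (hm k).aemeasurable]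
  refine tsum_congr fun k => ?_
  refine lintegral_finiteRank (fun t => continuous_sphereMonomial _ t) _ (fun y => ?_) ν
  rw [← e]
  exact mul_nonneg (by positivity) (pow_nonneg (hnn y) _)

theorem IsStdIso.lintegral_lintegral_logKer [IsAlgClosed K] (hσ : IsStdIso σ)
    (ν μ : Measure (P1 K)) [IsFiniteMeasure ν] [IsFiniteMeasure μ] :
    ∫⁻ x, ∫⁻ y, logKer x y ∂μ ∂ν = ∑' k : ℕ, ENNReal.ofReal (∑ t : Fin (k + 1) → Fin 4,
      ((2 * ((k : ℝ) + 1))⁻¹ * ∫ y, sphereMonomial σ (k + 1) t y ∂μ)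
        * ∫ y, sphereMonomial σ (k + 1) t y ∂ν) := by
  have e : ∀ (k : ℕ) (x : P1 K), ∑ t : Fin (k + 1) → Fin 4,
      ((2 * ((k : ℝ) + 1))⁻¹ * sphereMonomial σ (k + 1) t x)
        * ∫ y, sphereMonomial σ (k + 1) t y ∂μ = ∑ t : Fin (k + 1) → Fin 4,
      ((2 * ((k : ℝ) + 1))⁻¹ * ∫ y, sphereMonomial σ (k + 1) t y ∂μ)
        * sphereMonomial σ (k + 1) t x := fun k x =>
    Finset.sum_congr rfl fun t _ => by ring
  have hm : ∀ k : ℕ, Measurable fun x : P1 K => ENNReal.ofReal (∑ t : Fin (k + 1) → Fin 4,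
      ((2 * ((k : ℝ) + 1))⁻¹ * ∫ y, sphereMonomial σ (k + 1) t y ∂μ)
        * sphereMonomial σ (k + 1) t x) :=
    fun k => (Finset.measurable_fun_sum _ fun t _ =>
      (continuous_sphereMonomial _ t).measurable.const_mul _).ennreal_ofReal
  simp only [hσ.lintegral_logKer, e]
  rw [lintegral_tsum fun k => (hm k).aemeasurable]
  refine tsum_congr fun k => ?_
  refine lintegral_finiteRank (fun t => continuous_sphereMonomial _ t) _ (fun x => ?_) ν
  rw [← e]
  have h1 : ∑ t : Fin (k + 1) → Fin 4, ((2 * ((k : ℝ) + 1))⁻¹ * sphereMonomial σ (k + 1) t x)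
      * ∫ y, sphereMonomial σ (k + 1) t y ∂μ
      = ∫ y, (2 * ((k : ℝ) + 1))⁻¹ * (1 - hsia x y ^ 2) ^ (k + 1) ∂μ := by
    simp only [hσ.one_sub_hsia_sq_pow, Finset.mul_sum]
    rw [integral_finsetSum]
    · refine Finset.sum_congr rfl fun t _ => ?_
      rw [← integral_const_mul]
      simp only [mul_assoc]
    · intro t _
      exact ((integrable_of_continuous (continuous_sphereMonomial _ t) μ).const_mul _).const_mul _
  rw [h1]
  refine integral_nonneg fun y => mul_nonneg (by positivity) (pow_nonneg ?_ _)
  nlinarith [hσ.hsia_le_one x y, hsia_nonneg x y]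

theorem IsStdIso.kernelProps [IsAlgClosed K] (hσ : IsStdIso σ) : KernelProps K where
  hsia_le_one := hσ.hsia_le_one
  measurable_hsia x := (hσ.continuous_hsia x).measurable
  measurable_potential ν _ := by
    simp only [hσ.lintegral_logKer]
    refine Measurable.tsum fun k => Measurable.ennreal_ofReal ?_
    exact Finset.measurable_fun_sum _ fun t _ =>
      ((continuous_sphereMonomial _ t).measurable.const_mul _).mul_const _
  energy_le ν μ _ _ := by
    rw [hσ.lintegral_lintegral_logKer, hσ.lintegral_lintegral_logKer,
      hσ.lintegral_lintegral_logKer, ← ENNReal.tsum_mul_left, ← ENNReal.tsum_add]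
    refine ENNReal.tsum_le_tsum fun k => ?_
    have hnn : ∀ ρ : Measure (P1 K), 0 ≤ ∑ t : Fin (k + 1) → Fin 4,
        ((2 * ((k : ℝ) + 1))⁻¹ * ∫ y, sphereMonomial σ (k + 1) t y ∂ρ)
          * ∫ y, sphereMonomial σ (k + 1) t y ∂ρ := fun ρ =>
      Finset.sum_nonneg fun t _ => by
        rw [mul_assoc]
        exact mul_nonneg (by positivity) (mul_self_nonneg _)
    rw [← ENNReal.ofReal_add (hnn ν) (hnn μ), ← ENNReal.ofReal_ofNat 2,
      ← ENNReal.ofReal_mul (by norm_num), Finset.mul_sum, ← Finset.sum_add_distrib]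
    refine ENNReal.ofReal_le_ofReal (Finset.sum_le_sum fun t _ => ?_)
    have hc : (0 : ℝ) ≤ (2 * ((k : ℝ) + 1))⁻¹ := by positivity
    generalize (2 * ((k : ℝ) + 1))⁻¹ = c at hc
    generalize ∫ y, sphereMonomial σ (k + 1) t y ∂ν = a
    generalize ∫ y, sphereMonomial σ (k + 1) t y ∂μ = b
    nlinarith [mul_nonneg hc (sq_nonneg (a - b))]

end Complex

end Berkovich

end

noncomputable section

namespace Berkovich

/-! ### The Fubini-Study density -/

/-- The Fubini-Study density on `ℂ`. -/
def fs (z : ℂ) : ℝ := 1 / (Real.pi * (1 + ‖z‖ ^ 2) ^ 2)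

theorem fs_pos (z : ℂ) : 0 < fs z := by
  unfold fs
  positivity

theorem continuous_fs : Continuous fs := by
  unfold fs
  refine continuous_const.div (by fun_prop) fun z => ?_
  positivity

theorem integrable_fs : Integrable fs := by
  have h : Integrable (fun z : ℂ => (fun y : ℝ => 1 / (Real.pi * (1 + y ^ 2) ^ 2)) ‖z‖) := by
    refine (integrable_fun_norm_addHaar (volume : Measure ℂ)
      (f := fun y : ℝ => 1 / (Real.pi * (1 + y ^ 2) ^ 2))).mpr ?_
    rw [Complex.finrank_real_complex]
    refine (integrable_inv_one_add_sq.integrableOn (s := Set.Ioi 0)).mono' ?_ ?_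
    · refine Measurable.aestronglyMeasurable ?_
      fun_prop
    · refine (ae_restrict_mem measurableSet_Ioi).mono fun y (hy : 0 < y) => ?_
      simp only [smul_eq_mul]
      rw [Real.norm_of_nonneg (by positivity), mul_one_div, div_le_iff₀ (by positivity),
        show 2 - 1 = 1 from rfl, pow_one]
      have : (1 + y ^ 2)⁻¹ * (Real.pi * (1 + y ^ 2) ^ 2) = Real.pi * (1 + y ^ 2) := by
        field_simp
      rw [this]
      nlinarith [Real.pi_gt_three, sq_nonneg (y - 1)]
  exact h

theorem integral_fs : ∫ z, fs z = 1 := by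
  have h : ∫ z : ℂ, (fun y : ℝ => 1 / (Real.pi * (1 + y ^ 2) ^ 2)) ‖z‖ = 1 := by
    refine (integral_fun_norm_addHaar (volume : Measure ℂ)
      fun y : ℝ => 1 / (Real.pi * (1 + y ^ 2) ^ 2)).trans ?_
    rw [Complex.finrank_real_complex]
    have hd : ∀ y : ℝ, HasDerivAt (fun y => -(1 / (2 * Real.pi)) * (1 + y ^ 2)⁻¹)
        (y ^ (2 - 1) • (1 / (Real.pi * (1 + y ^ 2) ^ 2))) y := by
      intro y
      have h1 : HasDerivAt (fun y : ℝ => 1 + y ^ 2) (2 * y) y := by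
        simpa using (hasDerivAt_pow 2 y).const_add 1
      have h2 := (h1.inv (by positivity)).const_mul (-(1 / (2 * Real.pi)))
      refine h2.congr_deriv ?_
      have : 1 + y ^ 2 ≠ 0 := by positivity
      simp only [smul_eq_mul]
      field_simp
      exact (pow_one y).symm
    have ht : Tendsto (fun y : ℝ => -(1 / (2 * Real.pi)) * (1 + y ^ 2)⁻¹) atTop (𝓝 0) := by
      have : Tendsto (fun y : ℝ => 1 + y ^ 2) atTop atTop :=
        tendsto_atTop_add_const_left _ _ (tendsto_pow_atTop two_ne_zero)
      simpa using this.inv_tendsto_atTop.const_mul (-(1 / (2 * Real.pi)))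
    rw [integral_Ioi_of_hasDerivAt_of_nonneg' (fun y _ => hd y) ?_ ht]
    · rw [Measure.real, Complex.volume_ball]
      simp
    · intro y (hy : 0 < y)
      simp only [smul_eq_mul]
      positivity
  exact h

/-! ### Invariance under Möbius transformations -/

theorem abs_det_smul_one (c : ℂ) : |(c • (1 : ℂ →L[ℝ] ℂ)).det| = ‖c‖ ^ 2 := by
  have h : (c • (1 : ℂ →L[ℝ] ℂ)).det = Complex.normSq c := by
    rw [← Algebra.norm_complex_apply, Algebra.norm_apply]
    rfl
  rw [h, Complex.normSq_eq_norm_sq, abs_of_nonneg (by positivity)]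

theorem lintegral_fs_comp {M M' : ℂ → ℂ} {s : Set ℂ} (hs : MeasurableSet s)
    (hs0 : volume sᶜ = 0) (hMs : volume (M '' s)ᶜ = 0) (hM : ∀ u ∈ s, HasDerivAt M (M' u) u)
    (hinj : Set.InjOn M s) (hfs : ∀ u ∈ s, ‖M' u‖ ^ 2 * fs (M u) = fs u) (F : ℂ → ℝ≥0∞) :
    ∫⁻ z, ENNReal.ofReal (fs z) * F z = ∫⁻ u, ENNReal.ofReal (fs u) * F (M u) := by
  have h1 : ∀ (t : Set ℂ) (G : ℂ → ℝ≥0∞), volume tᶜ = 0 → ∫⁻ z, G z = ∫⁻ z in t, G z := by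
    intro t G ht
    rw [Measure.restrict_eq_self_of_ae_mem]
    exact mem_ae_iff.mpr ht
  rw [h1 _ _ hMs, h1 _ (fun u => ENNReal.ofReal (fs u) * F (M u)) hs0,
    lintegral_image_eq_lintegral_abs_det_fderiv_mul volume hs
      (fun u hu => (hM u hu).complexToReal_fderiv.hasFDerivWithinAt) hinj]
  refine setLIntegral_congr_fun hs fun u hu => ?_
  rw [abs_det_smul_one, ← mul_assoc, ← ENNReal.ofReal_mul (by positivity), hfs u hu]

theorem norm_sq_add_norm_sq_moebius (a u : ℂ) :
    ‖1 - starRingEnd ℂ a * u‖ ^ 2 + ‖u + a‖ ^ 2 = (1 + ‖a‖ ^ 2) * (1 + ‖u‖ ^ 2) := by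
  simp only [← Complex.normSq_eq_norm_sq, Complex.normSq_apply]
  simp
  ring

theorem one_add_norm_sq_moebius (a u : ℂ) (h : 1 - starRingEnd ℂ a * u ≠ 0) :
    1 + ‖(u + a) / (1 - starRingEnd ℂ a * u)‖ ^ 2
      = (1 + ‖a‖ ^ 2) * (1 + ‖u‖ ^ 2) / ‖1 - starRingEnd ℂ a * u‖ ^ 2 := by
  have h' : ‖1 - starRingEnd ℂ a * u‖ ≠ 0 := norm_ne_zero_iff.mpr h
  rw [← norm_sq_add_norm_sq_moebius, norm_div, div_pow, add_div,
    div_self (pow_ne_zero 2 h')]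

theorem one_add_conj_mul_self (a : ℂ) : 1 + starRingEnd ℂ a * a = ((1 + ‖a‖ ^ 2 : ℝ) : ℂ) := by
  rw [mul_comm, Complex.mul_conj, Complex.normSq_eq_norm_sq]
  push_cast
  rfl

theorem one_add_conj_mul_self_ne_zero (a : ℂ) : 1 + starRingEnd ℂ a * a ≠ 0 := by
  rw [one_add_conj_mul_self, Complex.ofReal_ne_zero]
  positivity

theorem volume_setOf_affine_eq_zero (b : ℂ) : volume {u : ℂ | 1 - b * u ≠ 0}ᶜ = 0 := by
  refine Set.Subsingleton.measure_zero (fun u hu v hv => ?_) _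
  simp only [Set.mem_compl_iff, Set.mem_ofPred_eq, not_not] at hu hv
  have hb : b ≠ 0 := by
    rintro rfl
    simp at hu
  refine mul_left_cancel₀ hb ?_
  linear_combination hv - hu

theorem lintegral_fs_moebius (a : ℂ) (F : ℂ → ℝ≥0∞) :
    ∫⁻ z, ENNReal.ofReal (fs z) * F z
      = ∫⁻ u, ENNReal.ofReal (fs u) * F ((u + a) / (1 - starRingEnd ℂ a * u)) := by
  set b := starRingEnd ℂ a with hb
  have hab : 1 + b * a ≠ 0 := one_add_conj_mul_self_ne_zero a
  have himg : {z : ℂ | 1 - (-b) * z ≠ 0}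
      ⊆ (fun u => (u + a) / (1 - b * u)) '' {u | 1 - b * u ≠ 0} := by
    intro z hz
    simp only [Set.mem_ofPred_eq, neg_mul, sub_neg_eq_add] at hz
    have e : 1 - b * ((z - a) / (1 + b * z)) = (1 + b * a) / (1 + b * z) := by
      field_simp
      ring
    refine ⟨(z - a) / (1 + b * z), ?_, ?_⟩
    · simp only [Set.mem_ofPred_eq]
      rw [e]
      exact div_ne_zero hab hz
    · simp only
      rw [e, div_add' _ _ _ hz, div_div_div_cancel_right₀ hz, div_eq_iff hab]
      ring
  refine lintegral_fs_comp (M := fun u => (u + a) / (1 - b * u))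
    (M' := fun u => (1 + b * a) / (1 - b * u) ^ 2) (s := {u | 1 - b * u ≠ 0}) ?_
    (volume_setOf_affine_eq_zero b)
    (measure_mono_null (Set.compl_subset_compl.mpr himg) (volume_setOf_affine_eq_zero (-b)))
    ?_ ?_ ?_ F
  · have : IsOpen {u : ℂ | 1 - b * u ≠ 0} := isOpen_ne_fun (by fun_prop) continuous_const
    exact this.measurableSet
  · intro u hu
    simp only [Set.mem_ofPred_eq] at hu
    have h1 : HasDerivAt (fun u : ℂ => u + a) 1 u := (hasDerivAt_id u).add_const a
    have h2 : HasDerivAt (fun u : ℂ => 1 - b * u) (-b) u := by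
      simpa using ((hasDerivAt_id u).const_mul b).const_sub 1
    refine (h1.div h2 hu).congr_deriv ?_
    congr 1
    ring
  · intro u hu v hv h
    simp only [Set.mem_ofPred_eq] at hu hv
    simp only at h
    rw [div_eq_div_iff hu hv] at h
    refine mul_left_cancel₀ hab ?_
    linear_combination h
  · intro u hu
    simp only [Set.mem_ofPred_eq] at hu
    have hu' : ‖1 - b * u‖ ≠ 0 := norm_ne_zero_iff.mpr hu
    rw [fs, one_add_norm_sq_moebius a u hu, one_add_conj_mul_self, norm_div, norm_pow,
      Complex.norm_real, Real.norm_of_nonneg (by positivity), fs]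
    rw [← hb]
    have : 1 + ‖a‖ ^ 2 ≠ 0 := by positivity
    field_simp

theorem lintegral_fs_inv (F : ℂ → ℝ≥0∞) :
    ∫⁻ z, ENNReal.ofReal (fs z) * F z = ∫⁻ u, ENNReal.ofReal (fs u) * F u⁻¹ := by
  refine lintegral_fs_comp (M := fun u => u⁻¹) (M' := fun u => -(u ^ 2)⁻¹) (s := {0}ᶜ)
    (measurableSet_singleton 0).compl (by simp) ?_ ?_ inv_injective.injOn ?_ F
  · have h : ({0}ᶜ : Set ℂ) ⊆ (fun u : ℂ => u⁻¹) '' {0}ᶜ := fun z hz =>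
      ⟨z⁻¹, by simpa using hz, inv_inv z⟩
    refine measure_mono_null (Set.compl_subset_compl.mpr h) ?_
    rw [compl_compl]
    exact measure_singleton 0
  · intro u hu
    exact hasDerivAt_inv hu
  · intro u hu
    have hu' : ‖u‖ ≠ 0 := norm_ne_zero_iff.mpr hu
    rw [fs, fs, norm_neg, norm_inv, norm_inv, norm_pow]
    field_simp
    ring

section Complex

variable {K : Type*} [NontriviallyNormedField K] {σ : ℂ ≃+* K}

theorem fubiniStudy_eq (σ : ℂ ≃+* K) : fubiniStudy σ
    = (volume.withDensity fun z => ENNReal.ofReal (fs z)).map (cpt σ) := rfl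

theorem IsStdIso.lintegral_fubiniStudy (hσ : IsStdIso σ) {F : P1 K → ℝ≥0∞} (hF : Measurable F) :
    ∫⁻ x, F x ∂(fubiniStudy σ) = ∫⁻ z, ENNReal.ofReal (fs z) * F (cpt σ z) := by
  have hc := hσ.continuous_cpt.measurable
  rw [fubiniStudy_eq, lintegral_map hF hc]
  exact lintegral_withDensity_eq_lintegral_mul _ continuous_fs.measurable.ennreal_ofReal
    (hF.comp hc)

theorem IsStdIso.integral_fubiniStudy (hσ : IsStdIso σ) {φ : P1 K → ℝ} (hφ : Continuous φ) :
    ∫ x, φ x ∂(fubiniStudy σ) = ∫ z, φ (cpt σ z) * fs z := by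
  rw [fubiniStudy_eq, integral_map hσ.continuous_cpt.measurable.aemeasurable
    hφ.measurable.aestronglyMeasurable, integral_withDensity_eq_integral_toReal_smul
    continuous_fs.measurable.ennreal_ofReal (ae_of_all _ fun _ => ENNReal.ofReal_lt_top)]
  refine integral_congr_ae (ae_of_all _ fun z => ?_)
  simp only
  rw [ENNReal.toReal_ofReal (fs_pos z).le, smul_eq_mul, mul_comm]

theorem IsStdIso.isProbabilityMeasure_fubiniStudy (hσ : IsStdIso σ) :
    IsProbabilityMeasure (fubiniStudy σ) := by
  constructor
  rw [← lintegral_one, hσ.lintegral_fubiniStudy measurable_const]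
  simp only [mul_one]
  rw [← ofReal_integral_eq_lintegral_ofReal integrable_fs (ae_of_all _ fun z => (fs_pos z).le),
    integral_fs, ENNReal.ofReal_one]

/-- The potential of the Fubini-Study measure is constant. -/
theorem IsStdIso.exists_lintegral_logKer_fubiniStudy [IsAlgClosed K] (hσ : IsStdIso σ) :
    ∃ k : ℝ, 0 ≤ k ∧ ∀ x, ∫⁻ y, logKer x y ∂(fubiniStudy σ) = ENNReal.ofReal k := by
  have hK := hσ.kernelProps
  set κ : ℝ≥0∞ := ∫⁻ u, ENNReal.ofReal (fs u) * logKer (cpt σ 0) (cpt σ u) with hκ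
  have hx : ∀ x, ∫⁻ y, logKer x y ∂(fubiniStudy σ) = κ := by
    intro x
    rw [hσ.lintegral_fubiniStudy (hK.measurable_logKer x)]
    rcases hσ.cases x with rfl | ⟨a, rfl⟩
    · rw [lintegral_fs_inv]
      refine lintegral_congr_ae ?_
      have h0 : ∀ᵐ u : ℂ, u ≠ 0 := Measure.ae_ne volume 0
      refine h0.mono fun u hu => ?_
      simp only [logKer]
      have hu' : ‖u‖ ≠ 0 := norm_ne_zero_iff.mpr hu
      rw [hsia_comm, hσ.hsia_cpt_infty, hσ.hsia_cpt_cpt]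
      congr 2
      rw [← sq_eq_sq₀ (by positivity) (by positivity)]
      simp only [div_pow, mul_pow]
      rw [Real.sq_sqrt (by positivity), Real.sq_sqrt (by positivity), Real.sq_sqrt (by positivity)]
      simp only [zero_sub, norm_neg, norm_zero, norm_inv]
      field_simp
      ring
    · rw [lintegral_fs_moebius a]
      refine lintegral_congr_ae ?_
      have h0 : ∀ᵐ u : ℂ, 1 - starRingEnd ℂ a * u ≠ 0 :=
        mem_ae_iff.mpr (volume_setOf_affine_eq_zero _)
      refine h0.mono fun u hu => ?_
      simp only [logKer]
      have hu' : ‖1 - starRingEnd ℂ a * u‖ ≠ 0 := norm_ne_zero_iff.mpr hu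
      rw [hσ.hsia_cpt_cpt, hσ.hsia_cpt_cpt]
      congr 2
      rw [← sq_eq_sq₀ (by positivity) (by positivity)]
      simp only [div_pow, mul_pow]
      rw [Real.sq_sqrt (by positivity), Real.sq_sqrt (by positivity), Real.sq_sqrt (by positivity),
        Real.sq_sqrt (by positivity), add_comm _ (1 : ℝ), add_comm _ (1 : ℝ),
        one_add_norm_sq_moebius a u hu]
      have e : a - (u + a) / (1 - starRingEnd ℂ a * u)
          = -(u * ((1 + ‖a‖ ^ 2 : ℝ) : ℂ) / (1 - starRingEnd ℂ a * u)) := by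
        rw [← one_add_conj_mul_self, sub_div' hu, ← neg_div]
        congr 1
        ring
      rw [e, norm_neg, norm_div, norm_mul, Complex.norm_real, Real.norm_of_nonneg (by positivity)]
      simp only [zero_sub, norm_neg, norm_zero]
      have : 1 + ‖a‖ ^ 2 ≠ 0 := by positivity
      field_simp
      ring
  have hfin : κ ≠ ⊤ := by
    have hint : Integrable (fun z : ℂ => (fun y : ℝ => (y * (1 + y ^ 2))⁻¹) ‖z‖) := by
      refine (integrable_fun_norm_addHaar (volume : Measure ℂ)
        (f := fun y : ℝ => (y * (1 + y ^ 2))⁻¹)).mpr ?_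
      rw [Complex.finrank_real_complex]
      refine (integrable_inv_one_add_sq.integrableOn (s := Set.Ioi 0)).congr_fun
        (fun y (hy : 0 < y) => ?_) measurableSet_Ioi
      simp only [smul_eq_mul]
      norm_num
      field_simp
    refine ne_top_of_le_ne_top hint.lintegral_lt_top.ne (lintegral_mono_ae ?_)
    have h0 : ∀ᵐ u : ℂ, u ≠ 0 := Measure.ae_ne volume 0
    refine h0.mono fun u hu => ?_
    have hu' : 0 < ‖u‖ := norm_pos_iff.mpr hu
    have hh : hsia (cpt σ 0) (cpt σ u) = ‖u‖ / √(‖u‖ ^ 2 + 1) := by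
      rw [hσ.hsia_cpt_cpt]
      simp
    simp only [logKer]
    rw [hh, negLog_of_pos (by positivity), ← ENNReal.ofReal_mul (fs_pos u).le]
    refine ENNReal.ofReal_le_ofReal ?_
    have hlog : -Real.log (‖u‖ / √(‖u‖ ^ 2 + 1)) ≤ ‖u‖⁻¹ := by
      rw [Real.log_div (by positivity) (by positivity), neg_sub]
      have h1 : √(‖u‖ ^ 2 + 1) ≤ ‖u‖ * Real.exp ‖u‖⁻¹ := by
        calc √(‖u‖ ^ 2 + 1) ≤ ‖u‖ + 1 := by
              rw [Real.sqrt_le_left (by positivity)]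
              nlinarith
          _ = ‖u‖ * (‖u‖⁻¹ + 1) := by
              field_simp
              ring
          _ ≤ _ := by
              gcongr
              exact Real.add_one_le_exp _
      have h2 := Real.log_le_log (by positivity) h1
      rw [Real.log_mul (by positivity) (Real.exp_ne_zero _), Real.log_exp] at h2
      linarith
    calc fs u * -Real.log (‖u‖ / √(‖u‖ ^ 2 + 1)) ≤ fs u * ‖u‖⁻¹ :=
          mul_le_mul_of_nonneg_left hlog (fs_pos u).le
      _ ≤ (1 + ‖u‖ ^ 2)⁻¹ * ‖u‖⁻¹ := by
          gcongr
          rw [fs, ← one_div]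
          gcongr
          nlinarith [Real.pi_gt_three, sq_nonneg ‖u‖, sq_nonneg (‖u‖ ^ 2)]
      _ = _ := by
          rw [mul_inv]
          ring
  exact ⟨κ.toReal, ENNReal.toReal_nonneg, fun x => by rw [hx, ENNReal.ofReal_toReal hfin]⟩

end Complex

end Berkovich

end

noncomputable section

namespace Berkovich

/-! ### The Laplacian of a logarithm -/

theorem contDiff_log_norm_sq_add {n : WithTop ℕ∞} (a : ℂ) {t : ℝ} (ht : 0 < t) :
    ContDiff ℝ n fun z : ℂ => Real.log (‖z - a‖ ^ 2 + t) := by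
  refine ContDiff.log ?_ fun z => ?_
  · exact ((contDiff_id.sub contDiff_const).norm_sq ℝ).add contDiff_const
  · positivity

theorem fderiv_log_norm_sq_add (a : ℂ) {t : ℝ} (ht : 0 < t) (z v : ℂ) :
    fderiv ℝ (fun z : ℂ => Real.log (‖z - a‖ ^ 2 + t)) z v
      = (‖z - a‖ ^ 2 + t)⁻¹ * (2 * inner ℝ v (z - a)) := by
  have h1 : HasFDerivAt (fun z : ℂ => ‖z - a‖ ^ 2 + t)
      (2 • (innerSL ℝ) (z - a) ∘SL ContinuousLinearMap.id ℝ ℂ) z :=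
    (((hasFDerivAt_id z).sub_const a).norm_sq).add_const t
  rw [(h1.log (by positivity)).fderiv]
  simp
  left
  ring

theorem fderiv_fderiv_log_norm_sq_add (a : ℂ) {t : ℝ} (ht : 0 < t) (z v : ℂ) :
    fderiv ℝ (fderiv ℝ fun z : ℂ => Real.log (‖z - a‖ ^ 2 + t)) z v v
      = (‖z - a‖ ^ 2 + t)⁻¹ * (2 * ‖v‖ ^ 2)
        - ((‖z - a‖ ^ 2 + t) ^ 2)⁻¹ * (2 * inner ℝ v (z - a)) ^ 2 := by
  have hd : DifferentiableAt ℝ (fderiv ℝ fun z : ℂ => Real.log (‖z - a‖ ^ 2 + t)) z :=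
    ((contDiff_log_norm_sq_add (n := 2) a ht).fderiv_right (m := 1)
      (by norm_num)).differentiable_one z
  have h := fderiv_clm_apply hd (differentiableAt_const v)
  have h2 : fderiv ℝ (fderiv ℝ fun z : ℂ => Real.log (‖z - a‖ ^ 2 + t)) z v v
      = fderiv ℝ (fun y => fderiv ℝ (fun z : ℂ => Real.log (‖z - a‖ ^ 2 + t)) y v) z v := by
    rw [h]
    simp
  rw [h2]
  simp only [fderiv_log_norm_sq_add a ht]
  have h1 : HasFDerivAt (fun z : ℂ => ‖z - a‖ ^ 2 + t)
      (2 • (innerSL ℝ) (z - a) ∘SL ContinuousLinearMap.id ℝ ℂ) z :=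
    (((hasFDerivAt_id z).sub_const a).norm_sq).add_const t
  have h3 : HasFDerivAt (fun z : ℂ => (‖z - a‖ ^ 2 + t)⁻¹) _ z :=
    (hasDerivAt_inv (by positivity : ‖z - a‖ ^ 2 + t ≠ 0)).comp_hasFDerivAt z h1
  have h4 : HasFDerivAt (fun y : ℂ => 2 * inner ℝ v (y - a))
      ((2 : ℝ) • ((innerSL ℝ v) ∘SL ContinuousLinearMap.id ℝ ℂ)) z :=
    (((innerSL ℝ v).hasFDerivAt.comp z ((hasFDerivAt_id z).sub_const a))).const_mul 2
  have h5 : HasFDerivAt (fun y : ℂ => (‖y - a‖ ^ 2 + t)⁻¹ * (2 * inner ℝ v (y - a))) _ z :=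
    h3.mul h4
  rw [h5.fderiv]
  simp
  ring

theorem laplacian_log_norm_sq_add (a : ℂ) {t : ℝ} (ht : 0 < t) (z : ℂ) :
    Laplacian.laplacian (fun z : ℂ => Real.log (‖z - a‖ ^ 2 + t)) z
      = 4 * t / (‖z - a‖ ^ 2 + t) ^ 2 := by
  rw [InnerProductSpace.laplacian_eq_iteratedFDeriv_complexPlane]
  simp only [iteratedFDeriv_two_apply, Matrix.cons_val_zero, Matrix.cons_val_one]
  rw [fderiv_fderiv_log_norm_sq_add a ht, fderiv_fderiv_log_norm_sq_add a ht, Complex.inner,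
    Complex.inner]
  have e : ‖z - a‖ ^ 2 = (z - a).re ^ 2 + (z - a).im ^ 2 := by
    rw [← Complex.normSq_eq_norm_sq, Complex.normSq_apply, sq, sq]
  have hq : 0 < (z - a).re ^ 2 + (z - a).im ^ 2 + t := by positivity
  rw [e]
  generalize z - a = w at *
  simp
  field_simp
  ring

/-! ### Rescaled Fubini-Study densities -/

theorem fs_rescale (a z : ℂ) {t : ℝ} (ht : 0 < t) :
    t / (Real.pi * (‖z - a‖ ^ 2 + t) ^ 2) = t⁻¹ * fs ((√t)⁻¹ • (z - a)) := by
  have hs : (√t)⁻¹ ^ 2 = t⁻¹ := by rw [inv_pow, Real.sq_sqrt ht.le]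
  rw [fs, norm_smul, mul_pow, Real.norm_of_nonneg (by positivity), hs]
  have : 0 < ‖z - a‖ ^ 2 + t := by positivity
  field_simp
  ring

theorem integrable_mul_fs {G : ℂ → ℝ} (hG : Continuous G) {M : ℝ} (hM : ∀ z, ‖G z‖ ≤ M) :
    Integrable fun z => G z * fs z :=
  integrable_fs.bdd_mul hG.aestronglyMeasurable (ae_of_all _ hM)

theorem integrable_mul_rescaled {G : ℂ → ℝ} (hG : Continuous G) {M : ℝ} (hM : ∀ z, ‖G z‖ ≤ M)
    (a : ℂ) {t : ℝ} (ht : 0 < t) :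
    Integrable fun z => G z * (t / (Real.pi * (‖z - a‖ ^ 2 + t) ^ 2)) := by
  simp only [fs_rescale a _ ht]
  have h := ((integrable_fs.comp_smul (inv_ne_zero (Real.sqrt_pos.mpr ht).ne')).comp_sub_right
    a).const_mul t⁻¹
  exact h.bdd_mul hG.aestronglyMeasurable (ae_of_all _ hM)

theorem integral_mul_rescaled (G : ℂ → ℝ) (a : ℂ) {t : ℝ} (ht : 0 < t) :
    ∫ z, G z * (t / (Real.pi * (‖z - a‖ ^ 2 + t) ^ 2)) = ∫ u, G (a + √t • u) * fs u := by
  have hs : √t ≠ 0 := (Real.sqrt_pos.mpr ht).ne'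
  have h1 := Measure.integral_comp_smul (volume : Measure ℂ) (fun u => G (a + √t • u) * fs u) (√t)⁻¹
  rw [Complex.finrank_real_complex, inv_pow, inv_inv, Real.sq_sqrt ht.le, abs_of_pos ht] at h1
  have h2 := integral_sub_right_eq_self (μ := (volume : Measure ℂ))
    (fun z => G (a + √t • (√t)⁻¹ • z) * fs ((√t)⁻¹ • z)) a
  rw [h1] at h2
  simp only [fs_rescale a _ ht]
  have h3 : ∀ z, G z * (t⁻¹ * fs ((√t)⁻¹ • (z - a)))
      = t⁻¹ * (G (a + √t • (√t)⁻¹ • (z - a)) * fs ((√t)⁻¹ • (z - a))) := by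
    intro z
    rw [smul_inv_smul₀ hs, add_sub_cancel]
    ring
  simp only [h3]
  rw [integral_const_mul, h2, smul_eq_mul, inv_mul_cancel_left₀ ht.ne']

section Complex

variable {K : Type*} [NontriviallyNormedField K] {σ : ℂ ≃+* K}

/-! ### Smooth approximations of the logarithmic kernel -/

variable (σ) in
/-- The function `(|z - a|² + t) / (|z|² + 1)` on `𝖯¹`. -/
def bump (a : ℂ) (t : ℝ) (x : P1 K) : ℝ :=
  (‖a‖ ^ 2 + 1) * hsia x (cpt σ a) ^ 2 + t * hsia x ∞ ^ 2

theorem IsStdIso.bump_cpt (hσ : IsStdIso σ) (a : ℂ) (t : ℝ) (z : ℂ) :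
    bump σ a t (cpt σ z) = (‖z - a‖ ^ 2 + t) / (‖z‖ ^ 2 + 1) := by
  rw [bump, hσ.hsia_cpt_cpt, hσ.hsia_cpt_infty, div_pow, div_pow, mul_pow,
    Real.sq_sqrt (by positivity), Real.sq_sqrt (by positivity)]
  have h1 : ‖z‖ ^ 2 + 1 ≠ 0 := by positivity
  have h2 : ‖a‖ ^ 2 + 1 ≠ 0 := by positivity
  field_simp

theorem IsStdIso.bump_infty (hσ : IsStdIso σ) (a : ℂ) (t : ℝ) : bump σ a t ∞ = 1 := by
  have hii : hsia (∞ : P1 K) ∞ = 0 := rfl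
  rw [bump, hsia_comm, hσ.hsia_cpt_infty, hii, div_pow, Real.sq_sqrt (by positivity)]
  have h2 : ‖a‖ ^ 2 + 1 ≠ 0 := by positivity
  field_simp
  ring

theorem IsStdIso.bump_pos [IsAlgClosed K] (hσ : IsStdIso σ) (a : ℂ) {t : ℝ} (ht : 0 < t)
    (x : P1 K) : 0 < bump σ a t x := by
  rcases hσ.cases x with rfl | ⟨z, rfl⟩
  · rw [hσ.bump_infty]
    exact one_pos
  · rw [hσ.bump_cpt]
    positivity

theorem continuous_bump (a : ℂ) (t : ℝ) : Continuous (bump σ a t : P1 K → ℝ) := by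
  have h1 : Continuous fun x : P1 K => hsia x (cpt σ a) := continuous_hsia_pt _
  have h2 : Continuous fun x : P1 K => hsia x (∞ : P1 K) := continuous_hsia_pt (∞ : OnePoint K)
  exact (continuous_const.mul (h1.pow 2)).add (continuous_const.mul (h2.pow 2))

theorem IsStdIso.continuous_log_bump [IsAlgClosed K] (hσ : IsStdIso σ) (a : ℂ) {t : ℝ}
    (ht : 0 < t) : Continuous fun x : P1 K => (1 / 2) * Real.log (bump σ a t x) :=
  continuous_const.mul ((continuous_bump a t).log fun x => (hσ.bump_pos a ht x).ne')

theorem IsStdIso.log_bump_cpt (hσ : IsStdIso σ) (a : ℂ) {t : ℝ} (ht : 0 < t) (z : ℂ) :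
    (1 / 2) * Real.log (bump σ a t (cpt σ z))
      = (1 / 2) * (Real.log (‖z - a‖ ^ 2 + t) - Real.log (‖z - 0‖ ^ 2 + 1)) := by
  rw [hσ.bump_cpt, Real.log_div (by positivity) (by positivity), sub_zero]

theorem IsStdIso.isSmooth_log_bump (hσ : IsStdIso σ) (a : ℂ) {t : ℝ} (ht : 0 < t) :
    IsSmooth σ fun x : P1 K => (1 / 2) * Real.log (bump σ a t x) := by
  constructor
  · have h : ContDiff ℝ (⊤ : ℕ∞) fun z : ℂ =>
        (1 / 2 : ℝ) * (Real.log (‖z - a‖ ^ 2 + t) - Real.log (‖z - 0‖ ^ 2 + 1)) :=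
      contDiff_const.mul ((contDiff_log_norm_sq_add a ht).sub (contDiff_log_norm_sq_add 0 one_pos))
    exact (congrArg (ContDiff ℝ _) (funext fun z => hσ.log_bump_cpt a ht z)).mpr h
  · have hpos : ∀ w : ℂ, 0 < ‖1 - a * w‖ ^ 2 + t * ‖w‖ ^ 2 := by
      intro w
      by_cases hw : w = 0
      · simp [hw]
      · have := norm_pos_iff.mpr hw
        positivity
    have h : ContDiff ℝ (⊤ : ℕ∞) fun w : ℂ => (1 / 2 : ℝ) *
        Real.log ((‖1 - a * w‖ ^ 2 + t * ‖w‖ ^ 2) / (1 + ‖w‖ ^ 2)) := by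
      refine contDiff_const.mul (ContDiff.log (ContDiff.div ?_ ?_ fun w => ?_) fun w => ?_)
      · exact ((contDiff_const.sub (contDiff_const.mul contDiff_id)).norm_sq ℝ).add
          (contDiff_const.mul (contDiff_norm_sq ℝ))
      · exact contDiff_const.add (contDiff_norm_sq ℝ)
      · positivity
      · exact (div_pos (hpos w) (by positivity)).ne'
    refine (congrArg (ContDiff ℝ _) (funext fun w => ?_)).mpr h
    by_cases hw : w = 0
    · subst hw
      simp only [if_true]
      rw [pt_infty, hσ.bump_infty]
      simp
    · simp only [if_neg hw]
      have h1 := hσ.bump_cpt a t w⁻¹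
      rw [cpt] at h1
      rw [h1]
      have hw' : ‖w‖ ≠ 0 := norm_ne_zero_iff.mpr hw
      have e : ‖1 - a * w‖ = ‖w‖ * ‖w⁻¹ - a‖ := by
        rw [← norm_mul]
        congr 1
        field_simp
      rw [e, norm_inv]
      congr 2
      field_simp

theorem IsStdIso.laplacian_log_bump (hσ : IsStdIso σ) (a : ℂ) {t : ℝ} (ht : 0 < t) (z : ℂ) :
    (2 * Real.pi)⁻¹ * Laplacian.laplacian
        (fun z : ℂ => (1 / 2) * Real.log (bump σ a t (pt (σ z : OnePoint K)))) z
      = t / (Real.pi * (‖z - a‖ ^ 2 + t) ^ 2) - fs z := by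
  have e : (fun z : ℂ => (1 / 2) * Real.log (bump σ a t (pt (σ z : OnePoint K))))
      = (1 / 2 : ℝ) • ((fun z : ℂ => Real.log (‖z - a‖ ^ 2 + t))
        - fun z : ℂ => Real.log (‖z - 0‖ ^ 2 + 1)) :=
    funext fun z => hσ.log_bump_cpt a ht z
  have h1 : ContDiff ℝ 2 fun z : ℂ => Real.log (‖z - a‖ ^ 2 + t) := contDiff_log_norm_sq_add a ht
  have h2 : ContDiff ℝ 2 fun z : ℂ => Real.log (‖z - 0‖ ^ 2 + 1) :=
    contDiff_log_norm_sq_add 0 one_pos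
  have h12 : ContDiff ℝ 2 ((fun z : ℂ => Real.log (‖z - a‖ ^ 2 + t))
      - fun z : ℂ => Real.log (‖z - 0‖ ^ 2 + 1)) := h1.sub h2
  rw [e, InnerProductSpace.laplacian_smul _ h12.contDiffAt,
    h1.contDiffAt.laplacian_sub h2.contDiffAt, laplacian_log_norm_sq_add a ht,
    laplacian_log_norm_sq_add 0 one_pos, fs, sub_zero, smul_eq_mul]
  have h3 : 0 < ‖z - a‖ ^ 2 + t := by positivity
  have h4 : 0 < ‖z‖ ^ 2 + 1 := by positivity
  rw [add_comm 1 (‖z‖ ^ 2)]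
  field_simp
  ring

theorem IsStdIso.omegaCan_eq (hσ : IsStdIso σ) :
    ∃ τ : ℂ ≃+* K, IsStdIso τ ∧ omegaCan K = fubiniStudy τ := by
  have h : ∃ σ : ℂ ≃+* K, IsStdIso σ := ⟨σ, hσ⟩
  refine ⟨h.choose, h.choose_spec, ?_⟩
  rw [omegaCan, dif_neg hσ.not_isUltrametricDist, dif_pos h]

theorem IsStdIso.integral_log_bump_sub [IsAlgClosed K] (hσ : IsStdIso σ) {g : P1 K → ℝ}
    (hg : Continuous g) {μ : Measure (P1 K)} (h : HasLaplacian g μ (fubiniStudy σ)) (a : ℂ) {t : ℝ}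
    (ht : 0 < t) :
    ∫ x, (1 / 2) * Real.log (bump σ a t x) ∂μ
        - ∫ x, (1 / 2) * Real.log (bump σ a t x) ∂(fubiniStudy σ)
      = (∫ u, g (cpt σ (a + √t • u)) * fs u) - ∫ x, g x ∂(fubiniStudy σ) := by
  have hK := hσ.not_isUltrametricDist
  obtain ⟨M, hM⟩ := isCompact_univ.exists_bound_of_continuousOn hg.continuousOn
  have hG : Continuous fun z => g (cpt σ z) := hg.comp hσ.continuous_cpt
  have hGM : ∀ z, ‖g (cpt σ z)‖ ≤ M := fun z => hM _ (Set.mem_univ _)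
  have h1 := h.2 hK σ hσ _ (hσ.isSmooth_log_bump a ht)
  have h2 := integral_mul_rescaled (fun z => g (cpt σ z)) a ht
  rw [← h1, ← h2, hσ.integral_fubiniStudy hg,
    ← integral_sub (integrable_mul_rescaled hG hGM a ht) (integrable_mul_fs hG hGM)]
  refine integral_congr_ae (ae_of_all _ fun z => ?_)
  simp only
  rw [hσ.laplacian_log_bump a ht]
  simp only [cpt]
  ring

end Complex

end Berkovich

end

noncomputable section

namespace Berkovich

theorem negLog_mul {q h : ℝ} (hq : 0 < q) (hq1 : q ≤ 1) (h0 : 0 ≤ h) (h1 : h ≤ 1) :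
    negLog (q * h) = ENNReal.ofReal (-Real.log q) + negLog h := by
  rcases h0.eq_or_lt with rfl | h0
  · rw [mul_zero, negLog_zero, add_top]
  · rw [negLog_of_pos (mul_pos hq h0), negLog_of_pos h0, Real.log_mul hq.ne' h0.ne', neg_add,
      ENNReal.ofReal_add (neg_nonneg.mpr (Real.log_nonpos hq.le hq1))
        (neg_nonneg.mpr (Real.log_nonpos h0.le h1))]

section Complex

variable {K : Type*} [NontriviallyNormedField K] {σ : ℂ ≃+* K}

theorem IsStdIso.neg_log_mul_sqrt_bump [IsAlgClosed K] (hσ : IsStdIso σ) (a : ℂ) {t : ℝ}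
    (ht : 0 < t) {s : ℝ} (hs : 0 < s) (y : P1 K) :
    -Real.log (s * √(bump σ a t y)) = -Real.log s - (1 / 2) * Real.log (bump σ a t y) := by
  have h := hσ.bump_pos a ht y
  rw [Real.log_mul hs.ne' (Real.sqrt_pos.mpr h).ne', Real.log_sqrt h.le]
  ring

/-- Monotone convergence for the approximations `s √(bump a t)` of the kernel. -/
theorem IsStdIso.tendsto_ofReal_sub_integral_log_bump [IsAlgClosed K] (hσ : IsStdIso σ) {x : P1 K}
    {a : ℕ → ℂ} {t s : ℕ → ℝ} (ht : ∀ n, 0 < t n) (hs : ∀ n, 0 < s n) {q : ℝ} (hq : 0 < q)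
    (hq1 : q ≤ 1) (hanti : ∀ y : P1 K, Antitone fun n => s n * √(bump σ (a n) (t n) y))
    (hle : ∀ n (y : P1 K), s n * √(bump σ (a n) (t n) y) ≤ 1)
    (hlim : ∀ y : P1 K, Tendsto (fun n => s n * √(bump σ (a n) (t n) y)) atTop
      (𝓝 (q * hsia x y))) (ν : Measure (P1 K)) [IsProbabilityMeasure ν] :
    (∀ n, 0 ≤ -Real.log (s n) - ∫ y, (1 / 2) * Real.log (bump σ (a n) (t n) y) ∂ν) ∧
    Tendsto (fun n => ENNReal.ofReal
      (-Real.log (s n) - ∫ y, (1 / 2) * Real.log (bump σ (a n) (t n) y) ∂ν)) atTop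
      (𝓝 (ENNReal.ofReal (-Real.log q) + ∫⁻ y, logKer x y ∂ν)) := by
  have hK := hσ.kernelProps
  have hc := fun n => hσ.continuous_log_bump (a n) (ht n)
  have hi : ∀ n, Integrable (fun y : P1 K => (1 / 2) * Real.log (bump σ (a n) (t n) y)) ν :=
    fun n => integrable_of_continuous (hc n) ν
  have hi' : ∀ n, Integrable
      (fun y : P1 K => -Real.log (s n) - (1 / 2) * Real.log (bump σ (a n) (t n) y)) ν :=
    fun n => (integrable_const _).sub (hi n)
  have hnn : ∀ n (y : P1 K), 0 ≤ -Real.log (s n) - (1 / 2) * Real.log (bump σ (a n) (t n) y) := by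
    intro n y
    rw [← hσ.neg_log_mul_sqrt_bump (a n) (ht n) (hs n)]
    exact neg_nonneg.mpr (Real.log_nonpos (mul_nonneg (hs n).le (Real.sqrt_nonneg _)) (hle n y))
  have hint : ∀ n, ∫ y : P1 K, -Real.log (s n) - (1 / 2) * Real.log (bump σ (a n) (t n) y) ∂ν
      = -Real.log (s n) - ∫ y, (1 / 2) * Real.log (bump σ (a n) (t n) y) ∂ν := by
    intro n
    rw [integral_sub (integrable_const _) (hi n)]
    simp
  refine ⟨fun n => by rw [← hint]; exact integral_nonneg (hnn n), ?_⟩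
  have e1 : ∀ n, ENNReal.ofReal
      (-Real.log (s n) - ∫ y, (1 / 2) * Real.log (bump σ (a n) (t n) y) ∂ν)
      = ∫⁻ y, negLog (s n * √(bump σ (a n) (t n) y)) ∂ν := by
    intro n
    rw [← hint, ofReal_integral_eq_lintegral_ofReal (hi' n) (ae_of_all _ (hnn n))]
    refine lintegral_congr fun y => ?_
    rw [negLog_of_pos (mul_pos (hs n) (Real.sqrt_pos.mpr (hσ.bump_pos (a n) (ht n) y))),
      hσ.neg_log_mul_sqrt_bump (a n) (ht n) (hs n)]
  have e2 : ENNReal.ofReal (-Real.log q) + ∫⁻ y, logKer x y ∂ν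
      = ∫⁻ y, negLog (q * hsia x y) ∂ν := by
    have : ∀ y, negLog (q * hsia x y) = ENNReal.ofReal (-Real.log q) + logKer x y := fun y =>
      negLog_mul hq hq1 (hsia_nonneg x y) (hK.hsia_le_one x y)
    simp only [this]
    rw [lintegral_add_left measurable_const]
    simp
  simp only [e1, e2]
  refine lintegral_tendsto_of_tendsto_of_monotone (fun n => ?_) (ae_of_all _ fun y => ?_)
    (ae_of_all _ fun y => ?_)
  · exact (measurable_negLog.comp
      (((continuous_bump (a n) (t n)).sqrt.const_mul (s n)).measurable)).aemeasurable
  · exact fun m n hmn => negLog_antitone (hanti y hmn)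
  · exact (continuous_negLog.tendsto _).comp (hlim y)

theorem IsStdIso.potential_eq_of_tendsto [IsAlgClosed K] (hσ : IsStdIso σ) {g : P1 K → ℝ}
    (hg : Continuous g) {μ : Measure (P1 K)} [IsProbabilityMeasure μ]
    (h : HasLaplacian g μ (fubiniStudy σ)) {k : ℝ} (hk0 : 0 ≤ k) {x : P1 K}
    (hk : ∫⁻ y, logKer x y ∂(fubiniStudy σ) = ENNReal.ofReal k)
    {a : ℕ → ℂ} {t s : ℕ → ℝ} (ht : ∀ n, 0 < t n) (hs : ∀ n, 0 < s n) {q : ℝ} (hq : 0 < q)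
    (hq1 : q ≤ 1) (hanti : ∀ y : P1 K, Antitone fun n => s n * √(bump σ (a n) (t n) y))
    (hle : ∀ n (y : P1 K), s n * √(bump σ (a n) (t n) y) ≤ 1)
    (hlim : ∀ y : P1 K, Tendsto (fun n => s n * √(bump σ (a n) (t n) y)) atTop
      (𝓝 (q * hsia x y)))
    (hx : ∀ u : ℂ, u ≠ 0 → Tendsto (fun n => cpt σ (a n + √(t n) • u)) atTop (𝓝 x)) :
    g x ≤ k + ∫ y, g y ∂(fubiniStudy σ) ∧ ∫⁻ y, logKer x y ∂μ
      = ENNReal.ofReal (k + ∫ y, g y ∂(fubiniStudy σ) - g x) := by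
  have hΩ := hσ.isProbabilityMeasure_fubiniStudy
  set G := ∫ y, g y ∂(fubiniStudy σ) with hG
  set Q := -Real.log q with hQ
  have hQ0 : 0 ≤ Q := neg_nonneg.mpr (Real.log_nonpos hq.le hq1)
  obtain ⟨n1, l1⟩ := hσ.tendsto_ofReal_sub_integral_log_bump ht hs hq hq1 hanti hle hlim
    (fubiniStudy σ)
  obtain ⟨n2, l2⟩ := hσ.tendsto_ofReal_sub_integral_log_bump ht hs hq hq1 hanti hle hlim μ
  rw [hk, ← ENNReal.ofReal_add hQ0 hk0] at l1
  have l1' : Tendsto (fun n => -Real.log (s n)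
      - ∫ y, (1 / 2) * Real.log (bump σ (a n) (t n) y) ∂(fubiniStudy σ)) atTop (𝓝 (Q + k)) := by
    have := (ENNReal.tendsto_toReal ENNReal.ofReal_ne_top).comp l1
    rw [ENNReal.toReal_ofReal (add_nonneg hQ0 hk0)] at this
    refine this.congr fun n => ?_
    exact ENNReal.toReal_ofReal (n1 n)
  have l3 : Tendsto (fun n => ∫ u, g (cpt σ (a n + √(t n) • u)) * fs u) atTop (𝓝 (g x)) := by
    obtain ⟨M, hM⟩ := isCompact_univ.exists_bound_of_continuousOn hg.continuousOn
    have e : ∫ u, g x * fs u = g x := by rw [integral_const_mul, integral_fs, mul_one]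
    rw [← e]
    refine tendsto_integral_of_dominated_convergence (fun u => M * fs u) (fun n => ?_)
      (integrable_fs.const_mul M) (fun n => ae_of_all _ fun u => ?_) ?_
    · refine Continuous.aestronglyMeasurable (Continuous.mul ?_ continuous_fs)
      exact hg.comp (hσ.continuous_cpt.comp (by fun_prop))
    · rw [norm_mul, Real.norm_of_nonneg (fs_pos u).le]
      exact mul_le_mul_of_nonneg_right (hM _ (Set.mem_univ _)) (fs_pos u).le
    · have h0 : ∀ᵐ u : ℂ, u ≠ 0 := Measure.ae_ne volume 0
      exact h0.mono fun u hu => (((hg.tendsto x).comp (hx u hu)).mul_const _)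
  have l4 : Tendsto (fun n => -Real.log (s n)
      - ∫ y, (1 / 2) * Real.log (bump σ (a n) (t n) y) ∂μ) atTop (𝓝 (Q + k - (g x - G))) := by
    refine (l1'.sub (l3.sub_const G)).congr fun n => ?_
    rw [hG, ← hσ.integral_log_bump_sub hg h (a n) (ht n)]
    ring
  have hnn : 0 ≤ Q + k - (g x - G) := ge_of_tendsto' l4 n2
  have l5 := tendsto_nhds_unique l2 ((ENNReal.continuous_ofReal.tendsto _).comp l4)
  have hfin : ∫⁻ y, logKer x y ∂μ ≠ ⊤ := fun htop => by
    rw [htop, add_top] at l5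
    exact ENNReal.ofReal_ne_top l5.symm
  have hL := ENNReal.ofReal_toReal hfin
  have hL0 : 0 ≤ (∫⁻ y, logKer x y ∂μ).toReal := ENNReal.toReal_nonneg
  rw [← hL] at l5 ⊢
  rw [← ENNReal.ofReal_add hQ0 hL0, ENNReal.ofReal_eq_ofReal_iff (add_nonneg hQ0 hL0) hnn] at l5
  refine ⟨by linarith, ?_⟩
  congr 1
  linarith

theorem IsStdIso.bump_le [IsAlgClosed K] (hσ : IsStdIso σ) (a : ℂ) {t : ℝ} (ht : 0 < t)
    (x : P1 K) : bump σ a t x ≤ ‖a‖ ^ 2 + 1 + t := by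
  have h1 : hsia x (cpt σ a) ^ 2 ≤ 1 := pow_le_one₀ (hsia_nonneg _ _) (hσ.hsia_le_one _ _)
  have h2 : hsia x ∞ ^ 2 ≤ 1 := pow_le_one₀ (hsia_nonneg _ _) (hσ.hsia_le_one _ _)
  rw [bump]
  nlinarith [sq_nonneg ‖a‖]

/-- Over the complex numbers, the potential of a measure with `μ = Δ g + Ω_can` is `A - g`. -/
theorem exists_hasPotential_of_isStdIso [IsAlgClosed K] (hσ₀ : IsStdIso σ) {g : P1 K → ℝ}
    (hg : Continuous g) {μ : Measure (P1 K)} [IsProbabilityMeasure μ]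
    (h : HasLaplacian g μ (omegaCan K)) : ∃ A, HasPotential g μ A := by
  obtain ⟨τ, hτ, hΩ⟩ := hσ₀.omegaCan_eq
  rw [hΩ] at h
  obtain ⟨k, hk0, hk⟩ := hτ.exists_lintegral_logKer_fubiniStudy
  refine ⟨k + ∫ y, g y ∂(fubiniStudy τ), fun x => ?_⟩
  have hn : ∀ n : ℕ, (0 : ℝ) < n + 1 := fun n => by positivity
  rcases hτ.cases x with rfl | ⟨a, rfl⟩
  · have e : ∀ (n : ℕ) (y : P1 K), (√(2 * (n + 1)))⁻¹ * √(bump τ 0 ((n : ℝ) + 1) y)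
        = √(hsia y (cpt τ 0) ^ 2 * (1 / 2 * (1 / ((n : ℝ) + 1))) + hsia y ∞ ^ 2 / 2) := by
      intro n y
      have := hn n
      rw [← Real.sqrt_inv, ← Real.sqrt_mul (by positivity), bump]
      congr 1
      simp only [norm_zero]
      field_simp
      ring
    refine hτ.potential_eq_of_tendsto hg h hk0 (hk _) (a := fun _ => 0)
      (t := fun n : ℕ => (n : ℝ) + 1) (s := fun n : ℕ => (√(2 * ((n : ℝ) + 1)))⁻¹) (q := (√2)⁻¹) hn
      (fun n => ?_) (by positivity) ?_ ?_ ?_ ?_ ?_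
    · have := hn n
      positivity
    · exact inv_le_one_of_one_le₀ (Real.one_le_sqrt.mpr (by norm_num))
    · intro y m n hmn
      simp only [e]
      refine Real.sqrt_le_sqrt ?_
      gcongr
    · intro n y
      rw [inv_mul_le_iff₀ (by have := hn n; positivity), mul_one]
      refine Real.sqrt_le_sqrt ((hτ.bump_le 0 (hn n) y).trans ?_)
      rw [norm_zero]
      have : (0 : ℝ) ≤ n := n.cast_nonneg
      linarith
    · intro y
      simp only [e]
      have hl : Tendsto (fun n : ℕ => √(hsia y (cpt τ 0) ^ 2 * (1 / 2 * (1 / ((n : ℝ) + 1)))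
          + hsia y ∞ ^ 2 / 2)) atTop
          (𝓝 √(hsia y (cpt τ 0) ^ 2 * (1 / 2 * 0) + hsia y ∞ ^ 2 / 2)) :=
        (Real.continuous_sqrt.tendsto _).comp
          (((tendsto_one_div_add_atTop_nhds_zero_nat.const_mul _).const_mul _).add_const _)
      convert hl using 2
      rw [mul_zero, mul_zero, zero_add, Real.sqrt_div (sq_nonneg _), Real.sqrt_sq (hsia_nonneg _ _),
        hsia_comm]
      ring
    · intro u hu
      refine A1.tendsto_coe_infty_of_val_X ?_
      simp only [A1.val_evalPt, eval_X, hτ _, zero_add, norm_smul]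
      have hu' : 0 < ‖u‖ := norm_pos_iff.mpr hu
      refine Tendsto.atTop_mul_const hu' ?_
      refine tendsto_norm_atTop_atTop.comp (Real.tendsto_sqrt_atTop.comp ?_)
      exact tendsto_atTop_add_const_right _ _ tendsto_natCast_atTop_atTop
  · set N := ‖a‖ ^ 2 + 2 with hN
    have hNpos : 0 < N := by positivity
    refine hτ.potential_eq_of_tendsto hg h hk0 (hk _) (a := fun _ => a)
      (t := fun n : ℕ => 1 / ((n : ℝ) + 1)) (s := fun _ => (√N)⁻¹)
      (q := (√N)⁻¹ * √(‖a‖ ^ 2 + 1)) (fun n => by have := hn n; positivity)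
      (fun n => by positivity) (by positivity) ?_ ?_ ?_ ?_ ?_
    · rw [inv_mul_le_iff₀ (by positivity), mul_one]
      exact Real.sqrt_le_sqrt (by linarith)
    · intro y m n hmn
      simp only [bump]
      gcongr
    · intro n y
      rw [inv_mul_le_iff₀ (by positivity), mul_one]
      have h1 : 1 / ((n : ℝ) + 1) ≤ 1 := by
        rw [div_le_one (hn n)]
        linarith [(n.cast_nonneg : (0 : ℝ) ≤ n)]
      refine Real.sqrt_le_sqrt ((hτ.bump_le a (by have := hn n; positivity) y).trans ?_)
      linarith
    · intro y
      simp only [bump]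
      have hl : Tendsto (fun n : ℕ => (√N)⁻¹ * √((‖a‖ ^ 2 + 1) * hsia y (cpt τ a) ^ 2
          + 1 / ((n : ℝ) + 1) * hsia y ∞ ^ 2)) atTop
          (𝓝 ((√N)⁻¹ * √((‖a‖ ^ 2 + 1) * hsia y (cpt τ a) ^ 2 + 0 * hsia y ∞ ^ 2))) :=
        ((Real.continuous_sqrt.tendsto _).comp
          ((tendsto_one_div_add_atTop_nhds_zero_nat.mul_const _).const_add _)).const_mul _
      convert hl using 2
      rw [zero_mul, add_zero, Real.sqrt_mul (by positivity), Real.sqrt_sq (hsia_nonneg _ _),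
        hsia_comm]
      ring
    · intro u _
      have hl : Tendsto (fun n : ℕ => a + √(1 / ((n : ℝ) + 1)) • u) atTop (𝓝 (a + √0 • u)) :=
        (((Real.continuous_sqrt.tendsto _).comp
          tendsto_one_div_add_atTop_nhds_zero_nat).smul_const _).const_add _
      rw [Real.sqrt_zero, zero_smul, add_zero] at hl
      exact (hτ.continuous_cpt.tendsto a).comp hl

end Complex

/-- The potential of a measure with `μ = Δ g + Ω_can` is `A - g` for a constant `A`. -/
theorem exists_hasPotential {K : Type*} [NontriviallyNormedField K] [CompleteSpace K]
    [IsAlgClosed K] [CharZero K] (hK : IsUltrametricDist K ∨ ‖(2 : K)‖ = 2) {g : P1 K → ℝ}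
    (hg : Continuous g) {μ : Measure (P1 K)} [IsProbabilityMeasure μ]
    (h : HasLaplacian g μ (omegaCan K)) : ∃ A, HasPotential g μ A := by
  rcases hK with hK | hK
  · exact exists_hasPotential_of_ultrametric hg h
  · obtain ⟨σ, hσ⟩ := exists_isStdIso hK
    exact exists_hasPotential_of_isStdIso hσ hg h

theorem kernelProps {K : Type*} [NontriviallyNormedField K] [CompleteSpace K]
    [IsAlgClosed K] [CharZero K] (hK : IsUltrametricDist K ∨ ‖(2 : K)‖ = 2) : KernelProps K := by
  rcases hK with hK | hK
  · exact kernelProps_of_ultrametric K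
  · obtain ⟨σ, hσ⟩ := exists_isStdIso hK
    exact hσ.kernelProps

end Berkovich

end

noncomputable section

namespace Berkovich

/-! ### The divisor of fixed points -/

section FixedPoints

variable {K : Type*} [NontriviallyNormedField K]

theorem natDegree_fixPoly_le (f : RatFunc K) : (fixPoly f).natDegree ≤ deg f + 1 := by
  refine (natDegree_sub_le _ _).trans (max_le ((natDegree_num_le f).trans (Nat.le_succ _)) ?_)
  refine natDegree_mul_le.trans ?_
  rw [natDegree_X, add_comm]
  exact Nat.add_le_add_right (natDegree_denom_le f) 1

theorem fixPoly_ne_zero {f : RatFunc K} (hd : 1 < deg f) : fixPoly f ≠ 0 := by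
  intro h
  have h1 : f.num = X * f.denom := sub_eq_zero.mp h
  have hu : IsUnit f.denom :=
    f.isCoprime_num_denom.isUnit_of_dvd' (h1 ▸ dvd_mul_left _ _) dvd_rfl
  have h2 : f.denom.natDegree = 0 := natDegree_eq_zero_of_isUnit hu
  have h3 : f.num.natDegree = 1 := by
    rw [h1, natDegree_mul X_ne_zero f.denom_ne_zero, natDegree_X, h2]
  rw [deg, h2, h3] at hd
  exact absurd hd (by norm_num)

/-- The fixed points of `f` in `ℙ¹`, with multiplicities. -/
def fixDivisor (f : RatFunc K) : Multiset (OnePoint K) :=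
  (fixPoly f).roots.map (fun a : K => (a : OnePoint K))
    + Multiset.replicate (deg f + 1 - (fixPoly f).natDegree) (∞ : OnePoint K)

theorem card_fixDivisor [IsAlgClosed K] (f : RatFunc K) :
    Multiset.card (fixDivisor f) = deg f + 1 := by
  have h := splits_iff_card_roots.mp (IsAlgClosed.splits (fixPoly f))
  rw [fixDivisor, Multiset.card_add, Multiset.card_map, Multiset.card_replicate, h,
    Nat.add_sub_cancel' (natDegree_fixPoly_le f)]

theorem rootMultiplicity_zero_reflect {p : K[X]} (hp : p ≠ 0) {N : ℕ} (hN : p.natDegree ≤ N) :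
    rootMultiplicity 0 (reflect N p) = N - p.natDegree := by
  obtain ⟨k, rfl⟩ := Nat.exists_eq_add_of_le hN
  have h := reflect_mul p 1 le_rfl (natDegree_one.trans_le (Nat.zero_le k))
  rw [mul_one, reflect_one] at h
  have hr : reflect p.natDegree p ≠ 0 := fun h0 => hp (reflect_eq_zero_iff.mp h0)
  have ht : (reflect p.natDegree p).natTrailingDegree = 0 := natTrailingDegree_reverse p
  rw [rootMultiplicity_eq_natTrailingDegree', h,
    natTrailingDegree_mul hr (pow_ne_zero k X_ne_zero), natTrailingDegree_X_pow, ht]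
  omega

open Classical in
theorem count_fixDivisor {f : RatFunc K} (hd : 1 < deg f) (w : OnePoint K) :
    (fixDivisor f).count w = fixMult f w := by
  rw [fixDivisor, Multiset.count_add]
  induction w using OnePoint.rec with
  | infty =>
    rw [Multiset.count_eq_zero_of_notMem, Multiset.count_replicate_self, zero_add]
    · exact (rootMultiplicity_zero_reflect (fixPoly_ne_zero hd) (natDegree_fixPoly_le f)).symm
    · simp
  | coe a =>
    rw [Multiset.count_map_eq_count' _ _ (OnePoint.coe_injective), count_roots,
      Multiset.count_eq_zero_of_notMem, add_zero]
    · rfl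
    · exact fun h => OnePoint.coe_ne_infty a (Multiset.eq_of_mem_replicate h)

open Classical in
theorem fixMeasure_eq_sum {f : RatFunc K} (hd : 1 < deg f) : fixMeasure f
    = ∑ w ∈ (fixDivisor f).toFinset, ((fixDivisor f).count w : ℝ≥0∞) • Measure.dirac (pt w) := by
  ext s hs
  rw [fixMeasure, Measure.sum_apply _ hs, Measure.finsetSum_apply, tsum_eq_sum]
  · exact Finset.sum_congr rfl fun w _ => by rw [count_fixDivisor hd]
  · intro w hw
    rw [Multiset.mem_toFinset, ← Multiset.count_eq_zero, count_fixDivisor hd] at hw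
    simp [hw]

theorem lintegral_fixMeasure_restrict {f : RatFunc K} (hd : 1 < deg f) (S : Set (P1 K))
    [DecidablePred fun w : OnePoint K => pt w ∈ S] (F : P1 K → ℝ≥0∞) :
    ∫⁻ y, F y ∂((fixMeasure f).restrict S)
      = (((fixDivisor f).filter fun w => pt w ∈ S).map fun w => F (pt w)).sum := by
  classical
  have h1 : (fixMeasure f).restrict S = ∑ w ∈ (fixDivisor f).toFinset,
      ((fixDivisor f).count w : ℝ≥0∞) • (Measure.dirac (pt w)).restrict S := by
    rw [fixMeasure_eq_sum hd, ← Measure.restrictₗ_apply, map_sum]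
    simp only [map_smul, Measure.restrictₗ_apply]
  rw [h1, lintegral_finsetSum_measure]
  have h2 : (((fixDivisor f).filter fun w => pt w ∈ S).map fun w => F (pt w)).sum
      = ((fixDivisor f).map fun w => if pt w ∈ S then F (pt w) else 0).sum := by
    generalize fixDivisor f = V
    induction V using Multiset.induction_on with
    | empty => simp
    | cons w V ih =>
      by_cases hw : pt w ∈ S
      · rw [Multiset.filter_cons_of_pos (p := fun w => pt w ∈ S) V hw, Multiset.map_cons,
          Multiset.map_cons, Multiset.sum_cons, Multiset.sum_cons, ih, if_pos hw]
      · rw [Multiset.filter_cons_of_neg (p := fun w => pt w ∈ S) V hw, Multiset.map_cons,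
          Multiset.sum_cons, ih, if_neg hw, zero_add]
  rw [h2, Finset.sum_multiset_map_count]
  refine Finset.sum_congr rfl fun w _ => ?_
  rw [lintegral_smul_measure, setLIntegral_dirac, nsmul_eq_mul, smul_eq_mul]

theorem multiset_sum_ofReal_sub {ι : Type*} (V : Multiset ι) (r : ι → ℝ) :
    ((V.map fun w => ENNReal.ofReal (r w)).sum : EReal)
      - ((V.map fun w => ENNReal.ofReal (-r w)).sum : ℝ≥0∞) = ((V.map r).sum : ℝ) := by
  have h : ∃ a b : ℝ, 0 ≤ a ∧ 0 ≤ b ∧ (V.map fun w => ENNReal.ofReal (r w)).sum = ENNReal.ofReal a ∧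
      (V.map fun w => ENNReal.ofReal (-r w)).sum = ENNReal.ofReal b ∧ a - b = (V.map r).sum := by
    induction V using Multiset.induction_on with
    | empty => exact ⟨0, 0, le_rfl, le_rfl, by simp⟩
    | cons w V ih =>
      obtain ⟨a, b, ha, hb, h1, h2, h3⟩ := ih
      refine ⟨max (r w) 0 + a, max (-r w) 0 + b, by positivity, by positivity, ?_, ?_, ?_⟩
      · rw [Multiset.map_cons, Multiset.sum_cons, h1, ENNReal.ofReal_add (by positivity) ha,
          ENNReal.ofReal_max, ENNReal.ofReal_zero, max_eq_left zero_le]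
      · rw [Multiset.map_cons, Multiset.sum_cons, h2, ENNReal.ofReal_add (by positivity) hb,
          ENNReal.ofReal_max, ENNReal.ofReal_zero, max_eq_left zero_le]
      · rw [Multiset.map_cons, Multiset.sum_cons, ← h3]
        rcases le_total (r w) 0 with h | h
        · rw [max_eq_right h, max_eq_left (by linarith)]
          ring
        · rw [max_eq_left h, max_eq_right (by linarith)]
          ring
  obtain ⟨a, b, ha, hb, h1, h2, h3⟩ := h
  rw [h1, h2, ← h3, EReal.coe_ennreal_ofReal, EReal.coe_ennreal_ofReal, max_eq_left ha,
    max_eq_left hb, EReal.coe_sub]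

theorem eintegral_fixMeasure_restrict {f : RatFunc K} (hd : 1 < deg f) (S : Set (P1 K))
    [DecidablePred fun w : OnePoint K => pt w ∈ S] {φ : P1 K → EReal} {r : OnePoint K → ℝ}
    (h : ∀ w ∈ fixDivisor f, pt w ∈ S → φ (pt w) = (r w : EReal)) :
    eintegral φ ((fixMeasure f).restrict S)
      = ((((fixDivisor f).filter fun w => pt w ∈ S).map r).sum : ℝ) := by
  rw [eintegral, lintegral_fixMeasure_restrict hd, lintegral_fixMeasure_restrict hd,
    ← multiset_sum_ofReal_sub]
  have h' : ∀ w ∈ (fixDivisor f).filter fun w => pt w ∈ S, φ (pt w) = (r w : EReal) := fun w hw =>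
    h w (Multiset.mem_filter.mp hw).1 (Multiset.mem_filter.mp hw).2
  congr 3
  · refine Multiset.map_congr rfl fun w hw => ?_
    rw [h' w hw, EReal.toENNReal_of_ne_top (EReal.coe_ne_top _), EReal.toReal_coe]
  · refine Multiset.map_congr rfl fun w hw => ?_
    rw [h' w hw, ← EReal.coe_neg, EReal.toENNReal_of_ne_top (EReal.coe_ne_top _), EReal.toReal_coe]

/-! ### Factorization of `[f, Id]_can` -/

theorem formAbs_multiset_prod (V : Multiset (OnePoint K)) (x : P1 K) :
    formAbs (V.map ell).prod (Multiset.card V) x = (V.map fun w => formAbs (ell w) 1 x).prod ∧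
      (V.map ell).prod.natDegree ≤ Multiset.card V := by
  induction V using Multiset.induction_on with
  | empty =>
    refine ⟨?_, by simp⟩
    have := formAbs_C (1 : K) x
    simpa using this
  | cons w V ih =>
    simp only [Multiset.map_cons, Multiset.prod_cons, Multiset.card_cons]
    rw [add_comm (Multiset.card V) 1]
    exact ⟨by rw [formAbs_mul (natDegree_ell_le w) ih.2, ih.1],
      natDegree_mul_le.trans (add_le_add (natDegree_ell_le w) ih.2)⟩

theorem fixPoly_eq_prod [IsAlgClosed K] (f : RatFunc K) :
    fixPoly f = C (fixPoly f).leadingCoeff * ((fixDivisor f).map ell).prod := by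
  conv_lhs => rw [(IsAlgClosed.splits (fixPoly f)).eq_prod_roots]
  simp [fixDivisor, Multiset.map_map, Function.comp_def]

theorem formAbs_fixPoly [IsAlgClosed K] (f : RatFunc K) (x : P1 K) :
    formAbs (fixPoly f) (deg f + 1) x = ‖(fixPoly f).leadingCoeff‖ *
      ((fixDivisor f).map fun w => formAbs (ell w) 1 x).prod := by
  conv_lhs => rw [fixPoly_eq_prod f]
  rw [formAbs_C_mul, ← (formAbs_multiset_prod _ x).1, card_fixDivisor]

/-- The constant in the factorization of `[f, Id]_can`. -/
def proxConst (f : RatFunc K) : ℝ :=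
  ‖(fixPoly f).leadingCoeff‖ * ((fixDivisor f).map fun w => coordNorm (pt w)).prod

theorem prod_coordNorm_pos (V : Multiset (OnePoint K)) :
    0 < (V.map fun w => coordNorm (pt w)).prod :=
  Multiset.prod_pos fun r hr => by
    obtain ⟨w, -, rfl⟩ := Multiset.mem_map.mp hr
    exact coordNorm_pos _

theorem proxConst_pos {f : RatFunc K} (hd : 1 < deg f) : 0 < proxConst f :=
  mul_pos (norm_pos_iff.mpr (leadingCoeff_ne_zero.mpr (fixPoly_ne_zero hd)))
    (prod_coordNorm_pos _)

theorem prod_hsia_mul (V : Multiset (OnePoint K)) (x : P1 K) :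
    (V.map fun w => hsia x (pt w)).prod * (coordNorm x ^ Multiset.card V *
      (V.map fun w => coordNorm (pt w)).prod) = (V.map fun w => formAbs (ell w) 1 x).prod := by
  have h : (V.map fun w => formAbs (ell w) 1 x).prod
      = (V.map fun w => hsia x (pt w) * (coordNorm x * coordNorm (pt w))).prod := by
    congr 1
    refine Multiset.map_congr rfl fun w _ => ?_
    have h1 := coordNorm_pos x
    have h2 := coordNorm_pos (pt w)
    rw [hsia_pt]
    field_simp
  rw [h, Multiset.prod_map_mul, Multiset.prod_map_mul, Multiset.map_const', Multiset.prod_replicate]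

theorem exp_T_one (f : RatFunc K) (x : P1 K) :
    Real.exp (T f 1 x) = liftNorm f 1 x / coordNorm x ^ deg f := by
  rw [T, pow_one, ← Real.log_pow, ← Real.log_div (liftNorm_pos f 1 x).ne'
    (pow_pos (coordNorm_pos x) _).ne', Real.exp_log]
  exact div_pos (liftNorm_pos f 1 x) (pow_pos (coordNorm_pos x) _)

theorem prox_eq [IsAlgClosed K] (f : RatFunc K) (x : P1 K) :
    prox f x = proxConst f * Real.exp (-T f 1 x) *
      ((fixDivisor f).map fun w => hsia x (pt w)).prod := by
  have h1 := coordNorm_pos x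
  have h2 := liftNorm_pos f 1 x
  rw [prox, ← liftNorm_one, formAbs_fixPoly, ← prod_hsia_mul, Real.exp_neg, exp_T_one, proxConst,
    card_fixDivisor]
  field_simp
  ring

theorem elog_mul {a : ℝ} (ha : 0 ≤ a) (b : ℝ) : elog (a * b) = elog a + elog b := by
  rw [elog, ENNReal.ofReal_mul ha, ENNReal.log_mul_add]
  rfl

theorem elog_multiset_prod {ι : Type*} (V : Multiset ι) {h : ι → ℝ} (h0 : ∀ w, 0 ≤ h w)
    (h1 : ∀ w, h w ≤ 1) :
    elog (V.map h).prod = -((V.map fun w => negLog (h w)).sum : ℝ≥0∞) := by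
  induction V using Multiset.induction_on with
  | empty =>
    simp [elog]
  | cons w V ih =>
    rw [Multiset.map_cons, Multiset.map_cons, Multiset.prod_cons, Multiset.sum_cons,
      elog_mul (h0 w), ih, elog_eq_neg_negLog (h1 w), EReal.coe_ennreal_add,
      EReal.neg_add (Or.inl (EReal.coe_ennreal_ne_bot _)) (Or.inr (EReal.coe_ennreal_ne_bot _)),
      sub_eq_add_neg]

theorem PhiProx_eq [IsAlgClosed K] (hK : KernelProps K) {f : RatFunc K} (hd : 1 < deg f)
    {g : P1 K → ℝ} {b : ℝ} (hb : ∀ x, T f 1 x + g (mapBerk f x) = deg f * g x + b) (x : P1 K) :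
    PhiProx f g x = ((Real.log (proxConst f) - b - (deg f + 1) * g x : ℝ) : EReal)
      - (((fixDivisor f).map fun w => logKer x (pt w)).sum : ℝ≥0∞) := by
  have hc := proxConst_pos hd
  have hpos : 0 < proxConst f * Real.exp (-T f 1 x) := mul_pos hc (Real.exp_pos _)
  rw [PhiProx, prox_eq, elog_mul hpos.le, elog_of_pos hpos,
    elog_multiset_prod _ (fun w => hsia_nonneg x (pt w)) (fun w => hK.hsia_le_one x (pt w)),
    Real.log_mul hc.ne' (Real.exp_pos _).ne', Real.log_exp]
  have e : Real.log (proxConst f) - b - (deg f + 1) * g x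
      = Real.log (proxConst f) + -T f 1 x + (-g (mapBerk f x) - g x) := by
    linarith [hb x]
  rw [e]
  change _ + -((((fixDivisor f).map fun w => logKer x (pt w)).sum : ℝ≥0∞) : EReal) - _ - _ = _
  generalize ((fixDivisor f).map fun w => logKer x (pt w)).sum = l
  induction l using ENNReal.recTopCoe with
  | top => simp [sub_eq_add_neg]
  | coe l =>
    have el : (((l : ℝ≥0∞)) : EReal) = ((l : ℝ) : EReal) := rfl
    rw [el]
    norm_cast
    ring

theorem lintegral_multiset_sum_logKer (hK : KernelProps K) {μ : Measure (P1 K)} {g : P1 K → ℝ}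
    {A : ℝ} (hA : HasPotential g μ A) (V : Multiset (OnePoint K)) :
    Measurable (fun x : P1 K => (V.map fun w => logKer x (pt w)).sum) ∧
    0 ≤ (V.map fun w => A - g (pt w)).sum ∧
    ∫⁻ x, (V.map fun w => logKer x (pt w)).sum ∂μ
      = ENNReal.ofReal (V.map fun w => A - g (pt w)).sum := by
  induction V using Multiset.induction_on with
  | empty => simp
  | cons w V ih =>
    obtain ⟨h1, h2, h3⟩ := ih
    have hm : Measurable fun x : P1 K => logKer x (pt w) := by
      simp only [logKer_comm _ (pt w)]
      exact hK.measurable_logKer _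
    obtain ⟨hw1, hw2⟩ := hA (pt w)
    have hw3 : 0 ≤ A - g (pt w) := sub_nonneg.mpr hw1
    simp only [Multiset.map_cons, Multiset.sum_cons]
    refine ⟨hm.add h1, add_nonneg hw3 h2, ?_⟩
    rw [lintegral_add_left hm, h3, ENNReal.ofReal_add hw3 h2, ← hw2]
    simp only [logKer_comm _ (pt w)]

theorem multiset_sum_const_sub {ι : Type*} (V : Multiset ι) (A : ℝ) (r : ι → ℝ) :
    (V.map fun w => A - r w).sum = Multiset.card V * A - (V.map r).sum := by
  rw [Multiset.sum_map_sub, Multiset.map_const', Multiset.sum_replicate, nsmul_eq_mul]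

/-- The integral of `Φ(f, Id)_g` against the equilibrium measure. -/
theorem eintegral_PhiProx [IsAlgClosed K] (hK : KernelProps K) {f : RatFunc K} (hd : 1 < deg f)
    {g : P1 K → ℝ} (hg : Continuous g) {b : ℝ}
    (hb : ∀ x, T f 1 x + g (mapBerk f x) = deg f * g x + b) {μ : Measure (P1 K)}
    [IsProbabilityMeasure μ] {A : ℝ} (hA : HasPotential g μ A) (hA0 : A + ∫ x, g x ∂μ = 0) :
    eintegral (PhiProx f g) μ = ((Real.log (proxConst f) - b
      + ((fixDivisor f).map fun w => g (pt w)).sum : ℝ) : EReal) := by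
  have hi := integrable_of_continuous hg μ
  have hi1 : Integrable (fun x => (deg f + 1) * g x) μ := hi.const_mul _
  have hi2 : Integrable (fun x => Real.log (proxConst f) - b - (deg f + 1) * g x) μ :=
    (integrable_const _).sub hi1
  have hm : Measurable (fun x => Real.log (proxConst f) - b - (deg f + 1) * g x) :=
    measurable_const.sub (hg.measurable.const_mul _)
  obtain ⟨h1, h2, h3⟩ := lintegral_multiset_sum_logKer hK hA (fixDivisor f)
  have e : PhiProx f g = fun x => ((Real.log (proxConst f) - b - (deg f + 1) * g x : ℝ) : EReal)
      - (((fixDivisor f).map fun w => logKer x (pt w)).sum : ℝ≥0∞) :=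
    funext fun x => PhiProx_eq hK hd hb x
  rw [e, eintegral_sub hi2 hm h1, h3, EReal.coe_ennreal_ofReal, max_eq_left h2, ← EReal.coe_sub,
    multiset_sum_const_sub, card_fixDivisor, integral_sub (integrable_const _) hi1,
    integral_const_mul]
  congr 1
  simp only [integral_const, probReal_univ, smul_eq_mul, one_mul]
  push_cast
  linear_combination -((deg f : ℝ) + 1) * hA0

/-! ### Classical points -/

theorem mapBerk_pt (f : RatFunc K) (c : OnePoint K) : mapBerk f (pt c) = pt (mapP1 f c) := by
  classical
  induction c using OnePoint.rec with
  | infty => rfl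
  | coe a =>
    have h1 : mapBerk f (pt (a : OnePoint K)) = if hx : (evalPt a).val f.denom = 0 then (∞ : P1 K)
      else ((pushAff f.num f.denom (evalPt a) hx : A1 K) : P1 K) := rfl
    have h2 : mapP1 f (a : OnePoint K) = if f.denom.eval a = 0 then (∞ : OnePoint K)
      else ((f.num.eval a / f.denom.eval a : K) : OnePoint K) := rfl
    have h3 : (evalPt a).val f.denom = ‖f.denom.eval a‖ := A1.val_evalPt _ _
    rw [h1, h2]
    by_cases h : f.denom.eval a = 0
    · rw [if_pos h, dif_pos (by rw [h3, h, norm_zero]), pt_infty]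
    · have hx : (evalPt a).val f.denom ≠ 0 := by rwa [h3, norm_ne_zero_iff]
      rw [if_neg h, dif_neg hx, pt_coe]
      congr 1
      refine A1.eq_evalPt_of_val_eq_zero ?_
      have e : homComp (X - C (f.num.eval a / f.denom.eval a)) 1 f.num f.denom
          = f.num - C (f.num.eval a / f.denom.eval a) * f.denom := by
        simp [homComp, Finset.sum_range_succ]
        ring
      rw [val_pushAff hx (natDegree_X_sub_C_le _), e, A1.val_evalPt]
      simp [h]

theorem hsia_pt_pt_pos {z w : OnePoint K} (h : z ≠ w) : 0 < hsia (pt z) (pt w) := by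
  rw [hsia_pt]
  refine div_pos ?_ (mul_pos (coordNorm_pos _) (coordNorm_pos _))
  induction z using OnePoint.rec with
  | infty =>
    induction w using OnePoint.rec with
    | infty => exact absurd rfl h
    | coe b => simp
  | coe a =>
    induction w using OnePoint.rec with
    | infty => simp
    | coe b =>
      have hab : a - b ≠ 0 := sub_ne_zero.mpr fun e => h (by rw [e])
      simpa using hab

theorem prox_pt (f : RatFunc K) (c : OnePoint K) :
    prox f (pt c) = hsia (pt (mapP1 f c)) (pt c) := by
  obtain ⟨s, hs, h⟩ := exists_formAbs_homComp_eq f (pt c)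
  have h1 := h X 1 natDegree_X_le
  have h2 := h 1 1 (natDegree_one.trans_le zero_le_one)
  have h3 := h (ell c) 1 (natDegree_ell_le c)
  rw [homComp_X, one_mul, pow_one] at h1
  rw [homComp_one, one_mul, pow_one] at h2
  rw [one_mul, pow_one] at h3
  have h4 : formAbs (homComp (ell c) 1 f.num f.denom) (deg f) (pt c)
      = formAbs (fixPoly f) (deg f + 1) (pt c) := by
    induction c using OnePoint.rec with
    | infty =>
      rw [ell_infty, homComp_one, pt_infty, formAbs_infty, formAbs_infty, fixPoly, coeff_sub,
        coeff_X_mul, coeff_eq_zero_of_natDegree_lt (Nat.lt_succ_of_le (natDegree_num_le f)),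
        zero_sub, norm_neg]
    | coe a =>
      simp [homComp, Finset.sum_range_succ, fixPoly]
      congr 1
      ring
  rw [prox, ← h4, h3, h1, h2, norm2_mul K hs.le, hsia_pt, ← mapBerk_pt]
  have := coordNorm_pos (mapBerk f (pt c))
  have := coordNorm_pos (pt c)
  change _ / (s * coordNorm _ * coordNorm _) = _
  field_simp

/-- The real value of `Φ_g` at distinct classical points. -/
theorem Phi_pt_pt {z w : OnePoint K} (h : z ≠ w) (g : P1 K → ℝ) : Phi g (pt z) (pt w)
    = ((Real.log (hsia (pt z) (pt w)) - g (pt z) - g (pt w) : ℝ) : EReal) := by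
  rw [Phi, elog_of_pos (hsia_pt_pt_pos h), EReal.coe_sub, EReal.coe_sub]

theorem log_multiset_prod {ι : Type*} (V : Multiset ι) {h : ι → ℝ} (h0 : ∀ w ∈ V, 0 < h w) :
    Real.log (V.map h).prod = (V.map fun w => Real.log (h w)).sum := by
  induction V using Multiset.induction_on with
  | empty => simp
  | cons w V ih =>
    have hV : ∀ w ∈ V, 0 < h w := fun u hu => h0 u (Multiset.mem_cons_of_mem hu)
    have hp : 0 < (V.map h).prod := Multiset.prod_pos fun r hr => by
      obtain ⟨u, hu, rfl⟩ := Multiset.mem_map.mp hr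
      exact hV u hu
    rw [Multiset.map_cons, Multiset.map_cons, Multiset.prod_cons, Multiset.sum_cons,
      Real.log_mul (h0 w (Multiset.mem_cons_self w V)).ne' hp.ne', ih hV]

/-- At a fixed critical point the form `F ∧ Id` vanishes to the first order, and its cofactor is
determined by the lift. -/
theorem exists_fixDivisor_eq_cons [IsAlgClosed K] {f : RatFunc K} (hd : 1 < deg f)
    {c : OnePoint K} (hc : c ∈ Crit f 1) (hfix : mapP1 f c = c) :
    ∃ V : Multiset (OnePoint K), fixDivisor f = c ::ₘ V ∧
      ‖(fixPoly f).leadingCoeff‖ * (V.map fun w => formAbs (ell w) 1 (pt c)).prod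
        * coordNorm (pt c) = liftNorm f 1 (pt c) := by
  classical
  rw [liftNorm_one]
  induction c using OnePoint.rec with
  | infty =>
    have hD : f.denom.coeff (deg f) = 0 := by
      by_contra h
      have h1 : mapP1 f (∞ : OnePoint K) = if f.denom.coeff (deg f) = 0 then (∞ : OnePoint K)
        else ((f.num.coeff (deg f) / f.denom.coeff (deg f) : K) : OnePoint K) := rfl
      rw [h1, if_neg h] at hfix
      exact OnePoint.coe_ne_infty _ hfix
    have hN : f.num.coeff (deg f) ≠ 0 := (coeff_deg_ne_zero f).resolve_right (not_not.mpr hD)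
    have hW : (wronskian (reflect (deg f ^ 1) (lift f 1).1)
        (reflect (deg f ^ 1) (lift f 1).2)).eval 0 = 0 := hc
    rw [lift_one, pow_one, wronskian, eval_sub, eval_mul, eval_mul, ← coeff_zero_eq_eval_zero,
      ← coeff_zero_eq_eval_zero, ← coeff_zero_eq_eval_zero, ← coeff_zero_eq_eval_zero,
      coeff_derivative, coeff_derivative, coeff_reflect, coeff_reflect, coeff_reflect,
      coeff_reflect, revAt_le (Nat.zero_le _), revAt_le (by omega : 0 + 1 ≤ deg f)] at hW
    simp only [Nat.sub_zero, zero_add, hD, mul_zero, sub_zero, Nat.cast_zero, mul_one,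
      mul_eq_zero, hN, false_or] at hW
    have hpd : (fixPoly f).coeff (deg f) = f.num.coeff (deg f) := by
      obtain ⟨k, hk⟩ : ∃ k, deg f = k + 1 := ⟨deg f - 1, by omega⟩
      rw [hk, Nat.add_sub_cancel] at hW
      rw [fixPoly, coeff_sub, hk, coeff_X_mul, hW, sub_zero]
    have hp1 : (fixPoly f).coeff (deg f + 1) = 0 := by
      rw [fixPoly, coeff_sub, coeff_X_mul, hD,
        coeff_eq_zero_of_natDegree_lt (Nat.lt_succ_of_le (natDegree_num_le f)), sub_zero]
    have hdeg : (fixPoly f).natDegree = deg f := by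
      refine le_antisymm ?_ (le_natDegree_of_ne_zero (by rwa [hpd]))
      by_contra h
      have h1 : (fixPoly f).natDegree = deg f + 1 :=
        le_antisymm (natDegree_fixPoly_le f) (by omega)
      rw [← h1] at hp1
      exact fixPoly_ne_zero hd (leadingCoeff_eq_zero.mp hp1)
    refine ⟨(fixPoly f).roots.map fun a : K => (a : OnePoint K), ?_, ?_⟩
    · rw [fixDivisor, hdeg, Nat.add_sub_cancel_left, Multiset.replicate_one, add_comm,
        Multiset.singleton_add]
    · rw [leadingCoeff, hdeg, hpd, Multiset.map_map, pt_infty, coordNorm_infty, mul_one,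
        formAbs_infty, formAbs_infty, hD, norm_zero, norm2_zero_right K (norm_nonneg _),
        Multiset.map_congr rfl (g := fun _ => (1 : ℝ)) fun a _ => by
          simp [coeff_X], Multiset.map_const', Multiset.prod_replicate, one_pow, mul_one]
  | coe a =>
    have hfix' : f.denom.eval a ≠ 0 ∧ f.num.eval a = a * f.denom.eval a := by
      have h1 : mapP1 f (a : OnePoint K) = if f.denom.eval a = 0 then (∞ : OnePoint K)
        else ((f.num.eval a / f.denom.eval a : K) : OnePoint K) := rfl
      rw [h1] at hfix
      by_cases h : f.denom.eval a = 0
      · rw [if_pos h] at hfix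
        exact absurd hfix.symm (OnePoint.coe_ne_infty a)
      · rw [if_neg h] at hfix
        exact ⟨h, (div_eq_iff h).mp (OnePoint.coe_injective hfix)⟩
    obtain ⟨hD, hN⟩ := hfix'
    have hW : (wronskian (lift f 1).1 (lift f 1).2).eval a = 0 := hc
    rw [lift_one, wronskian, eval_sub, eval_mul, eval_mul, hN] at hW
    have hW' : (derivative f.num).eval a = a * (derivative f.denom).eval a := by
      refine mul_right_cancel₀ hD ?_
      linear_combination -hW
    have hp' : (derivative (fixPoly f)).eval a = -f.denom.eval a := by
      rw [fixPoly, derivative_sub, derivative_mul, derivative_X, one_mul, eval_sub, eval_add,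
        eval_mul, eval_X, hW']
      ring
    have hroot : a ∈ (fixPoly f).roots := by
      rw [mem_roots (fixPoly_ne_zero hd), IsRoot.def, fixPoly, eval_sub, eval_mul, eval_X, hN,
        sub_self]
    obtain ⟨R, hR⟩ := Multiset.exists_cons_of_mem hroot
    refine ⟨R.map (fun a : K => (a : OnePoint K))
      + Multiset.replicate (deg f + 1 - (fixPoly f).natDegree) (∞ : OnePoint K), ?_, ?_⟩
    · rw [fixDivisor, hR, Multiset.map_cons, Multiset.cons_add]
    · have hfac : fixPoly f = (X - C a) *
          (C (fixPoly f).leadingCoeff * (R.map fun r => X - C r).prod) := by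
        conv_lhs => rw [(IsAlgClosed.splits (fixPoly f)).eq_prod_roots, hR, Multiset.map_cons,
          Multiset.prod_cons]
        ring
      have hev : (fixPoly f).leadingCoeff * (R.map fun r => a - r).prod = -f.denom.eval a := by
        have h1 := congrArg (fun q => (derivative q).eval a) hfac
        simp only [hp'] at h1
        rw [derivative_mul, eval_add, eval_mul, eval_mul, eval_mul, eval_C, derivative_sub,
          derivative_X, derivative_C, sub_zero, eval_one, one_mul, eval_sub, eval_X, eval_C,
          sub_self, zero_mul, add_zero, eval_multiset_prod, Multiset.map_map] at h1
        rw [h1]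
        simp
      have hnorm : ‖(fixPoly f).leadingCoeff‖ * (R.map fun r => ‖a - r‖).prod
          = ‖f.denom.eval a‖ := by
        rw [← norm_neg (f.denom.eval a), ← hev, norm_mul]
        congr 1
        have := map_multiset_prod (normHom : K →*₀ ℝ) (R.map fun r => a - r)
        rw [Multiset.map_map] at this
        exact this.symm
      have hprod : ((R.map (fun a : K => (a : OnePoint K)) + Multiset.replicate
          (deg f + 1 - (fixPoly f).natDegree) (∞ : OnePoint K)).map fun w =>
            formAbs (ell w) 1 (pt (a : OnePoint K))).prod = (R.map fun r => ‖a - r‖).prod := by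
        simp [Multiset.map_map]
      rw [hprod, hnorm, coordNorm, ← norm2_mul K (norm_nonneg _)]
      simp [hN, mul_comm]

theorem sum_Phi_add_eq [IsAlgClosed K] {f : RatFunc K} (hd : 1 < deg f) {g : P1 K → ℝ} {b : ℝ}
    (hb : ∀ x, T f 1 x + g (mapBerk f x) = deg f * g x + b) {c : OnePoint K}
    (hc : mapP1 f c ≠ c) :
    (∀ w ∈ fixDivisor f, c ≠ w) ∧
    ((fixDivisor f).map fun w => Real.log (hsia (pt c) (pt w)) - g (pt c) - g (pt w)).sum
        + (Real.log (proxConst f) - b + ((fixDivisor f).map fun w => g (pt w)).sum)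
      = Real.log (hsia (pt (mapP1 f c)) (pt c)) - g (pt (mapP1 f c)) - g (pt c) := by
  have hpos : 0 < prox f (pt c) := by
    rw [prox_pt]
    exact hsia_pt_pt_pos hc
  have hne : ∀ w ∈ fixDivisor f, c ≠ w := by
    rintro w hw rfl
    rw [prox_eq] at hpos
    have h0 : hsia (pt c) (pt c) = 0 := by
      rw [hsia_pt]
      induction c using OnePoint.rec with
      | infty => simp [coeff_one]
      | coe a => simp
    rw [Multiset.prod_eq_zero (Multiset.mem_map.mpr ⟨c, hw, h0⟩), mul_zero] at hpos
    exact lt_irrefl _ hpos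
  refine ⟨hne, ?_⟩
  have hh : ∀ w ∈ fixDivisor f, 0 < hsia (pt c) (pt w) := fun w hw => hsia_pt_pt_pos (hne w hw)
  have hprod : 0 < ((fixDivisor f).map fun w => hsia (pt c) (pt w)).prod :=
    Multiset.prod_pos fun r hr => by
      obtain ⟨u, hu, rfl⟩ := Multiset.mem_map.mp hr
      exact hh u hu
  have hc0 := proxConst_pos hd
  rw [← prox_pt, prox_eq, Real.log_mul (mul_pos hc0 (Real.exp_pos _)).ne' hprod.ne',
    Real.log_mul hc0.ne' (Real.exp_pos _).ne', Real.log_exp, log_multiset_prod _ hh,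
    Multiset.sum_map_sub, Multiset.sum_map_sub, Multiset.map_const', Multiset.sum_replicate,
    card_fixDivisor, nsmul_eq_mul, ← mapBerk_pt]
  push_cast
  linear_combination hb (pt c)

theorem sum_Phi_add_eq_zero [IsAlgClosed K] {f : RatFunc K} (hd : 1 < deg f) {g : P1 K → ℝ} {b : ℝ}
    (hb : ∀ x, T f 1 x + g (mapBerk f x) = deg f * g x + b) {c : OnePoint K}
    (hc : c ∈ Crit f 1) (hfix : mapP1 f c = c) :
    ∃ V : Multiset (OnePoint K), fixDivisor f = c ::ₘ V ∧ c ∉ V ∧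
    (V.map fun w => Real.log (hsia (pt c) (pt w)) - g (pt c) - g (pt w)).sum
        + (Real.log (proxConst f) - b + ((fixDivisor f).map fun w => g (pt w)).sum) = 0 := by
  obtain ⟨V, hV, h⟩ := exists_fixDivisor_eq_cons hd hc hfix
  have hcard : Multiset.card V = deg f := by
    have := card_fixDivisor f
    rw [hV, Multiset.card_cons] at this
    omega
  have hl := liftNorm_pos f 1 (pt c)
  have hcn := coordNorm_pos (pt c)
  have hV0 := prod_coordNorm_pos V
  have hlc : 0 < ‖(fixPoly f).leadingCoeff‖ :=
    norm_pos_iff.mpr (leadingCoeff_ne_zero.mpr (fixPoly_ne_zero hd))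
  have hprod : proxConst f * (V.map fun w => hsia (pt c) (pt w)).prod
      = Real.exp (T f 1 (pt c)) := by
    rw [exp_T_one, ← h, ← prod_hsia_mul, proxConst, hV, Multiset.map_cons, Multiset.prod_cons,
      hcard]
    field_simp
  have hpc := proxConst_pos hd
  have hp : 0 < (V.map fun w => hsia (pt c) (pt w)).prod :=
    pos_of_mul_pos_right (hprod ▸ Real.exp_pos _) hpc.le
  have hne : c ∉ V := by
    intro hcV
    have h0 : hsia (pt c) (pt c) = 0 := by
      rw [hsia_pt]
      induction c using OnePoint.rec with
      | infty => simp [coeff_one]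
      | coe a => simp
    rw [Multiset.prod_eq_zero (Multiset.mem_map.mpr ⟨c, hcV, h0⟩)] at hp
    exact lt_irrefl _ hp
  refine ⟨V, hV, hne, ?_⟩
  have hh : ∀ w ∈ V, 0 < hsia (pt c) (pt w) := fun w hw =>
    hsia_pt_pt_pos fun e => hne (e ▸ hw)
  have hlog := congrArg Real.log hprod
  rw [Real.log_exp, Real.log_mul hpc.ne' hp.ne', log_multiset_prod _ hh] at hlog
  have hbc := hb (pt c)
  rw [mapBerk_pt, hfix] at hbc
  rw [Multiset.sum_map_sub, Multiset.sum_map_sub, Multiset.map_const', Multiset.sum_replicate,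
    hcard, nsmul_eq_mul, hV, Multiset.map_cons, Multiset.sum_cons]
  linear_combination hlog + hbc

/-- The dynamical Green function satisfies the functional equation of `g_F` up to a constant. -/
theorem exists_add_mapBerk_eq [CompleteSpace K] [IsAlgClosed K] [CharZero K]
    (hK : IsUltrametricDist K ∨ ‖(2 : K)‖ = 2) {f : RatFunc K} (hd : 1 < deg f)
    {μ : Measure (P1 K)} (hμ : IsEquilibriumMeasure f μ) {g : P1 K → ℝ} {A : ℝ}
    (hA : HasPotential g μ A) : ∃ b, ∀ x, T f 1 x + g (mapBerk f x) = deg f * g x + b := by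
  have := hμ.1
  obtain ⟨B, hB⟩ := exists_hasPotential hK (continuous_gLift hd) hμ.2.2
  have h : ∀ x, g x = gLift f x + (A - B) := by
    intro x
    have h1 := (hA x).2.symm.trans (hB x).2
    rw [ENNReal.ofReal_eq_ofReal_iff (sub_nonneg.mpr (hA x).1) (sub_nonneg.mpr (hB x).1)] at h1
    linarith
  refine ⟨(1 - deg f) * (A - B), fun x => ?_⟩
  rw [h, h, gLift_mapBerk hd]
  ring

end FixedPoints

end Berkovich

end

noncomputable section

namespace Berkovich

theorem sum_filter_add_sum_filter_not {ι : Type*} (V : Multiset ι) (p : ι → Prop) [DecidablePred p]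
    (r : ι → ℝ) :
    ((V.filter fun w => ¬ p w).map r).sum + ((V.filter p).map r).sum = (V.map r).sum := by
  rw [add_comm, ← Multiset.sum_add, ← Multiset.map_add, Multiset.filter_add_not]

end Berkovich

end

theorem potential_at_critical_points {K : Type*} [NontriviallyNormedField K] [CompleteSpace K]
    [IsAlgClosed K] [CharZero K] (hK : IsUltrametricDist K ∨ ‖(2 : K)‖ = 2)
    (f : RatFunc K) (hd : 1 < Berkovich.deg f)
    (μ : Measure (Berkovich.P1 K)) (hμ : Berkovich.IsEquilibriumMeasure f μ)
    (g : Berkovich.P1 K → ℝ) (hg : Berkovich.IsDynamicalGreen μ g)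
    (c : OnePoint K) (hc : c ∈ Berkovich.Crit f 1) :
    (c ∉ Berkovich.Fix f 1 →
      Berkovich.U g ((Berkovich.fixMeasure f).restrict (Set.univ \ Berkovich.SAT f))
          (Berkovich.pt c)
        + Berkovich.eintegral (Berkovich.PhiProx f g) μ
      = Berkovich.Phi g (Berkovich.pt (Berkovich.mapP1 f c)) (Berkovich.pt c)
        - Berkovich.eintegral (fun y => Berkovich.Phi g (Berkovich.pt c) y)
            ((Berkovich.fixMeasure f).restrict (Berkovich.SAT f))) ∧
    (c ∈ Berkovich.Fix f 1 →
      Berkovich.U g ((Berkovich.fixMeasure f).restrict (Set.univ \ Berkovich.SAT f))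
          (Berkovich.pt c)
        + Berkovich.eintegral (Berkovich.PhiProx f g) μ
      = - Berkovich.eintegral (fun y => Berkovich.Phi g (Berkovich.pt c) y)
            ((Berkovich.fixMeasure f).restrict (Berkovich.SAT f \ {Berkovich.pt c}))) := by
  classical
  open Berkovich in
  obtain ⟨hgc, ⟨hprob, hreg, hlap⟩, hV⟩ := hg
  have hKer := kernelProps hK
  obtain ⟨A, hA⟩ := exists_hasPotential hK hgc hlap
  rw [hKer.V_eq hgc hreg (fun x => (hA x).1) fun x => (hA x).2] at hV
  have hA0 : A + ∫ x, g x ∂μ = 0 := by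
    have : -A - ∫ x, g x ∂μ = 0 := by exact_mod_cast hV
    linarith
  obtain ⟨b, hb⟩ := exists_add_mapBerk_eq hK hd hμ hA
  rw [eintegral_PhiProx hKer hd hgc hb hA hA0, U]
  set r : OnePoint K → ℝ := fun w => Real.log (hsia (pt c) (pt w)) - g (pt c) - g (pt w) with hr
  constructor
  · intro hfix
    have hfix' : mapP1 f c ≠ c := hfix
    obtain ⟨hne, hsum⟩ := sum_Phi_add_eq hd hb hfix'
    have hr' : ∀ w ∈ fixDivisor f, Phi g (pt c) (pt w) = (r w : EReal) := fun w hw =>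
      Phi_pt_pt (hne w hw) g
    rw [← sum_filter_add_sum_filter_not (fixDivisor f) (fun w => pt w ∈ SAT f)] at hsum
    rw [eintegral_fixMeasure_restrict hd _ fun w hw _ => hr' w hw,
      eintegral_fixMeasure_restrict hd _ fun w hw _ => hr' w hw, Phi_pt_pt hfix' g, ← hsum,
      ← EReal.coe_add, ← EReal.coe_sub]
    simp only [Set.mem_sdiff, Set.mem_univ, true_and]
    congr 1
    ring
  · intro hfix
    have hfix' : mapP1 f c = c := hfix
    have hsat : pt c ∈ SAT f := ⟨c, Set.mem_biUnion (x := 1) (by simp) ⟨hfix, hc⟩, rfl⟩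
    obtain ⟨V, hV, hcV, hsum⟩ := sum_Phi_add_eq_zero hd hb hc hfix'
    rw [eintegral_fixMeasure_restrict (r := r) hd _ fun w _ hw => Phi_pt_pt (fun e => ?_) g,
      eintegral_fixMeasure_restrict (r := r) hd _ fun w _ hw => Phi_pt_pt (fun e => ?_) g,
      ← EReal.coe_add, ← EReal.coe_neg]
    · have h1 : (fixDivisor f).filter (fun w => pt w ∈ Set.univ \ SAT f)
          = V.filter fun w => ¬ pt w ∈ SAT f := by
        rw [hV, Multiset.filter_cons_of_neg _ fun h => h.2 hsat]
        exact Multiset.filter_congr fun w _ => by simp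
      have h2 : (fixDivisor f).filter (fun w => pt w ∈ SAT f \ {pt c})
          = V.filter fun w => pt w ∈ SAT f := by
        rw [hV, Multiset.filter_cons_of_neg _ fun h => h.2 rfl]
        refine Multiset.filter_congr fun w hw => ⟨fun h => h.1, fun h => ⟨h, fun e => ?_⟩⟩
        exact hcV (pt_injective e ▸ hw)
      rw [h1, h2]
      rw [← sum_filter_add_sum_filter_not V (fun w => pt w ∈ SAT f)] at hsum
      congr 1
      linarith
    · exact hw.2 (e ▸ rfl)
    · exact hw.2 (e ▸ hsat)
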